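/- arXiv:2305.14353 — 7 statements merged into one kernel-verified Lean document; each statement's English description precedes it below -/
import Mathlib

section
/- Let c be a real number with 1 < c < e (where e is Euler's number) and let k ≥ 0 be an integer. Then there exists a natural number N such that for every integer n > N, one has n^(n - π(n)) > c^(p_{n+k}). -/
open Filter Topology MeasureTheory FourierTransform Convolution

lemma zeta_ext : ∃ G : ℂ → ℂ, ContinuousOn G {s | 1 ≤ s.re} ∧
    ∀ s : ℂ, 1 < s.re →
      LSeries (fun n => ((ArithmeticFunction.vonMangoldt n : ℝ) : ℂ)) s = G s + 1 / (s - 1) := by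
  refine ⟨ArithmeticFunction.vonMangoldt.LFunctionResidueClassAux (q := 1) 1,
    ArithmeticFunction.vonMangoldt.continuousOn_LFunctionResidueClassAux _, fun s hs => ?_⟩
  have h := ArithmeticFunction.vonMangoldt.eqOn_LFunctionResidueClassAux (q := 1) (a := 1)
    isUnit_one hs
  simp only at h
  rw [h]
  have h2 : ∀ n : ℕ, ArithmeticFunction.vonMangoldt.residueClass (1 : ZMod 1) n =
      ArithmeticFunction.vonMangoldt n := by
    intro n
    simp only [ArithmeticFunction.vonMangoldt.residueClass]
    rw [Set.indicator_of_mem]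
    exact Subsingleton.elim _ _
  simp [h2]

noncomputable def Dfun (u : ℝ) : ℝ :=
  if 0 < u then Chebyshev.psi (Real.exp u) * Real.exp (-u) - 1 else 0

lemma Dfun_meas : Measurable Dfun := by
  unfold Dfun
  refine Measurable.ite measurableSet_Ioi ?_ measurable_const
  exact ((Chebyshev.psi_mono.measurable.comp Real.measurable_exp).mul
    (Real.measurable_exp.comp measurable_neg)).sub_const 1

lemma Sfun_le (u : ℝ) : Chebyshev.psi (Real.exp u) * Real.exp (-u) ≤ Real.log 4 + 4 := by
  have h := Chebyshev.psi_le_const_mul_self (Real.exp_pos u).le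
  rw [Real.exp_neg, ← div_eq_mul_inv, div_le_iff₀ (Real.exp_pos u)]
  exact h

lemma Sfun_nonneg (u : ℝ) : 0 ≤ Chebyshev.psi (Real.exp u) * Real.exp (-u) :=
  mul_nonneg (Chebyshev.psi_nonneg _) (Real.exp_pos _).le

lemma Dfun_bound (u : ℝ) : |Dfun u| ≤ Real.log 4 + 4 := by
  have h0 := Sfun_nonneg u
  have h1 := Sfun_le u
  have h4 : 0 < Real.log 4 := Real.log_pos (by norm_num)
  unfold Dfun
  split_ifs
  · rw [abs_le]; constructor <;> linarith
  · rw [abs_zero]; linarith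

lemma integrableOn_aux (f : ℝ → ℂ) (hf : AEStronglyMeasurable f) (C : ℝ)
    (hC : ∀ u, ‖f u‖ ≤ C) (a : ℂ) (ha : a.re < 0) :
    IntegrableOn (fun u : ℝ => f u * Complex.exp (a * u)) (Set.Ioi 0) :=
  (integrableOn_exp_mul_complex_Ioi ha 0).bdd_mul hf.restrict (ae_of_all _ hC)

lemma Dfun_laplace : ∃ H : ℂ → ℂ, ContinuousOn H {s | 1 ≤ s.re} ∧
    ∀ s : ℂ, 1 < s.re →
      ∫ u in Set.Ioi (0 : ℝ), (Dfun u : ℂ) * Complex.exp (-(s - 1) * u) = H s := by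
  obtain ⟨G, hG, hGs⟩ := zeta_ext
  refine ⟨fun s => (G s - 1) / s, ?_, fun s hs => ?_⟩
  · refine (hG.sub continuousOn_const).div continuousOn_id fun s hs => ?_
    rintro rfl
    norm_num at hs
  have hs0 : s ≠ 0 := by rintro rfl; norm_num at hs
  have hs1 : s - 1 ≠ 0 := by
    intro h; rw [sub_eq_zero] at h; subst h; norm_num at hs
  have hL := LSeries_eq_mul_integral_of_nonneg (fun n => ArithmeticFunction.vonMangoldt n)
    zero_le_one hs (by
      refine Asymptotics.IsBigO.of_bound (Real.log 4 + 4) (Eventually.of_forall fun n => ?_)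
      have := Chebyshev.psi_le_const_mul_self (x := n) (by positivity)
      rw [Chebyshev.psi, Nat.floor_natCast] at this
      rw [Real.rpow_one, Real.norm_of_nonneg, Real.norm_of_nonneg (by positivity)]
      · exact this
      · exact Finset.sum_nonneg fun i _ => ArithmeticFunction.vonMangoldt_nonneg)
    (fun n => ArithmeticFunction.vonMangoldt_nonneg)
  have himg : Real.exp '' Set.Ioi 0 = Set.Ioi 1 := by
    ext y
    constructor
    · rintro ⟨x, hx, rfl⟩
      exact Real.one_lt_exp_iff.mpr hx
    · intro hy
      have hy' : (1:ℝ) < y := hy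
      exact ⟨Real.log y, Real.log_pos hy', Real.exp_log (by linarith)⟩
  rw [← himg, integral_image_eq_integral_abs_deriv_smul measurableSet_Ioi
    (fun x _ => (Real.hasDerivAt_exp x).hasDerivWithinAt) Real.exp_injective.injOn] at hL
  have hre : (-(s - 1)).re < 0 := by simp; linarith
  have e1 : ∫ u in Set.Ioi (0:ℝ), |Real.exp u| • ((∑ k ∈ Finset.Icc 1 ⌊Real.exp u⌋₊,
      ((ArithmeticFunction.vonMangoldt k : ℝ) : ℂ)) * ((Real.exp u : ℝ) : ℂ) ^ (-(s + 1))) =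
      ∫ u in Set.Ioi (0:ℝ),
        ((Chebyshev.psi (Real.exp u) * Real.exp (-u) : ℝ) : ℂ) * Complex.exp (-(s-1) * u) := by
    refine setIntegral_congr_fun measurableSet_Ioi fun u _ => ?_
    have h1 : ((Real.exp u : ℝ) : ℂ) ^ (-(s + 1)) = Complex.exp (u * (-(s+1))) := by
      rw [Complex.cpow_def_of_ne_zero (by exact_mod_cast (Real.exp_pos u).ne'),
        ← Complex.ofReal_log (Real.exp_pos u).le, Real.log_exp]
    have h2 : (∑ k ∈ Finset.Icc 1 ⌊Real.exp u⌋₊, ((ArithmeticFunction.vonMangoldt k : ℝ) : ℂ)) =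
        ((Chebyshev.psi (Real.exp u) : ℝ) : ℂ) := by
      rw [Chebyshev.psi]; push_cast; rfl
    rw [h1, h2, abs_of_pos (Real.exp_pos u), Complex.real_smul]
    push_cast
    rw [mul_left_comm, ← Complex.exp_add, mul_assoc, ← Complex.exp_add]
    congr 2
    ring
  rw [e1, hGs s hs] at hL
  have e2 : ∫ u in Set.Ioi (0:ℝ), (Dfun u : ℂ) * Complex.exp (-(s - 1) * u) =
      (∫ u in Set.Ioi (0:ℝ),
        ((Chebyshev.psi (Real.exp u) * Real.exp (-u) : ℝ) : ℂ) * Complex.exp (-(s-1) * u))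
      - ∫ u in Set.Ioi (0:ℝ), Complex.exp (-(s-1) * u) := by
    rw [← integral_sub]
    · refine setIntegral_congr_fun measurableSet_Ioi fun u hu => ?_
      simp only [Dfun, if_pos (Set.mem_Ioi.mp hu)]
      push_cast
      ring
    · refine integrableOn_aux _ ?_ (Real.log 4 + 4) ?_ _ hre
      · refine (Complex.measurable_ofReal.comp ?_).aestronglyMeasurable
        exact ((Chebyshev.psi_mono.measurable.comp Real.measurable_exp).mul
          (Real.measurable_exp.comp measurable_neg))
      · intro u
        rw [Complex.norm_real, Real.norm_of_nonneg (Sfun_nonneg u)]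
        exact Sfun_le u
    · exact integrableOn_exp_mul_complex_Ioi hre 0
  rw [e2, integral_exp_mul_complex_Ioi hre]
  generalize (∫ u in Set.Ioi (0:ℝ), ((Chebyshev.psi (Real.exp u) * Real.exp (-u) : ℝ) : ℂ) *
    Complex.exp (-(s-1) * u)) = J at hL
  have : J = (G s + 1 / (s - 1)) / s := by rw [hL]; field_simp
  rw [this]
  simp only [Complex.ofReal_zero, mul_zero, Complex.exp_zero]
  have hs2 : -(s - 1) ≠ 0 := neg_ne_zero.mpr hs1
  rw [neg_div_neg_eq]
  field_simp
  ring

lemma kernel0 : ∃ φ : ℝ → ℂ, Continuous φ ∧ HasCompactSupport φ ∧ Integrable (𝓕 φ) ∧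
    (∀ u, 0 ≤ (𝓕 φ u).re ∧ (𝓕 φ u).im = 0) ∧ φ 0 = 1 := by
  let b0 : ContDiffBump (0 : ℝ) := ⟨1, 2, by norm_num, by norm_num⟩
  let b : ℝ → ℂ := fun x => ((b0 x : ℝ) : ℂ)
  have hbs : HasCompactSupport b := b0.hasCompactSupport.comp_left Complex.ofReal_zero
  have hbd : ContDiff ℝ ((⊤ : ℕ∞) : WithTop ℕ∞) b := Complex.ofRealCLM.contDiff.comp b0.contDiff
  have hbc : Continuous b := hbd.continuous
  have hbi : Integrable b := hbc.integrable_of_hasCompactSupport hbs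
  let B : SchwartzMap ℝ ℂ := hbs.toSchwartzMap hbd
  have hFB : 𝓕 b = ⇑(𝓕 B : SchwartzMap ℝ ℂ) := by
    rw [SchwartzMap.fourier_coe]; rfl
  have hreal : ∀ u, (𝓕 b u).im = 0 := by
    intro u
    rw [← Complex.conj_eq_iff_im]
    rw [Real.fourier_eq', ← integral_conj, ← integral_neg_eq_self]
    congr 1
    ext x
    simp only [smul_eq_mul, map_mul, ← Complex.exp_conj]
    have : b (-x) = b x := by simp [b, b0.neg]
    rw [this]
    simp [b, Complex.conj_ofNat]
  let φ0 := b ⋆[ContinuousLinearMap.mul ℂ ℂ] b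
  have hF : ∀ u, 𝓕 φ0 u = 𝓕 b u * 𝓕 b u := fun u => Real.fourier_mul_convolution_eq hbi hbi u
  have hφ0c : Continuous φ0 := hbs.continuous_convolution_right _ hbi.locallyIntegrable hbc
  have hφ0s : HasCompactSupport φ0 := hbs.convolution _ hbs
  have hφ00 : φ0 0 = ((∫ t, b0 t * b0 t : ℝ) : ℂ) := by
    simp only [φ0, convolution_def]
    rw [← integral_complex_ofReal]
    congr 1
    ext t
    simp [b, b0.neg]
  have hpos : 0 < ∫ t, b0 t * b0 t := by
    refine Continuous.integral_pos_of_hasCompactSupport_nonneg_nonzero (x := 0)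
      (b0.continuous.mul b0.continuous) (b0.hasCompactSupport.mul_left) 
      (fun t => mul_self_nonneg _) ?_
    have : b0 0 = 1 := b0.one_of_mem_closedBall (by simp [b0.rIn_pos.le])
    simp [this]
  set a := ∫ t, b0 t * b0 t
  have hFφ : ∀ u, 𝓕 (fun x => (a⁻¹ : ℂ) * φ0 x) u = (a⁻¹ : ℂ) * (𝓕 b u * 𝓕 b u) := by
    intro u
    rw [← hF, Real.fourier_eq, Real.fourier_eq, ← integral_const_mul]
    congr 1
    ext x
    simp only [Circle.smul_def, smul_eq_mul]; ring
  refine ⟨fun x => (a⁻¹ : ℂ) * φ0 x, continuous_const.mul hφ0c, hφ0s.mul_left, ?_, ?_, ?_⟩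
  · have : 𝓕 (fun x => (a⁻¹ : ℂ) * φ0 x) = fun u => (a⁻¹ : ℂ) * (𝓕 b u * 𝓕 b u) := funext hFφ
    rw [this, hFB]
    refine Integrable.const_mul ?_ _
    obtain ⟨C, hC⟩ := (𝓕 B : SchwartzMap ℝ ℂ).decay 0 0
    refine (𝓕 B : SchwartzMap ℝ ℂ).integrable.bdd_mul (c := C) (𝓕 B : SchwartzMap ℝ ℂ).continuous.aestronglyMeasurable 
      (ae_of_all _ fun x => ?_)
    simpa using hC.2 x
  · intro u
    rw [hFφ]
    have : 𝓕 b u = (((𝓕 b u).re : ℝ) : ℂ) := by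
      apply Complex.ext <;> simp [hreal]
    rw [this, ← Complex.ofReal_mul, ← Complex.ofReal_inv, ← Complex.ofReal_mul]
    refine ⟨?_, Complex.ofReal_im _⟩
    rw [Complex.ofReal_re]
    exact mul_nonneg (inv_nonneg.mpr hpos.le) (mul_self_nonneg _)
  · simp only [hφ00]
    rw [inv_mul_cancel₀]
    exact_mod_cast hpos.ne'

lemma kernel (δ η : ℝ) (hδ : 0 < δ) (hη : 0 < η) : ∃ φ : ℝ → ℂ, ∃ K : ℝ → ℝ, Continuous φ ∧
    HasCompactSupport φ ∧ (∀ u, 𝓕 φ u = (K u : ℂ)) ∧ Integrable K ∧ (∀ u, 0 ≤ K u) ∧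
    ∫ u, K u = 1 ∧ ∫ u in {u | δ < |u|}, K u < η := by
  obtain ⟨φ, hc, hs, hi, hre, h0⟩ := kernel0
  let K : ℝ → ℝ := fun u => (𝓕 φ u).re
  have hK : ∀ u, 𝓕 φ u = (K u : ℂ) := fun u => by
    apply Complex.ext <;> simp [K, (hre u).2]
  have hKi : Integrable K := hi.re
  have hK0 : ∀ u, 0 ≤ K u := fun u => (hre u).1
  have hK1 : ∫ u, K u = 1 := by
    have h := congrFun (hc.fourierInv_fourier_eq (hc.integrable_of_hasCompactSupport hs) hi) 0
    rw [h0, Real.fourierInv_eq] at h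
    simp only [hK] at h
    simp at h
    rw [integral_complex_ofReal] at h
    exact_mod_cast h
  have htail : Tendsto (fun R : ℝ => ∫ u in {u | R < |u|}, K u) atTop (𝓝 0) := by
    have : ∀ R : ℝ, ∫ u in {u | R < |u|}, K u = ∫ u, Set.indicator {u | R < |u|} K u := by
      intro R
      rw [integral_indicator]
      exact measurableSet_lt measurable_const continuous_abs.measurable
    simp_rw [this]
    rw [← integral_zero ℝ ℝ]
    refine tendsto_integral_filter_of_dominated_convergence K ?_ ?_ hKi ?_
    · exact Eventually.of_forall fun R => hKi.aestronglyMeasurable.indicator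
        (measurableSet_lt measurable_const continuous_abs.measurable)
    · refine Eventually.of_forall fun R => ae_of_all _ fun u => ?_
      refine (norm_indicator_le_norm_self _ _).trans ?_
      rw [Real.norm_of_nonneg (hK0 u)]
    · refine ae_of_all _ fun u => ?_
      refine tendsto_const_nhds.congr' ?_
      filter_upwards [eventually_ge_atTop |u|] with R hR
      rw [Set.indicator_of_notMem]
      simpa using hR
  obtain ⟨R, hR, hR1⟩ := ((htail.eventually_lt_const hη).and (eventually_ge_atTop 1)).exists
  set l := R / δ with hl
  have hlpos : 0 < l := by positivity
  have hF : ∀ u, 𝓕 (fun t => φ (t / l)) u = ((l * K (u * l) : ℝ) : ℂ) := by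
    intro u
    push_cast
    rw [← hK, Real.fourier_eq, Real.fourier_eq]
    have := Measure.integral_comp_div (fun t : ℝ => (𝐞 (-(inner ℝ t (u * l))) : Circle) • φ t) l
    rw [abs_of_pos hlpos] at this
    rw [← Complex.real_smul, ← this]
    congr 1
    ext t
    congr 3
    simp
    field_simp
  refine ⟨fun t => φ (t / l), fun u => l * K (u * l), by fun_prop, ?_, hF, ?_, ?_, ?_, ?_⟩
  · simp_rw [div_eq_inv_mul]
    exact hs.comp_homeomorph (Homeomorph.mulLeft₀ l⁻¹ (inv_ne_zero hlpos.ne'))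
  · exact (hKi.comp_mul_right' hlpos.ne').const_mul l
  · exact fun u => mul_nonneg hlpos.le (hK0 _)
  · rw [integral_const_mul, Measure.integral_comp_mul_right, hK1]
    rw [abs_of_pos (by positivity)]
    simp [hlpos.ne']
  · have hm : ∀ r : ℝ, MeasurableSet {u : ℝ | r < |u|} := fun r => 
      measurableSet_lt measurable_const continuous_abs.measurable
    rw [← integral_indicator (hm _)] at hR ⊢
    have : (Set.indicator {u : ℝ | δ < |u|} fun u => l * K (u * l)) =
       fun u => l * (Set.indicator {u : ℝ | R < |u|} K) (u * l) := by
      ext u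
      have : R < |u * l| ↔ δ < |u| := by
        rw [abs_mul, abs_of_pos hlpos, hl, mul_div_assoc', lt_div_iff₀ hδ, mul_comm,
          mul_lt_mul_iff_left₀ (by linarith)]
      simp only [Set.indicator, Set.mem_ofPred_eq, this]
      split_ifs <;> simp
    rw [this, integral_const_mul, Measure.integral_comp_mul_right, abs_of_pos (by positivity)]
    simpa [hlpos.ne'] using hR

lemma core (D : ℝ → ℝ) (hD : Measurable D) (C : ℝ) (hC : ∀ u, |D u| ≤ C)
    (hD0 : ∀ u ≤ 0, D u = 0) (H : ℂ → ℂ) (hH : ContinuousOn H {s | 1 ≤ s.re})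
    (hL : ∀ s : ℂ, 1 < s.re →
      ∫ u in Set.Ioi (0 : ℝ), (D u : ℂ) * Complex.exp (-(s - 1) * u) = H s)
    (φ : ℝ → ℂ) (hφ : Continuous φ) (hφs : HasCompactSupport φ) (hφi : Integrable (𝓕 φ)) :
    Tendsto (fun x : ℝ => ∫ u, (D u : ℂ) * 𝓕 φ (u - x)) atTop (𝓝 0) := by
  have hDm : AEStronglyMeasurable (fun u => (D u : ℂ)) :=
    (Complex.measurable_ofReal.comp hD).aestronglyMeasurable
  have hDC : ∀ u, ‖(D u : ℂ)‖ ≤ C := fun u => by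
    rw [Complex.norm_real]; exact hC u
  let σ : ℝ → ℝ → ℂ := fun ε w => 1 + ε + (2 * Real.pi * w : ℝ) * Complex.I
  have hσre : ∀ ε w, (σ ε w).re = 1 + ε := by intro ε w; simp [σ]
  have hσc : Continuous fun p : ℝ × ℝ => σ p.1 p.2 := by
    simp only [σ]; fun_prop
  -- the identity for positive ε
  have hε : ∀ ε : ℝ, 0 < ε → ∀ x : ℝ,
      ∫ u, ((D u : ℂ) * Complex.exp (-ε * u)) * 𝓕 φ (u - x) =
      ∫ w, H (σ ε w) * ((𝐞 (w * x) : Circle) • φ w) := by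
    intro ε he x
    have hint : Integrable (fun u : ℝ => (D u : ℂ) * Complex.exp (-ε * u)) := by
      have h := integrableOn_aux _ hDm C hDC (-ε : ℂ) (by simpa using he)
      rw [← integrable_indicator_iff measurableSet_Ioi] at h
      refine h.congr (ae_of_all _ fun u => ?_)
      by_cases hu : 0 < u
      · rw [Set.indicator_of_mem (by exact hu)]
      · rw [Set.indicator_of_notMem (by exact hu)]
        simp [hD0 u (not_lt.mp hu)]
    have hF : ∀ w, 𝓕 (fun u : ℝ => (D u : ℂ) * Complex.exp (-ε * u)) w = H (σ ε w) := by
      intro w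
      rw [← hL _ (by rw [hσre]; linarith), Real.fourier_eq', ← integral_indicator measurableSet_Ioi]
      congr 1
      ext u
      by_cases hu : 0 < u
      · rw [Set.indicator_of_mem (by exact hu)]
        rw [smul_eq_mul, mul_left_comm, ← Complex.exp_add]
        congr 2
        simp [σ]
        ring
      · rw [Set.indicator_of_notMem (by exact hu)]
        simp [hD0 u (not_lt.mp hu)]
    have hFφ : ∀ u, 𝓕 (fun w => (𝐞 (w * x) : Circle) • φ w) u = 𝓕 φ (u - x) := by
      intro u
      rw [Real.fourier_eq, Real.fourier_eq]
      congr 1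
      ext w
      rw [smul_smul, ← AddChar.map_add_eq_mul]
      congr 3
      simp
      ring
    have hφint : Integrable (fun w => (𝐞 (w * x) : Circle) • φ w) := by
      refine Continuous.integrable_of_hasCompactSupport ?_ ?_
      · exact (Real.continuous_fourierChar.comp (by fun_prop)).smul hφ
      · exact hφs.smul_left
    have key := VectorFourier.integral_fourierIntegral_smul_eq_flip (μ := volume) (ν := volume)
      (L := innerₗ ℝ) Real.continuous_fourierChar continuous_inner hint hφint
    rw [flip_innerₗ] at key
    simp_rw [← hFφ, ← hF]
    exact key.symm
  -- let ε tend to 0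
  have h0 : ∀ x : ℝ, ∫ u, (D u : ℂ) * 𝓕 φ (u - x) =
      ∫ w, H (σ 0 w) * ((𝐞 (w * x) : Circle) • φ w) := by
    intro x
    have hl : Tendsto (fun ε : ℝ => ∫ u, ((D u : ℂ) * Complex.exp (-ε * u)) * 𝓕 φ (u - x))
        (𝓝[>] 0) (𝓝 (∫ u, (D u : ℂ) * 𝓕 φ (u - x))) := by
      refine tendsto_integral_filter_of_dominated_convergence (fun u => C * ‖𝓕 φ (u - x)‖)
        ?_ ?_ ?_ ?_
      · refine Eventually.of_forall fun ε => ?_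
        refine (hDm.mul ?_).mul (hφi.comp_sub_right x).aestronglyMeasurable
        exact (by fun_prop : Continuous fun u : ℝ => Complex.exp (-ε * u)).aestronglyMeasurable
      · filter_upwards [self_mem_nhdsWithin] with ε he
        refine ae_of_all _ fun u => ?_
        rw [norm_mul]
        gcongr
        by_cases hu : 0 < u
        · rw [norm_mul]
          have : ‖Complex.exp (-ε * u)‖ ≤ 1 := by
            rw [Complex.norm_exp]
            have he' : (0:ℝ) < ε := he
            simp
            positivity
          exact (mul_le_mul (hDC u) this (norm_nonneg _)
            ((norm_nonneg _).trans (hDC u))).trans_eq (mul_one C)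
        · simp [hD0 u (not_lt.mp hu)]
          exact (abs_nonneg _).trans (hC u)
      · exact (hφi.comp_sub_right x).norm.const_mul C
      · refine ae_of_all _ fun u => ?_
        refine tendsto_nhdsWithin_of_tendsto_nhds ?_
        have : Continuous fun ε : ℝ => ((D u : ℂ) * Complex.exp (-ε * u)) * 𝓕 φ (u - x) := by
          fun_prop
        simpa using this.tendsto 0
    have hr : Tendsto (fun ε : ℝ => ∫ w, H (σ ε w) * ((𝐞 (w * x) : Circle) • φ w))
        (𝓝[>] 0) (𝓝 (∫ w, H (σ 0 w) * ((𝐞 (w * x) : Circle) • φ w))) := by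
      have hcpt : IsCompact (Set.Icc (0:ℝ) 1 ×ˢ tsupport φ) := isCompact_Icc.prod hφs
      have hHc : ContinuousOn (fun p : ℝ × ℝ => H (σ p.1 p.2)) (Set.Ici 0 ×ˢ Set.univ) := by
        refine hH.comp hσc.continuousOn fun p hp => ?_
        have : (0:ℝ) ≤ p.1 := hp.1
        simp only [Set.mem_ofPred_eq, hσre]
        linarith
      obtain ⟨M, hM⟩ := hcpt.exists_bound_of_continuousOn
        (hHc.mono (Set.prod_mono Set.Icc_subset_Ici_self (Set.subset_univ _)))
      have hsec : ∀ ε : ℝ, 0 ≤ ε → Continuous fun w => H (σ ε w) := by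
        intro ε he
        rw [← continuousOn_univ]
        exact hHc.comp (f := fun w : ℝ => (ε, w)) (by fun_prop) fun w _ => ⟨he, trivial⟩
      have hcont : Continuous fun w => ((𝐞 (w * x) : Circle) • φ w) :=
        (Real.continuous_fourierChar.comp (by fun_prop)).smul hφ
      refine tendsto_integral_filter_of_dominated_convergence (fun w => M * ‖φ w‖) ?_ ?_ ?_ ?_
      · filter_upwards [self_mem_nhdsWithin] with ε he
        exact ((hsec ε (le_of_lt he)).mul hcont).aestronglyMeasurable
      · filter_upwards [Ioc_mem_nhdsGT (zero_lt_one (α := ℝ))] with ε he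
        refine ae_of_all _ fun w => ?_
        rw [norm_mul, Circle.norm_smul]
        by_cases hw : w ∈ tsupport φ
        · gcongr
          exact hM (ε, w) ⟨⟨he.1.le, he.2⟩, hw⟩
        · simp [image_eq_zero_of_notMem_tsupport hw]
      · exact (hφ.integrable_of_hasCompactSupport hφs).norm.const_mul M
      · refine ae_of_all _ fun w => ?_
        refine Tendsto.mul_const _ ?_
        have : ContinuousOn (fun ε : ℝ => H (σ ε w)) (Set.Ici 0) :=
          hHc.comp (f := fun ε : ℝ => (ε, w)) (by fun_prop) fun ε he => ⟨he, trivial⟩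
        exact ((this 0 (by simp)).tendsto).mono_left (nhdsWithin_mono _ Set.Ioi_subset_Ici_self)
    refine tendsto_nhds_unique hl (hr.congr' ?_)
    filter_upwards [self_mem_nhdsWithin] with ε he
    exact (hε ε he x).symm
  simp_rw [h0]
  have hRL := (Real.tendsto_integral_exp_smul_cocompact (fun w => H (σ 0 w) * φ w)).comp
    (tendsto_neg_atTop_atBot.mono_right atBot_le_cocompact)
  refine hRL.congr fun x => ?_
  simp only [Function.comp]
  congr 1
  ext w
  rw [mul_neg, neg_neg, mul_smul_comm]

lemma psi_lower (ε : ℝ) (hε : 0 < ε) (hε1 : ε < 1) :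
    ∀ᶠ x : ℝ in atTop, (1 - ε) * x ≤ Chebyshev.psi x := by
  set C := Real.log 4 + 4 with hCdef
  have hCpos : 0 < C := by
    have : 0 < Real.log 4 := Real.log_pos (by norm_num)
    linarith
  set δ := ε / 4 with hδ
  obtain ⟨φ, K, hc, hs, hF, hKi, hK0, hK1, hKt⟩ := kernel δ (ε / (4 * (C + 1)))
    (by positivity) (by positivity)
  obtain ⟨H, hH, hHs⟩ := Dfun_laplace
  have hFi : Integrable (𝓕 φ) := by
    rw [funext hF]; exact hKi.ofReal
  have h := core Dfun Dfun_meas C Dfun_bound (fun u hu => if_neg (not_lt.mpr hu)) H hH hHs φ hc hs hFi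
  have h' : Tendsto (fun x : ℝ => ∫ v, Dfun (v + x) * K v) atTop (𝓝 0) := by
    have h2 := (Complex.continuous_re.tendsto 0).comp h
    rw [Complex.zero_re] at h2
    refine h2.congr fun x => ?_
    simp only [Function.comp, hF]
    rw [← integral_add_right_eq_self _ x]
    simp only [add_sub_cancel_right, ← Complex.ofReal_mul]
    rw [integral_complex_ofReal, Complex.ofReal_re]
  have hm : MeasurableSet {u : ℝ | δ < |u|} :=
    measurableSet_lt measurable_const continuous_abs.measurable
  have hS : ∀ᶠ x : ℝ in atTop,
      (1 - ε) ≤ Chebyshev.psi (Real.exp (x + δ)) * Real.exp (-(x + δ)) := by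
    filter_upwards [h'.eventually_const_lt (show -(ε / 4) < 0 by linarith),
      eventually_gt_atTop δ] with x hx hxδ
    set S := Chebyshev.psi (Real.exp (x + δ)) * Real.exp (-(x + δ)) with hSdef
    have hS0 : 0 ≤ S := Sfun_nonneg _
    have hpt : ∀ v, Dfun (v + x) * K v ≤
        (S * Real.exp (2 * δ) - 1) * K v + (C + 1) * Set.indicator {u : ℝ | δ < |u|} K v := by
      intro v
      have hSe : 0 ≤ S * Real.exp (2 * δ) := by positivity
      by_cases hv : δ < |v|
      · rw [Set.indicator_of_mem (by exact hv), ← add_mul]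
        refine mul_le_mul_of_nonneg_right ?_ (hK0 v)
        have := (abs_le.mp (Dfun_bound (v + x))).2
        linarith
      · rw [Set.indicator_of_notMem (by exact hv), mul_zero, add_zero]
        refine mul_le_mul_of_nonneg_right ?_ (hK0 v)
        obtain ⟨hv1, hv2⟩ := abs_le.mp (not_lt.mp hv)
        rw [Dfun, if_pos (by linarith)]
        refine sub_le_sub_right ?_ 1
        rw [hSdef, mul_assoc, ← Real.exp_add]
        have h1 : Chebyshev.psi (Real.exp (v + x)) ≤ Chebyshev.psi (Real.exp (x + δ)) :=
          Chebyshev.psi_mono (Real.exp_le_exp.mpr (by linarith))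
        have h2 : Real.exp (-(v + x)) ≤ Real.exp (-(x + δ) + 2 * δ) :=
          Real.exp_le_exp.mpr (by linarith)
        exact mul_le_mul h1 h2 (Real.exp_pos _).le (Chebyshev.psi_nonneg _)
    have hi1 : Integrable (fun v => Dfun (v + x) * K v) :=
      hKi.bdd_mul (c := C) (Dfun_meas.comp (measurable_add_const x)).aestronglyMeasurable
        (ae_of_all _ fun v => Dfun_bound _)
    have hi2 : Integrable (fun v => (S * Real.exp (2 * δ) - 1) * K v) := hKi.const_mul _
    have hi3 : Integrable (fun v => (C + 1) * Set.indicator {u : ℝ | δ < |u|} K v) :=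
      (hKi.indicator hm).const_mul _
    have hle := integral_mono hi1 (hi2.add hi3) hpt
    simp only [Pi.add_apply] at hle
    rw [integral_add hi2 hi3, integral_const_mul, integral_const_mul, hK1,
      integral_indicator hm] at hle
    have ht : (C + 1) * ∫ u in {u : ℝ | δ < |u|}, K u ≤ ε / 4 := by
      calc _ ≤ (C + 1) * (ε / (4 * (C + 1))) := by gcongr
        _ = ε / 4 := by field_simp
    have hS2 : 1 - ε / 2 ≤ S * Real.exp (2 * δ) := by linarith
    have hexp : 1 - ε / 2 ≤ Real.exp (-(2 * δ)) := by
      have := Real.add_one_le_exp (-(2 * δ))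
      rw [hδ] at this ⊢
      linarith
    have : S = S * Real.exp (2 * δ) * Real.exp (-(2 * δ)) := by
      rw [mul_assoc, ← Real.exp_add]; simp
    rw [this]
    calc 1 - ε ≤ (1 - ε / 2) * (1 - ε / 2) := by nlinarith
      _ ≤ _ := mul_le_mul hS2 hexp (by linarith) (by positivity)
  have ht : Tendsto (fun x : ℝ => Real.log x - δ) atTop atTop :=
    tendsto_atTop_add_const_right _ _ Real.tendsto_log_atTop
  filter_upwards [ht.eventually hS, eventually_gt_atTop 0] with x hx hx0
  rw [sub_add_cancel, Real.exp_log hx0, Real.exp_neg, Real.exp_log hx0, ← div_eq_mul_inv,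
    le_div_iff₀ hx0] at hx
  exact hx

/-- Let `1 < c < e` and `k ≥ 0` an integer. Then there exists `N` such that for all
`n > N`, `n ^ (n - π n) > c ^ p_{n+k}`, where `p_m` is the m-th prime (`p_1 = 2`). -/
theorem stmt0 (c : ℝ) (hc1 : 1 < c) (hce : c < Real.exp 1) (k : ℕ) :
    ∃ N : ℕ, ∀ n : ℕ, n > N →
      (n : ℝ) ^ (n - n.primeCounting) > c ^ (Nat.nth Nat.Prime (n + k - 1)) := by
  have hc0 : 0 < c := by linarith
  set a := Real.log c with ha
  have ha0 : 0 < a := Real.log_pos hc1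
  have ha1 : a < 1 := by
    rw [ha, Real.log_lt_iff_lt_exp hc0]; exact hce
  obtain ⟨ε, hε, hε1, haε⟩ : ∃ ε : ℝ, 0 < ε ∧ ε < 1 ∧ a * (1 + ε) ^ 2 < (1 - ε) ^ 3 := by
    have h1 : ContinuousAt (fun ε : ℝ => (1 - ε) ^ 3 - a * (1 + ε) ^ 2) 0 := by fun_prop
    have h2 : ∀ᶠ ε in 𝓝[>] (0:ℝ), 0 < (1 - ε) ^ 3 - a * (1 + ε) ^ 2 := by
      refine (h1.tendsto.mono_left nhdsWithin_le_nhds).eventually_const_lt ?_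
      simpa using ha1
    obtain ⟨ε, h3, h4⟩ := (h2.and (Ioo_mem_nhdsGT (zero_lt_one (α := ℝ)))).exists
    exact ⟨ε, h4.1, h4.2, by linarith⟩
  let m : ℕ → ℕ := fun n => Nat.nth Nat.Prime (n + k - 1)
  have hmn : ∀ n, n ≤ m n := fun n => by
    have := Nat.add_two_le_nth_prime (n + k - 1)
    simp only [m]; omega
  have hcast : Tendsto (fun n : ℕ => (n : ℝ)) atTop atTop := tendsto_natCast_atTop_atTop
  have hm : Tendsto (fun n : ℕ => (m n : ℝ)) atTop atTop :=
    tendsto_atTop_mono (fun n => by exact_mod_cast hmn n) hcast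
  have hlog : Tendsto (fun n : ℕ => Real.log (n : ℝ)) atTop atTop :=
    Real.tendsto_log_atTop.comp hcast
  -- number of primes up to n is small
  have hpi : ∀ᶠ n : ℕ in atTop, (n.primeCounting : ℝ) ≤ ε * n := by
    filter_upwards [hcast.eventually (Chebyshev.eventually_primeCounting_le zero_lt_one),
      hlog.eventually_ge_atTop ((Real.log 4 + 1) / ε), hlog.eventually_gt_atTop 0] with n h1 h2 h3
    rw [Nat.floor_natCast] at h1
    refine h1.trans ?_
    rw [div_le_iff₀ h3]
    rw [div_le_iff₀ hε] at h2
    calc (Real.log 4 + 1) * (n : ℝ) ≤ (Real.log n * ε) * n := by gcongr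
      _ = _ := by ring
  have hlo : ∀ᶠ x : ℝ in atTop, Real.log x ≤ x ^ ε := by
    have := (isLittleO_log_rpow_atTop hε).bound zero_lt_one
    filter_upwards [this, eventually_gt_atTop 1] with x hx hx1
    rw [one_mul, Real.norm_of_nonneg (Real.log_nonneg hx1.le), Real.norm_of_nonneg (by positivity)]
      at hx
    exact hx
  have hfin : ∀ᶠ n : ℕ in atTop,
      (n : ℝ) ^ (n - n.primeCounting) > c ^ (Nat.nth Nat.Prime (n + k - 1)) := by
    filter_upwards [hpi, hm.eventually (psi_lower ε hε hε1), hm.eventually hlo,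
      hcast.eventually_ge_atTop (k / ε),
      hlog.eventually_ge_atTop ((Real.log (1 + ε) - Real.log (1 - ε)) / ε),
      hlog.eventually_gt_atTop 0, eventually_gt_atTop 1] with n h1 h2 h3 h4 h5 h6 h7
    have hn0 : (0:ℝ) < n := by exact_mod_cast (by omega : 0 < n)
    have hm1 : (1:ℝ) < m n := by exact_mod_cast h7.trans_le (hmn n)
    have hm0 : (0:ℝ) < m n := by linarith
    have hpim : (m n).primeCounting = n + k := by
      have : (m n).primeCounting = Nat.count Nat.Prime (m n + 1) := rfl
      rw [this]
      simp only [m]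
      rw [Nat.count_nth_succ_of_infinite Nat.infinite_setOfPred_prime]
      omega
    have hle : (1 - ε) * m n ≤ (n + k : ℝ) * Real.log (m n) := by
      refine h2.trans ((Chebyshev.psi_le_primeCounting_mul_log (m n)).trans_eq ?_)
      rw [hpim]; push_cast; rfl
    have hnk : (n + k : ℝ) ≤ (1 + ε) * n := by
      rw [div_le_iff₀ hε] at h4
      linarith
    have hlm0 : 0 < Real.log (m n) := Real.log_pos hm1
    have h1e : 0 < 1 - ε := by linarith
    -- bound for log m
    have hlm : (1 - ε) * Real.log (m n) ≤ (1 + ε) * Real.log n := by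
      have hA : (1 - ε) * (m n : ℝ) ^ (1 - ε) ≤ (1 + ε) * n := by
        have hB : (1 - ε) * m n ≤ ((1 + ε) * n) * (m n : ℝ) ^ ε := by
          refine hle.trans ?_
          gcongr
        rw [Real.rpow_sub hm0, Real.rpow_one, ← mul_div_assoc, div_le_iff₀ (by positivity)]
        exact hB
      have hC := Real.log_le_log (by positivity) hA
      rw [Real.log_mul h1e.ne' (by positivity), Real.log_mul (by positivity) hn0.ne',
        Real.log_rpow hm0] at hC
      rw [div_le_iff₀ hε] at h5
      linarith
    have hfinal : (m n : ℝ) * a < ((n - n.primeCounting : ℕ) : ℝ) * Real.log n := by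
      have hsub : (1 - ε) * n ≤ ((n - n.primeCounting : ℕ) : ℝ) := by
        have : ((n : ℝ) - n.primeCounting) ≤ ((n - n.primeCounting : ℕ) : ℝ) := by
          rw [sub_le_iff_le_add]
          exact_mod_cast (by omega : n ≤ n - n.primeCounting + n.primeCounting)
        linarith
      refine lt_of_lt_of_le ?_ (mul_le_mul_of_nonneg_right hsub h6.le)
      have hD : (1 - ε) ^ 2 * m n ≤ (1 + ε) ^ 2 * (n * Real.log n) := by
        calc (1 - ε) ^ 2 * (m n : ℝ) = (1 - ε) * ((1 - ε) * m n) := by ring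
          _ ≤ (1 - ε) * (((1 + ε) * n) * Real.log (m n)) := by
            exact mul_le_mul_of_nonneg_left
              (hle.trans (mul_le_mul_of_nonneg_right hnk hlm0.le)) h1e.le
          _ = ((1 + ε) * n) * ((1 - ε) * Real.log (m n)) := by ring
          _ ≤ ((1 + ε) * n) * ((1 + ε) * Real.log n) := by gcongr
          _ = _ := by ring
      have hnl : 0 < n * Real.log n := by positivity
      have hE : (1 - ε) ^ 2 * (m n * a) < (1 - ε) ^ 2 * ((1 - ε) * n * Real.log n) := by
        calc (1 - ε) ^ 2 * (m n * a) = a * ((1 - ε) ^ 2 * m n) := by ring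
          _ ≤ a * ((1 + ε) ^ 2 * (n * Real.log n)) := by gcongr
          _ = (a * (1 + ε) ^ 2) * (n * Real.log n) := by ring
          _ < (1 - ε) ^ 3 * (n * Real.log n) := by gcongr
          _ = _ := by ring
      exact lt_of_mul_lt_mul_left hE (by positivity)
    change c ^ (m n) < (n : ℝ) ^ (n - n.primeCounting)
    rw [← Real.log_lt_log_iff (by positivity) (by positivity), Real.log_pow, Real.log_pow]
    exact hfinal
  obtain ⟨N, hN⟩ := eventually_atTop.mp hfin
  exact ⟨N, fun n hn => hN n hn.le⟩
end

section
/- Let c be a real number with 1 < c < e (where e is Euler's number) and let k ≥ 0 be an integer. Then there exists a natural number N such that for every integer n ≥ N, the product of the first n primes satisfies ∏_{j ≤ n} p_j > c^(p_{n+k}). -/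
open Real MeasureTheory Filter Topology

namespace PNTaux

/-- Normalised Chebyshev error in logarithmic variable. -/
noncomputable def aa (u : ℝ) : ℝ := Chebyshev.psi (exp u) * exp (-u) - 1

/-- Upper bound constant. -/
noncomputable def MM : ℝ := log 4 + 4

lemma MM_ge : 4 ≤ MM := by
  have : 0 ≤ log 4 := log_nonneg (by norm_num)
  unfold MM; linarith

lemma aa_le (u : ℝ) : aa u ≤ MM := by
  have h := Chebyshev.psi_le_const_mul_self (exp_pos u).le
  have h2 : Chebyshev.psi (exp u) * exp (-u) ≤ (log 4 + 4) * exp u * exp (-u) :=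
    mul_le_mul_of_nonneg_right h (exp_pos _).le
  rw [mul_assoc, ← exp_add, add_neg_cancel, exp_zero, mul_one] at h2
  unfold aa MM; linarith

lemma aa_ge (u : ℝ) : -1 ≤ aa u := by
  have := mul_nonneg (Chebyshev.psi_nonneg (exp u)) (exp_pos (-u)).le
  unfold aa; linarith

lemma abs_aa_le (u : ℝ) : |aa u| ≤ MM := by
  have := MM_ge
  exact abs_le.2 ⟨by linarith [aa_ge u], aa_le u⟩

lemma measurable_aa : Measurable aa := by
  unfold aa
  have h : Measurable Chebyshev.psi := Chebyshev.psi_mono.measurable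
  fun_prop

/-- The continuous extension. -/
noncomputable def GG (s : ℂ) : ℂ :=
  (ArithmeticFunction.vonMangoldt.LFunctionResidueClassAux (1 : ZMod 1) s - 1) / s

lemma continuousOn_GG : ContinuousOn GG {s | 1 ≤ s.re} := by
  unfold GG
  refine ((ArithmeticFunction.vonMangoldt.continuousOn_LFunctionResidueClassAux
    (1 : ZMod 1)).sub continuousOn_const).div continuousOn_id ?_
  intro s hs h
  have h' : s = 0 := h
  subst h'
  simp at hs
  linarith

lemma psi_isBigO : (fun n : ℕ => ∑ k ∈ Finset.Icc 1 n, ArithmeticFunction.vonMangoldt k)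
    =O[atTop] fun n : ℕ => (n : ℝ) ^ (1 : ℝ) := by
  refine Asymptotics.IsBigO.of_bound MM ?_
  filter_upwards with n
  have h := Chebyshev.psi_le_const_mul_self (Nat.cast_nonneg (α := ℝ) n)
  have h0 := Chebyshev.psi_nonneg n
  have e : Chebyshev.psi n = ∑ k ∈ Finset.Icc 1 n, ArithmeticFunction.vonMangoldt k := by
    unfold Chebyshev.psi
    rw [Nat.floor_natCast]
    rfl
  rw [← e, rpow_one, norm_of_nonneg h0, norm_of_nonneg (Nat.cast_nonneg n)]
  exact h

lemma integrable_aa {σ : ℝ} (hσ : 0 < σ) :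
    Integrable (fun u : ℝ => ((aa u * exp (-σ * u) : ℝ) : ℂ)) (volume.restrict (Set.Ioi 0)) := by
  apply Integrable.ofReal
  refine Integrable.bdd_mul (c := MM) ?_ measurable_aa.aestronglyMeasurable ?_
  · exact integrableOn_exp_mul_Ioi (by linarith) 0
  · filter_upwards with u
    exact abs_aa_le u

lemma laplace {z : ℂ} (hz : 0 < z.re) :
    ∫ u in Set.Ioi (0 : ℝ), (aa u : ℂ) * Complex.exp (-z * u) = GG (1 + z) := by
  have hz0 : z ≠ 0 := by rintro rfl; simp at hz
  have hs : (1 : ℝ) < (1 + z).re := by simp [hz]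
  have hs0 : 1 + z ≠ 0 := by
    intro h; rw [h] at hs; simp at hs; linarith
  have h1 := LSeries_eq_mul_integral_of_nonneg (fun n => ArithmeticFunction.vonMangoldt n)
    zero_le_one hs psi_isBigO (fun n => ArithmeticFunction.vonMangoldt_nonneg)
  have h2 := ArithmeticFunction.vonMangoldt.eqOn_LFunctionResidueClassAux
    (q := 1) (a := 1) isUnit_one hs
  have h3 : (fun n => ((ArithmeticFunction.vonMangoldt.residueClass (1 : ZMod 1) n : ℝ) : ℂ))
      = fun n => ((ArithmeticFunction.vonMangoldt n : ℝ) : ℂ) := by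
    ext n
    congr 1
    rw [ArithmeticFunction.vonMangoldt.residueClass, Set.indicator_of_mem]
    exact Subsingleton.elim _ _
  have himg : exp '' Set.Ioi 0 = Set.Ioi (1 : ℝ) := by
    ext x
    constructor
    · rintro ⟨y, hy, rfl⟩
      simpa using hy
    · intro hx
      have hx' : (1 : ℝ) < x := hx
      exact ⟨log x, log_pos hx', exp_log (by linarith)⟩
  have h4 : ∫ t in Set.Ioi (1 : ℝ), (∑ k ∈ Finset.Icc 1 ⌊t⌋₊,
        ((ArithmeticFunction.vonMangoldt k : ℝ) : ℂ)) * (t : ℂ) ^ (-((1 + z) + 1))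
      = ∫ u in Set.Ioi (0 : ℝ), ((Chebyshev.psi (exp u) * exp (-u) : ℝ) : ℂ)
          * Complex.exp (-z * u) := by
    rw [← himg, integral_image_eq_integral_abs_deriv_smul (f' := exp) measurableSet_Ioi
      (fun x _ => (hasDerivAt_exp x).hasDerivWithinAt) exp_injective.injOn]
    refine setIntegral_congr_fun measurableSet_Ioi fun u _ => ?_
    have e : ((Chebyshev.psi (exp u) : ℝ) : ℂ) = ∑ k ∈ Finset.Icc 1 ⌊exp u⌋₊,
        ((ArithmeticFunction.vonMangoldt k : ℝ) : ℂ) := by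
      unfold Chebyshev.psi
      push_cast
      rfl
    simp only [← e, abs_of_pos (exp_pos u), Complex.real_smul]
    rw [Complex.cpow_def_of_ne_zero (by exact_mod_cast (exp_pos u).ne'), ← Complex.ofReal_log
      (exp_pos u).le, log_exp]
    push_cast
    have : Complex.exp u * (Chebyshev.psi (exp u) * Complex.exp (u * -((1 + z) + 1)))
      = Chebyshev.psi (exp u) * (Complex.exp u * Complex.exp (u * -((1 + z) + 1))) := by ring
    rw [this, mul_assoc, ← Complex.exp_add, ← Complex.exp_add]
    congr 2
    ring
  rw [h3] at h2
  simp only [Nat.totient_one, Nat.cast_one, inv_one, add_sub_cancel_left] at h2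
  have hexp : IntegrableOn (fun u : ℝ => Complex.exp (-z * u)) (Set.Ioi 0) :=
    integrableOn_exp_mul_complex_Ioi (by simpa using hz) 0
  have hE : ∫ u in Set.Ioi (0 : ℝ), Complex.exp (-z * u) = 1 / z := by
    rw [integral_exp_mul_complex_Ioi (by simpa using hz)]
    simp
  have hA : IntegrableOn (fun u : ℝ => (aa u : ℂ) * Complex.exp (-z * u)) (Set.Ioi 0) := by
    refine Integrable.bdd_mul (c := MM) hexp
      (Complex.measurable_ofReal.comp measurable_aa).aestronglyMeasurable ?_
    filter_upwards with u
    rw [Complex.norm_real]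
    exact abs_aa_le u
  have h5 : ∫ u in Set.Ioi (0 : ℝ), ((Chebyshev.psi (exp u) * exp (-u) : ℝ) : ℂ)
          * Complex.exp (-z * u)
      = (∫ u in Set.Ioi (0 : ℝ), (aa u : ℂ) * Complex.exp (-z * u)) + 1 / z := by
    rw [← hE, ← integral_add hA hexp]
    refine setIntegral_congr_fun measurableSet_Ioi fun u _ => ?_
    simp only [aa]
    push_cast
    ring
  rw [h4, h5] at h1
  unfold GG
  rw [h2, h1]
  field_simp
  ring

end PNTaux
namespace PNTaux

/-- The Fejer kernel. -/
noncomputable def KF (l v : ℝ) : ℝ := 2 * (1 - cos (l * v)) / (l * v ^ 2)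

/-- The Fejer kernel as an integral. -/
noncomputable def KI (l v : ℝ) : ℂ :=
  ∫ t in Set.Ioc (-l) l, ((1 - |t| / l : ℝ) : ℂ) * Complex.exp (Complex.I * t * v)

lemma KI_eq {l v : ℝ} (hl : 0 < l) (hv : v ≠ 0) : KI l v = (KF l v : ℂ) := by
  have hlC : (l : ℂ) ≠ 0 := by exact_mod_cast hl.ne'
  have hvC : (v : ℂ) ≠ 0 := by exact_mod_cast hv
  set c : ℂ := Complex.I * v with hc
  have hc0 : c ≠ 0 := mul_ne_zero Complex.I_ne_zero hvC
  have hcont : Continuous fun t : ℝ =>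
      ((1 - |t| / l : ℝ) : ℂ) * Complex.exp (Complex.I * t * v) := by fun_prop
  have hexp (t : ℝ) : HasDerivAt (fun t : ℝ => Complex.exp (c * t)) (c * Complex.exp (c * t)) t := by
    have := ((hasDerivAt_id (t : ℂ)).const_mul c).cexp.comp_ofReal
    simpa [mul_comm] using this
  have hid (t : ℝ) : HasDerivAt (fun t : ℝ => (t : ℂ)) 1 t := Complex.ofRealCLM.hasDerivAt
  have h1 : ∫ t in (0 : ℝ)..l, ((1 - |t| / l : ℝ) : ℂ) * Complex.exp (Complex.I * t * v)
      = Complex.exp (c * l) / (l * c ^ 2) - (1 / c + 1 / (l * c ^ 2)) := by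
    have e : ∫ t in (0 : ℝ)..l, ((1 - |t| / l : ℝ) : ℂ) * Complex.exp (Complex.I * t * v)
        = ∫ t in (0 : ℝ)..l, (1 - (t : ℂ) / l) * Complex.exp (c * t) := by
      refine intervalIntegral.integral_congr fun t ht => ?_
      rw [Set.uIcc_of_le hl.le] at ht
      simp only [abs_of_nonneg ht.1]
      push_cast
      congr 2
      rw [hc]; ring
    rw [e, intervalIntegral.integral_eq_sub_of_hasDerivAt
      (f := fun t : ℝ => (1 - (t : ℂ) / l) * Complex.exp (c * t) / c
        + Complex.exp (c * t) / (l * c ^ 2))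
      (f' := fun t : ℝ => (1 - (t : ℂ) / l) * Complex.exp (c * t))]
    · simp [hlC]
    · intro t _
      have := ((((hid t).div_const (l : ℂ)).const_sub 1).mul (hexp t)).div_const c
      have := this.add ((hexp t).div_const (l * c ^ 2))
      convert! this using 1
      field_simp
      ring
    · apply Continuous.intervalIntegrable
      fun_prop
  have h2 : ∫ t in (-l)..(0 : ℝ), ((1 - |t| / l : ℝ) : ℂ) * Complex.exp (Complex.I * t * v)
      = (1 / c - 1 / (l * c ^ 2)) + Complex.exp (-(c * l)) / (l * c ^ 2) := by
    have e : ∫ t in (-l)..(0 : ℝ), ((1 - |t| / l : ℝ) : ℂ) * Complex.exp (Complex.I * t * v)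
        = ∫ t in (-l)..(0 : ℝ), (1 + (t : ℂ) / l) * Complex.exp (c * t) := by
      refine intervalIntegral.integral_congr fun t ht => ?_
      rw [Set.uIcc_of_le (by linarith)] at ht
      simp only [abs_of_nonpos ht.2]
      push_cast
      rw [hc, neg_div, sub_neg_eq_add]
      congr 2
      ring
    rw [e, intervalIntegral.integral_eq_sub_of_hasDerivAt
      (f := fun t : ℝ => (1 + (t : ℂ) / l) * Complex.exp (c * t) / c
        - Complex.exp (c * t) / (l * c ^ 2))
      (f' := fun t : ℝ => (1 + (t : ℂ) / l) * Complex.exp (c * t))]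
    · simp [hlC]
    · intro t _
      have := ((((hid t).div_const (l : ℂ)).const_add 1).mul (hexp t)).div_const c
      have := this.sub ((hexp t).div_const (l * c ^ 2))
      convert! this using 1
      field_simp
      ring
    · apply Continuous.intervalIntegrable
      fun_prop
  unfold KI KF
  rw [← intervalIntegral.integral_of_le (by linarith),
    ← intervalIntegral.integral_add_adjacent_intervals (b := 0)
      (hcont.intervalIntegrable _ _) (hcont.intervalIntegrable _ _), h1, h2]
  push_cast
  rw [Complex.cos]
  have e1 : c * l = l * v * Complex.I := by rw [hc]; ring
  have e2 : -(l * v : ℂ) * Complex.I = -(l * v * Complex.I) := by ring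
  have e3 : c ^ 2 = - (v : ℂ) ^ 2 := by rw [hc, mul_pow, Complex.I_sq]; ring
  rw [e1, e2, e3]
  field_simp
  ring

lemma KF_nonneg {l : ℝ} (hl : 0 < l) (v : ℝ) : 0 ≤ KF l v := by
  unfold KF
  have := cos_le_one (l * v)
  apply div_nonneg <;> [linarith; positivity]

lemma KF_le_one {l : ℝ} (hl : 0 < l) (v : ℝ) : KF l v ≤ l := by
  unfold KF
  rcases eq_or_ne v 0 with rfl | hv
  · simpa using hl.le
  have := one_sub_sq_div_two_le_cos (x := l * v)
  rw [div_le_iff₀ (by positivity)]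
  nlinarith

lemma KF_le_two {l : ℝ} (hl : 0 < l) (v : ℝ) : KF l v ≤ 4 / (l * v ^ 2) := by
  unfold KF
  have := neg_one_le_cos (l * v)
  gcongr
  linarith

lemma KF_mul_le {l : ℝ} (hl : 0 < l) (v : ℝ) : KF l v * v ^ 2 ≤ 4 / l := by
  rcases eq_or_ne v 0 with rfl | hv
  · simp; positivity
  have := KF_le_two hl v
  calc KF l v * v ^ 2 ≤ 4 / (l * v ^ 2) * v ^ 2 := by gcongr
    _ = 4 / l := by field_simp

lemma KF_le {l : ℝ} (hl : 0 < l) (v : ℝ) : KF l v ≤ (l + 4 / l) * (1 + v ^ 2)⁻¹ := by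
  rw [← div_eq_mul_inv, le_div_iff₀ (by positivity)]
  nlinarith [KF_mul_le hl v, KF_le_one hl v]

lemma KF_ge {l v : ℝ} (hl : 0 < l) (hv : v ≠ 0) (h : |v| ≤ 1 / l) : 4 / π ^ 2 * l ≤ KF l v := by
  have h1 : |l * v| ≤ π := by
    rw [abs_mul, abs_of_pos hl]
    have : l * |v| ≤ l * (1 / l) := by gcongr
    rw [mul_one_div_cancel hl.ne'] at this
    linarith [pi_gt_three]
  have h2 := cos_le_one_sub_mul_cos_sq h1
  unfold KF
  rw [le_div_iff₀ (by positivity)]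
  have : 4 / π ^ 2 * l * (l * v ^ 2) = 2 * (2 / π ^ 2 * (l * v) ^ 2) := by ring
  rw [this]
  linarith

lemma measurable_KF (l : ℝ) : Measurable (KF l) := by
  unfold KF; fun_prop

lemma integrable_KF {l : ℝ} (hl : 0 < l) (x : ℝ) : Integrable fun u => KF l (x - u) := by
  have h : Integrable (KF l) := by
    refine (integrable_inv_one_add_sq.const_mul (l + 4 / l)).mono'
      (measurable_KF l).aestronglyMeasurable ?_
    filter_upwards with v
    rw [norm_of_nonneg (KF_nonneg hl v)]
    exact KF_le hl v
  exact h.comp_sub_left x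

lemma fub {l σ : ℝ} (hl : 0 < l) (hσ : 0 < σ) (x : ℝ) :
    ∫ t in Set.Ioc (-l) l, ((1 - |t| / l : ℝ) : ℂ) * Complex.exp (Complex.I * t * x)
        * GG (1 + (σ + Complex.I * t))
      = ∫ u in Set.Ioi (0 : ℝ), ((aa u * exp (-σ * u) * KF l (x - u) : ℝ) : ℂ) := by
  set f : ℝ → ℝ → ℂ := fun t u => (((1 - |t| / l : ℝ) : ℂ) * Complex.exp (Complex.I * t * x))
      * ((aa u * exp (-σ * u) : ℝ) : ℂ) * Complex.exp (-(Complex.I * t * u)) with hf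
  have hcont : Continuous fun t : ℝ =>
      ((1 - |t| / l : ℝ) : ℂ) * Complex.exp (Complex.I * t * x) := by fun_prop
  have hi1 : Integrable (fun t : ℝ =>
      ((1 - |t| / l : ℝ) : ℂ) * Complex.exp (Complex.I * t * x))
      (volume.restrict (Set.Ioc (-l) l)) :=
    (hcont.integrableOn_Icc (a := -l) (b := l)).mono_set Set.Ioc_subset_Icc_self
  have hint : Integrable (Function.uncurry f)
      ((volume.restrict (Set.Ioc (-l) l)).prod (volume.restrict (Set.Ioi 0))) := by
    refine Integrable.mul_bdd (c := 1) (hi1.mul_prod (integrable_aa hσ)) ?_ ?_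
    · apply Continuous.aestronglyMeasurable
      fun_prop
    · filter_upwards with p
      rw [Complex.norm_exp]
      simp
  have hsw := integral_integral_swap hint
  have hL (t : ℝ) : ∫ u in Set.Ioi (0 : ℝ), f t u
      = ((1 - |t| / l : ℝ) : ℂ) * Complex.exp (Complex.I * t * x)
        * GG (1 + (σ + Complex.I * t)) := by
    rw [← laplace (z := σ + Complex.I * t) (by simpa using hσ), ← integral_const_mul]
    refine setIntegral_congr_fun measurableSet_Ioi fun u _ => ?_
    simp only [hf]
    rw [mul_assoc]
    congr 1
    push_cast
    rw [mul_assoc, ← Complex.exp_add]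
    congr 2
    ring
  have hR (u : ℝ) (hu : u ≠ x) : ∫ t in Set.Ioc (-l) l, f t u
      = ((aa u * exp (-σ * u) * KF l (x - u) : ℝ) : ℂ) := by
    rw [Complex.ofReal_mul, ← KI_eq hl (sub_ne_zero.2 hu.symm), KI, ← integral_const_mul]
    refine setIntegral_congr_fun measurableSet_Ioc fun t _ => ?_
    simp only [hf]
    have : Complex.exp (Complex.I * t * ((x - u : ℝ) : ℂ))
        = Complex.exp (Complex.I * t * x) * Complex.exp (-(Complex.I * t * u)) := by
      rw [← Complex.exp_add]
      congr 1
      push_cast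
      ring
    rw [this]
    ring
  simp only [hL] at hsw
  rw [hsw]
  apply integral_congr_ae
  have : ∀ᵐ u : ℝ, u ≠ x := by
    rw [ae_iff]; simp
  filter_upwards [ae_restrict_of_ae this] with u hu using hR u hu

lemma lim_right {l : ℝ} (hl : 0 < l) (x : ℝ) :
    Tendsto (fun σ : ℝ => ∫ u in Set.Ioi (0 : ℝ), ((aa u * exp (-σ * u) * KF l (x - u) : ℝ) : ℂ))
      (𝓝[>] 0) (𝓝 (∫ u in Set.Ioi (0 : ℝ), ((aa u * KF l (x - u) : ℝ) : ℂ))) := by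
  refine tendsto_integral_filter_of_dominated_convergence (fun u => MM * KF l (x - u)) ?_ ?_ ?_ ?_
  · filter_upwards with σ
    have h1 := measurable_aa
    have h2 := measurable_KF l
    apply Measurable.aestronglyMeasurable
    fun_prop
  · filter_upwards [self_mem_nhdsWithin] with σ hσ
    have hσ' : 0 < σ := hσ
    filter_upwards [ae_restrict_mem measurableSet_Ioi] with u hu
    have hu' : 0 < u := hu
    rw [Complex.norm_real, norm_mul, norm_mul, norm_of_nonneg (KF_nonneg hl _),
      norm_of_nonneg (exp_pos _).le]
    have h1 : exp (-σ * u) ≤ 1 := by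
      rw [exp_le_one_iff]; nlinarith
    have h2 : ‖aa u‖ ≤ MM := abs_aa_le u
    have h3 : ‖aa u‖ * exp (-σ * u) ≤ MM * 1 := by
      have := MM_ge
      gcongr
    rw [mul_one] at h3
    exact mul_le_mul_of_nonneg_right h3 (KF_nonneg hl _)
  · exact ((integrable_KF hl x).const_mul _).integrableOn
  · filter_upwards with u
    apply tendsto_nhdsWithin_of_tendsto_nhds
    have : Continuous fun σ : ℝ => ((aa u * exp (-σ * u) * KF l (x - u) : ℝ) : ℂ) := by fun_prop
    have := this.tendsto 0
    simpa using this

lemma lim_left {l : ℝ} (hl : 0 < l) (x : ℝ) :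
    Tendsto (fun σ : ℝ => ∫ t in Set.Ioc (-l) l,
        ((1 - |t| / l : ℝ) : ℂ) * Complex.exp (Complex.I * t * x) * GG (1 + (σ + Complex.I * t)))
      (𝓝[>] 0) (𝓝 (∫ t in Set.Ioc (-l) l,
        ((1 - |t| / l : ℝ) : ℂ) * Complex.exp (Complex.I * t * x) * GG (1 + Complex.I * t))) := by
  have hmap : ContinuousOn (fun p : ℝ × ℝ => GG (1 + (p.1 + Complex.I * p.2)))
      (Set.Ici 0 ×ˢ Set.univ) := by
    refine continuousOn_GG.comp (Continuous.continuousOn (by fun_prop)) ?_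
    rintro ⟨p, q⟩ ⟨hp, -⟩
    simpa using hp
  have hcpt : IsCompact (Set.Icc (0 : ℝ) 1 ×ˢ Set.Icc (-l) l) := isCompact_Icc.prod isCompact_Icc
  obtain ⟨C, hC⟩ := hcpt.exists_bound_of_continuousOn (hmap.mono
    (Set.prod_mono Set.Icc_subset_Ici_self (Set.subset_univ _)))
  have hcont : Continuous fun t : ℝ =>
      ((1 - |t| / l : ℝ) : ℂ) * Complex.exp (Complex.I * t * x) := by fun_prop
  refine tendsto_integral_filter_of_dominated_convergence (fun u => C) ?_ ?_ ?_ ?_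
  · filter_upwards [self_mem_nhdsWithin] with σ hσ
    have hσ' : 0 < σ := hσ
    have : Continuous fun t : ℝ => GG (1 + (σ + Complex.I * t)) := by
      rw [← continuousOn_univ]
      refine hmap.comp (f := fun t : ℝ => (σ, t)) (by fun_prop) ?_
      intro t _
      exact ⟨hσ'.le, trivial⟩
    exact (hcont.mul this).aestronglyMeasurable
  · have : ∀ᶠ σ : ℝ in 𝓝[>] 0, σ < 1 :=
      nhdsWithin_le_nhds (eventually_lt_nhds one_pos)
    filter_upwards [self_mem_nhdsWithin, this] with σ hσ hσ1
    filter_upwards [ae_restrict_mem measurableSet_Ioc] with t ht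
    have h1 := hC (σ, t) ⟨⟨le_of_lt hσ, hσ1.le⟩, Set.Ioc_subset_Icc_self ht⟩
    have h2 : ‖((1 - |t| / l : ℝ) : ℂ) * Complex.exp (Complex.I * t * x)‖ ≤ 1 := by
      have ht' : |t| ≤ l := abs_le.2 ⟨ht.1.le, ht.2⟩
      have h3 : |t| / l ≤ 1 := (div_le_one hl).2 ht'
      have h4 : 0 ≤ |t| / l := by positivity
      rw [norm_mul, Complex.norm_real, Complex.norm_exp, norm_of_nonneg (by linarith)]
      simp
      exact h4
    rw [norm_mul]
    calc _ ≤ 1 * C := by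
          apply mul_le_mul h2 h1 (norm_nonneg _) zero_le_one
      _ = C := one_mul C
  · exact integrable_const _
  · filter_upwards with t
    have h0 : ContinuousOn (fun σ : ℝ => GG (1 + (σ + Complex.I * t))) (Set.Ici 0) := by
      refine hmap.comp (f := fun σ : ℝ => (σ, t)) (by fun_prop) ?_
      intro σ hσ
      exact ⟨hσ, trivial⟩
    have h1 := (h0 0 Set.self_mem_Ici).tendsto.mono_left (nhdsWithin_mono 0 Set.Ioi_subset_Ici_self)
    have h2 := h1.const_mul (((1 - |t| / l : ℝ) : ℂ) * Complex.exp (Complex.I * t * x))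
    simpa using h2

lemma conv_eq {l : ℝ} (hl : 0 < l) (x : ℝ) :
    ((∫ u in Set.Ioi (0 : ℝ), aa u * KF l (x - u) : ℝ) : ℂ) = ∫ t in Set.Ioc (-l) l,
        ((1 - |t| / l : ℝ) : ℂ) * Complex.exp (Complex.I * t * x) * GG (1 + Complex.I * t) := by
  rw [← integral_complex_ofReal]
  refine tendsto_nhds_unique (lim_right hl x) ((lim_left hl x).congr' ?_)
  filter_upwards [self_mem_nhdsWithin] with σ hσ
  exact fub hl hσ x

lemma conv_tendsto {l : ℝ} (hl : 0 < l) :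
    Tendsto (fun x => ∫ u in Set.Ioi (0 : ℝ), aa u * KF l (x - u)) atTop (𝓝 0) := by
  have h := Real.tendsto_integral_exp_smul_cocompact
    ((Set.Ioc (-l) l).indicator fun t : ℝ => ((1 - |t| / l : ℝ) : ℂ) * GG (1 + Complex.I * t))
  have h2 : Tendsto (fun x : ℝ => x * (-(2 * π)⁻¹)) atTop (cocompact ℝ) :=
    (tendsto_id.atTop_mul_const_of_neg (by simp; positivity)).mono_right atBot_le_cocompact
  have h3 := h.comp h2
  rw [← Complex.ofReal_zero] at h3
  have key : Tendsto (fun x => ((∫ u in Set.Ioi (0 : ℝ), aa u * KF l (x - u) : ℝ) : ℂ)) atTop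
      (𝓝 ((0 : ℝ) : ℂ)) := by
    refine h3.congr fun x => ?_
    rw [conv_eq hl, ← integral_indicator measurableSet_Ioc]
    refine integral_congr_ae (Eventually.of_forall fun t => ?_)
    simp only
    by_cases ht : t ∈ Set.Ioc (-l) l
    · rw [Set.indicator_of_mem ht, Set.indicator_of_mem ht, Circle.smul_def,
        Real.fourierChar_apply, smul_eq_mul]
      have : (2 * π * -(t * (x * -(2 * π)⁻¹)) : ℝ) = t * x := by
        have := pi_pos
        field_simp
      rw [this]
      have : ((t * x : ℝ) : ℂ) * Complex.I = Complex.I * t * x := by push_cast; ring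
      rw [this]
      ring
    · rw [Set.indicator_of_notMem ht, Set.indicator_of_notMem ht, smul_zero]
  exact_mod_cast (Complex.continuous_re.tendsto _).comp key

end PNTaux
namespace PNTaux

lemma aa_near {ε x₀ u : ℝ} (hε : 0 < ε) (hε1 : ε < 1) (h : aa x₀ ≤ -ε) (h1 : u ≤ x₀)
    (h2 : x₀ - ε / 2 ≤ u) : aa u ≤ -(ε / 2) := by
  unfold aa at h ⊢
  have hm : Chebyshev.psi (exp u) ≤ Chebyshev.psi (exp x₀) :=
    Chebyshev.psi_mono (exp_le_exp.2 h1)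
  have e1 : Chebyshev.psi (exp x₀) ≤ (1 - ε) * exp x₀ := by
    have : Chebyshev.psi (exp x₀) = (Chebyshev.psi (exp x₀) * exp (-x₀)) * exp x₀ := by
      rw [mul_assoc, ← exp_add, neg_add_cancel, exp_zero, mul_one]
    rw [this]
    gcongr
    linarith
  have e2 : Chebyshev.psi (exp u) * exp (-u) ≤ (1 - ε) * exp (ε / 2) := by
    calc _ ≤ (1 - ε) * exp x₀ * exp (-u) := by gcongr; linarith
      _ = (1 - ε) * exp (x₀ - u) := by rw [mul_assoc, ← exp_add]; congr 2
      _ ≤ _ := by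
        have : exp (x₀ - u) ≤ exp (ε / 2) := exp_le_exp.2 (by linarith)
        gcongr
  have e3 : 1 - ε / 2 ≤ exp (-(ε / 2)) := by linarith [add_one_le_exp (-(ε / 2))]
  have e4 : (1 - ε) * exp (ε / 2) ≤ 1 - ε / 2 := by
    calc (1 - ε) * exp (ε / 2) ≤ ((1 - ε / 2) * exp (-(ε / 2))) * exp (ε / 2) := by
          gcongr
          nlinarith
      _ = _ := by rw [mul_assoc, ← exp_add, neg_add_cancel, exp_zero, mul_one]
  linarith

lemma aa_eventually {ε : ℝ} (hε : 0 < ε) (hε1 : ε < 1) : ∀ᶠ u in atTop, -ε < aa u := by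
  by_contra hcon
  have hfreq : ∃ᶠ u in atTop, aa u ≤ -ε := by
    rw [Filter.Frequently]
    intro h
    exact hcon (h.mono fun u hu => not_le.1 hu)
  have hpi := pi_pos
  have hM : 0 < MM := by linarith [MM_ge]
  set δ : ℝ := ε / 2 with hδ
  have hδ0 : 0 < δ := by positivity
  set C : ℝ := 1 + 4 / δ ^ 2 with hC
  have hC0 : 0 < C := by positivity
  set l : ℝ := max (2 / δ) (2 * π ^ 3 * MM * C / ε) with hldef
  have hl : 0 < l := lt_max_of_lt_left (by positivity)
  have hl1 : 1 / l ≤ δ / 2 := by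
    have : 2 / δ ≤ l := le_max_left _ _
    rw [div_le_iff₀ hδ0] at this
    rw [div_le_iff₀ hl]
    linarith
  have hl2 : 4 * MM * C / l * π ≤ 2 * ε / π ^ 2 := by
    have : 2 * π ^ 3 * MM * C / ε ≤ l := le_max_right _ _
    rw [div_le_iff₀ hε] at this
    rw [div_mul_eq_mul_div, div_le_div_iff₀ hl (by positivity)]
    nlinarith
  have htend := conv_tendsto hl
  have hη : 0 < 2 * ε / π ^ 2 := by positivity
  have hev : ∀ᶠ x in atTop, -(2 * ε / π ^ 2) <
      ∫ u in Set.Ioi (0 : ℝ), aa u * KF l (x - u) :=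
    htend.eventually (eventually_gt_nhds (by linarith))
  have hev2 : ∀ᶠ x₀ : ℝ in atTop, -(2 * ε / π ^ 2) <
      ∫ u in Set.Ioi (0 : ℝ), aa u * KF l ((x₀ - δ / 2) - u) :=
    (tendsto_atTop_add_const_right atTop (-(δ / 2)) tendsto_id).eventually hev
  obtain ⟨x₀, hx₀, hlow, hbig⟩ :=
    (hfreq.and_eventually (hev2.and (eventually_ge_atTop δ))).exists
  set x := x₀ - δ / 2 with hx
  set S := Set.Ioc (x - 1 / l) (x + 1 / l) with hS
  have hSsub : S ⊆ Set.Ioi 0 := by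
    intro u hu
    have : x - 1 / l < u := hu.1
    have : 0 < u := by linarith
    exact this
  have hpt : ∀ u : ℝ, u ≠ x → aa u * KF l (x - u) ≤
      S.indicator (fun _ => -(2 * ε / π ^ 2 * l)) u
        + 4 * MM * C / l * (1 + (x - u) ^ 2)⁻¹ := by
    intro u hu
    have hK := KF_nonneg hl (x - u)
    have hpos : 0 ≤ 4 * MM * C / l * (1 + (x - u) ^ 2)⁻¹ := by positivity
    by_cases huS : u ∈ S
    · rw [Set.indicator_of_mem huS]
      have h1 : aa u ≤ -(ε / 2) :=
        aa_near hε hε1 hx₀ (by linarith [huS.2]) (by linarith [huS.1])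
      have h2 : 4 / π ^ 2 * l ≤ KF l (x - u) := by
        refine KF_ge hl (sub_ne_zero.2 hu.symm) (abs_le.2 ⟨?_, ?_⟩)
        · linarith [huS.2]
        · linarith [huS.1]
      have h3 : aa u * KF l (x - u) ≤ -(ε / 2) * (4 / π ^ 2 * l) := by
        nlinarith
      have h4 : -(ε / 2) * (4 / π ^ 2 * l) = -(2 * ε / π ^ 2 * l) := by ring
      linarith
    · rw [Set.indicator_of_notMem huS, zero_add]
      by_cases hd : |x - u| ≤ δ / 2
      · have h1 : aa u ≤ -(ε / 2) := by
          have := abs_le.1 hd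
          exact aa_near hε hε1 hx₀ (by linarith) (by linarith)
        have : aa u * KF l (x - u) ≤ 0 := mul_nonpos_of_nonpos_of_nonneg (by linarith) hK
        linarith
      · push Not at hd
        have h1 : δ ^ 2 / 4 ≤ (x - u) ^ 2 := by
          rw [← sq_abs (x - u)]
          nlinarith
        have h2 : 1 + (x - u) ^ 2 ≤ C * (x - u) ^ 2 := by
          have : 1 ≤ 4 / δ ^ 2 * (x - u) ^ 2 := by
            rw [div_mul_eq_mul_div, le_div_iff₀ (by positivity)]
            linarith
          rw [hC]; linarith
        have h3 := KF_mul_le hl (x - u)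
        have h4 : KF l (x - u) ≤ 4 * C / l * (1 + (x - u) ^ 2)⁻¹ := by
          rw [← div_eq_mul_inv, le_div_iff₀ (by positivity)]
          calc KF l (x - u) * (1 + (x - u) ^ 2) ≤ KF l (x - u) * (C * (x - u) ^ 2) := by gcongr
            _ = C * (KF l (x - u) * (x - u) ^ 2) := by ring
            _ ≤ C * (4 / l) := by gcongr
            _ = _ := by ring
        calc aa u * KF l (x - u) ≤ MM * KF l (x - u) := by
              gcongr
              exact aa_le u
          _ ≤ MM * (4 * C / l * (1 + (x - u) ^ 2)⁻¹) := by gcongr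
          _ = _ := by ring
  have hiS : Integrable (S.indicator (fun _ : ℝ => -(2 * ε / π ^ 2 * l))) := by
    rw [integrable_indicator_iff measurableSet_Ioc]
    exact integrableOn_const (by simp)
  have hiP : Integrable (fun u : ℝ => 4 * MM * C / l * (1 + (x - u) ^ 2)⁻¹) :=
    (integrable_inv_one_add_sq.comp_sub_left x).const_mul _
  have hiL : Integrable (fun u : ℝ => aa u * KF l (x - u)) := by
    refine Integrable.bdd_mul (c := MM) (integrable_KF hl x)
      measurable_aa.aestronglyMeasurable ?_
    filter_upwards with u using abs_aa_le u
  have hne : ∀ᵐ u : ℝ, u ≠ x := by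
    rw [ae_iff]; simp
  have hle : ∫ u in Set.Ioi (0 : ℝ), aa u * KF l (x - u) ≤
      ∫ u in Set.Ioi (0 : ℝ), (S.indicator (fun _ => -(2 * ε / π ^ 2 * l)) u
        + 4 * MM * C / l * (1 + (x - u) ^ 2)⁻¹) := by
    refine integral_mono_ae hiL.integrableOn (hiS.add hiP).integrableOn ?_
    filter_upwards [ae_restrict_of_ae hne] with u hu using hpt u hu
  rw [integral_add hiS.integrableOn hiP.integrableOn] at hle
  have hI1 : ∫ u in Set.Ioi (0 : ℝ), S.indicator (fun _ => -(2 * ε / π ^ 2 * l)) u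
      = -(4 * ε / π ^ 2) := by
    rw [setIntegral_indicator measurableSet_Ioc, Set.inter_eq_right.2 hSsub, setIntegral_const]
    have : volume.real S = 2 / l := by
      rw [hS, Real.volume_real_Ioc_of_le (by have : 0 < 1 / l := by positivity
                                             linarith)]
      ring
    rw [this, smul_eq_mul]
    field_simp
    ring
  have hI2 : ∫ u in Set.Ioi (0 : ℝ), 4 * MM * C / l * (1 + (x - u) ^ 2)⁻¹
      ≤ 4 * MM * C / l * π := by
    calc _ ≤ ∫ u : ℝ, 4 * MM * C / l * (1 + (x - u) ^ 2)⁻¹ := by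
          refine setIntegral_le_integral hiP ?_
          filter_upwards with u
          simp only [Pi.zero_apply]
          positivity
      _ = _ := by
          rw [integral_const_mul,
            integral_sub_left_eq_self (fun v : ℝ => (1 + v ^ 2)⁻¹) volume x,
            integral_univ_inv_one_add_sq]
  have e : 4 * ε / π ^ 2 = 2 * (2 * ε / π ^ 2) := by ring
  linarith

lemma psi_eventually {ε : ℝ} (hε : 0 < ε) (hε1 : ε < 1) :
    ∀ᶠ x in atTop, (1 - ε) * x ≤ Chebyshev.psi x := by
  filter_upwards [tendsto_log_atTop.eventually (aa_eventually hε hε1), eventually_gt_atTop 0]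
    with x hx hx0
  unfold aa at hx
  rw [exp_neg, exp_log hx0, ← div_eq_mul_inv] at hx
  have : 1 - ε < Chebyshev.psi x / x := by linarith
  rw [lt_div_iff₀ hx0] at this
  exact this.le

/-- Lower half of the prime number theorem, with a logarithmic saving. -/
lemma theta_eventually {a : ℝ} (ha0 : 0 < a) (ha : a < 1) (k : ℝ) :
    ∀ᶠ x in atTop, a * x < Chebyshev.theta x - k * log x := by
  have h1 := psi_eventually (ε := (1 - a) / 2) (by linarith) (by linarith)
  have h2 : (fun x : ℝ => √x * log x) =o[atTop] fun x => x := by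
    have := (isLittleO_log_rpow_atTop (r := 1 / 2) (by norm_num))
    have h := (Asymptotics.isBigO_refl (fun x : ℝ => √x) atTop).mul_isLittleO this
    refine h.congr' EventuallyEq.rfl ?_
    filter_upwards [eventually_ge_atTop 0] with x hx
    rw [← sqrt_eq_rpow, mul_self_sqrt hx]
  have h3 := (h2.const_mul_left 2).add (isLittleO_log_id_atTop.const_mul_left k)
  have h4 := h3.def (c := (1 - a) / 4) (by linarith)
  filter_upwards [h1, h4, eventually_gt_atTop 1] with x hx1 hx4 hx
  have h5 := Chebyshev.psi_sub_theta_le hx.le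
  have h6 := le_of_abs_le hx4
  simp only [norm_eq_abs, abs_of_pos (by linarith : 0 < x), id] at h6
  nlinarith

end PNTaux

/-- Let `1 < c < e` and `k ≥ 0` an integer. Then there exists `N` such that for all
`n ≥ N`, the product of the first `n` primes exceeds `c ^ p_{n+k}`. -/
theorem stmt1 (c : ℝ) (hc1 : 1 < c) (hce : c < Real.exp 1) (k : ℕ) :
    ∃ N : ℕ, ∀ n : ℕ, n ≥ N →
      ((∏ j ∈ Finset.range n, Nat.nth Nat.Prime j : ℕ) : ℝ) >
        c ^ (Nat.nth Nat.Prime (n + k - 1)) := by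
  have ha0 : 0 < log c := log_pos hc1
  have ha1 : log c < 1 := by
    rw [Real.log_lt_iff_lt_exp (by linarith)]
    exact hce
  have hinf : (Set.ofPred Nat.Prime).Infinite := Nat.infinite_setOfPred_prime
  have hsm : StrictMono (Nat.nth Nat.Prime) := Nat.nth_strictMono hinf
  have hpr (j : ℕ) : (Nat.nth Nat.Prime j).Prime := Nat.prime_nth_prime j
  have hθ (m : ℕ) : Chebyshev.theta (Nat.nth Nat.Prime m) =
      ∑ j ∈ Finset.range (m + 1), log (Nat.nth Nat.Prime j) := by
    unfold Chebyshev.theta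
    rw [Nat.floor_natCast]
    symm
    refine Finset.sum_bij (fun j _ => Nat.nth Nat.Prime j) ?_ ?_ ?_ ?_
    · intro j hj
      simp only [Finset.mem_filter, Finset.mem_Ioc]
      refine ⟨⟨(hpr j).pos, hsm.monotone ?_⟩, hpr j⟩
      have := Finset.mem_range.1 hj
      omega
    · intro i _ j _ h
      exact hsm.injective h
    · intro p hp
      simp only [Finset.mem_filter, Finset.mem_Ioc] at hp
      refine ⟨Nat.count Nat.Prime p, ?_, Nat.nth_count hp.2⟩
      rw [Finset.mem_range]
      have h := hp.1.2
      rw [← Nat.nth_count hp.2] at h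
      have := hsm.le_iff_le.1 h
      omega
    · intro j _
      rfl
  have hev := PNTaux.theta_eventually ha0 ha1 k
  have htend : Tendsto (fun m : ℕ => ((Nat.nth Nat.Prime m : ℕ) : ℝ)) atTop atTop :=
    tendsto_natCast_atTop_atTop.comp hsm.tendsto_atTop
  obtain ⟨N, hN⟩ := eventually_atTop.1 (htend.eventually hev)
  refine ⟨N + 1, fun n hn => ?_⟩
  have h := hN (n + k - 1) (by omega)
  rw [hθ, show n + k - 1 + 1 = n + k by omega, Finset.sum_range_add] at h
  have hlogle : ∑ i ∈ Finset.range k, log (Nat.nth Nat.Prime (n + i))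
      ≤ k * log (Nat.nth Nat.Prime (n + k - 1)) := by
    have : ∑ i ∈ Finset.range k, log (Nat.nth Nat.Prime (n + i))
        ≤ ∑ i ∈ Finset.range k, log (Nat.nth Nat.Prime (n + k - 1)) := by
      refine Finset.sum_le_sum fun i hi => ?_
      have := Finset.mem_range.1 hi
      refine log_le_log (by exact_mod_cast (hpr _).pos) ?_
      exact_mod_cast hsm.monotone (by omega)
    simpa using this
  have hfin : log c * (Nat.nth Nat.Prime (n + k - 1) : ℕ) <
      ∑ j ∈ Finset.range n, log (Nat.nth Nat.Prime j) := by linarith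
  have hprod : 0 < ((∏ j ∈ Finset.range n, Nat.nth Nat.Prime j : ℕ) : ℝ) := by
    exact_mod_cast Finset.prod_pos fun j _ => (hpr j).pos
  rw [gt_iff_lt, ← Real.log_lt_log_iff (by positivity) hprod, Real.log_pow]
  push_cast
  rw [Real.log_prod fun j _ => by exact_mod_cast (hpr j).ne_zero]
  linarith
end

section
/- For every integer n ≥ 20, one has p_{n+1}^(n - π(n)) > 2^(p_{n+1}). -/
def isP (k : ℕ) : Bool :=
  Nat.ble 2 k && (List.range 65).all fun e => Nat.ble e 1 || Nat.ble (k+1) (e*e) || Nat.ble 1 (k % e)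

theorem isP_iff (k : ℕ) (hk : k < 4225) : isP k = true ↔ Nat.Prime k := by
  rw [Nat.prime_def_le_sqrt]
  simp only [isP, Bool.and_eq_true, Nat.ble_eq, List.all_eq_true, List.mem_range, Bool.or_eq_true]
  refine and_congr_right fun h2 => ⟨fun h m hm hs hd => ?_, fun h e he => ?_⟩
  · have h1 : m * m ≤ k := Nat.le_sqrt.mp hs
    have := h m (by nlinarith)
    have := Nat.mod_eq_zero_of_dvd hd
    grind
  · by_cases h1 : e ≤ 1
    · simp [h1]
    by_cases h3 : e * e ≤ k
    · right
      by_contra h0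
      replace h0 : k % e = 0 := by omega
      exact h e (by omega) (Nat.le_sqrt.mpr h3) (Nat.dvd_of_mod_eq_zero h0)
    · left; right; omega

def loop : ℕ → ℕ → ℕ → ℕ → Bool
  | 0, _, _, _ => true
  | f+1, k, c, s =>
    bif isP k then
      (Nat.ble c 19 || Nat.ble (2^k+1) (k^(c-s))) &&
        loop f (k+1) (c+1) (bif isP (c+1) then s+1 else s)
    else loop f (k+1) c s

theorem loop_spec (f k c s : ℕ) (hf : k + f ≤ 4200) (hc : c = Nat.count Nat.Prime k) 
    (hs : s = Nat.count Nat.Prime (c+1)) (h : loop f k c s = true) (q : ℕ) (hq : Nat.Prime q)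
    (hkq : k ≤ q) (hqf : q < k + f) (h20 : 20 ≤ Nat.count Nat.Prime q) :
    2 ^ q < q ^ (Nat.count Nat.Prime q - Nat.primeCounting (Nat.count Nat.Prime q)) := by
  induction f generalizing k c s with
  | zero => omega
  | succ f ih =>
    have hck : c ≤ k := hc ▸ Nat.count_le _
    rw [loop] at h
    by_cases hp : Nat.Prime k
    · rw [(isP_iff k (by omega)).mpr hp] at h
      simp only [cond_true, Bool.and_eq_true, Bool.or_eq_true, Nat.ble_eq] at h
      rcases Nat.eq_or_lt_of_le hkq with rfl | hlt
      · rw [← hc] at h20 ⊢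
        rw [Nat.primeCounting, Nat.primeCounting', ← hs]
        omega
      · refine ih (k+1) (c+1) _ (by omega) ?_ ?_ h.2 hlt (by omega)
        · rw [Nat.count_succ, if_pos hp, hc]
        · rw [Nat.count_succ _ (c+1), ← hs]
          by_cases hp' : Nat.Prime (c+1)
          · rw [(isP_iff _ (by omega)).mpr hp', if_pos hp']; rfl
          · have : isP (c+1) = false := by
              rw [← Bool.not_eq_true, isP_iff _ (by omega)]; exact hp'
            rw [this, if_neg hp']; rfl
    · have : isP k = false := by
        rw [← Bool.not_eq_true, isP_iff _ (by omega)]; exact hp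
      rw [this] at h
      have : k ≠ q := by rintro rfl; exact hp hq
      refine ih (k+1) c s (by omega) ?_ hs h (by omega) (by omega)
      rw [Nat.count_succ, if_neg hp, hc]; rfl

theorem loop_ok : loop 4100 0 0 0 = true := by decide +kernel

def loop2 : ℕ → ℕ → ℕ → Bool
  | 0, _, _ => true
  | f+1, k, c =>
    (Nat.ble k 210 || Nat.ble (209 * c) (48 * k)) &&
    loop2 f (k+1) (bif isP k then c+1 else c)

theorem loop2_spec (f k c : ℕ) (hf : k + f ≤ 4200) (hc : c = Nat.count Nat.Prime k) 
    (h : loop2 f k c = true) (q : ℕ) 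
    (hkq : k ≤ q) (hqf : q < k + f) (h20 : 211 ≤ q) :
    209 * Nat.count Nat.Prime q ≤ 48 * q := by
  induction f generalizing k c with
  | zero => omega
  | succ f ih =>
    rw [loop2] at h
    simp only [Bool.and_eq_true, Bool.or_eq_true, Nat.ble_eq] at h
    rcases Nat.eq_or_lt_of_le hkq with rfl | hlt
    · rw [← hc]; omega
    · refine ih (k+1) _ (by omega) ?_ h.2 hlt (by omega)
      rw [Nat.count_succ, ← hc]
      by_cases hp : Nat.Prime k
      · rw [(isP_iff _ (by omega)).mpr hp, if_pos hp]; rfl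
      · have : isP k = false := by
          rw [← Bool.not_eq_true, isP_iff _ (by omega)]; exact hp
        rw [this, if_neg hp]; rfl

theorem loop2_ok : loop2 500 0 0 = true := by decide +kernel

theorem count_bound (q : ℕ) (hq : 211 ≤ q) : 209 * Nat.count Nat.Prime q ≤ 48 * q := by
  induction q using Nat.strong_induction_on with
  | _ q ih =>
    by_cases h : q < 500
    · exact loop2_spec 500 0 0 (by omega) (by simp) loop2_ok q (by omega) (by omega) hq
    · have h1 := ih (q - 209) (by omega) (by omega)
      have h2 := Nat.primeCounting'_add_le (a := 210) (k := q - 209) (by omega) (by omega) 209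
      have h3 : Nat.totient 210 = 48 := by decide +kernel
      rw [h3, Nat.primeCounting', Nat.sub_add_cancel (by omega)] at h2
      omega

theorem cheb_dvd (x : ℕ) : x.factorial * (x/30).factorial ∣
    (x/2).factorial * (x/3).factorial * (x/5).factorial * Nat.lcmUpto x := by
  have hf := Nat.factorial_ne_zero
  have hl := Nat.lcmUpto_ne_zero x
  rw [← Nat.factorization_prime_le_iff_dvd (mul_ne_zero (hf _) (hf _))
    (mul_ne_zero (mul_ne_zero (mul_ne_zero (hf _) (hf _)) (hf _)) hl)]
  intro p hp
  have hlog : ∀ d, Nat.log p (x / d) < Nat.log p x + 1 := fun d =>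
    Nat.lt_succ_of_le (Nat.log_mono_right (Nat.div_le_self x d))
  have h1 : (Nat.lcmUpto x).factorization p = ∑ i ∈ Finset.Ico 1 (Nat.log p x + 1), 1 := by
    simp [Nat.factorization_lcmUpto x hp]
  rw [Nat.factorization_mul (hf _) (hf _),
    Nat.factorization_mul (mul_ne_zero (mul_ne_zero (hf _) (hf _)) (hf _)) hl,
    Nat.factorization_mul (mul_ne_zero (hf _) (hf _)) (hf _),
    Nat.factorization_mul (hf _) (hf _)]
  simp only [Finsupp.add_apply]
  rw [Nat.factorization_factorial hp (Nat.lt_succ_self (Nat.log p x)),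
    Nat.factorization_factorial hp (hlog 30), Nat.factorization_factorial hp (hlog 2),
    Nat.factorization_factorial hp (hlog 3), Nat.factorization_factorial hp (hlog 5),
    h1]
  simp only [← Finset.sum_add_distrib]
  refine Finset.sum_le_sum fun i _ => ?_
  simp only [Nat.div_div_eq_div_mul, Nat.mul_comm _ (p ^ i)]
  simp only [← Nat.div_div_eq_div_mul]
  generalize x / p ^ i = y
  omega

open Real

theorem log_fact_le (k : ℕ) (hk : 1 ≤ k) :
    log (k.factorial : ℝ) ≤ k * log k - k + log k + 1 := by
  induction k, hk using Nat.le_induction with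
  | base => simp
  | succ k hk ih =>
    have hk0 : (0:ℝ) < k := by exact_mod_cast hk
    have hfk : (k.factorial : ℝ) ≠ 0 := by exact_mod_cast Nat.factorial_ne_zero k
    rw [Nat.factorial_succ, Nat.cast_mul, log_mul (by positivity) hfk]
    have h := one_sub_inv_le_log_of_pos (show (0:ℝ) < (k + 1) / k by positivity)
    rw [log_div (by positivity) (by positivity), inv_div] at h
    have h2 : 1 ≤ (k + 1) * (log ((k:ℝ) + 1) - log k) := by
      calc (1:ℝ) = (k + 1) * (1 - k / (k + 1)) := by field_simp; ring
        _ ≤ _ := by gcongr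
    push_cast
    nlinarith

theorem le_log_fact (k : ℕ) (hk : 1 ≤ k) :
    k * log k - k ≤ log (k.factorial : ℝ) := by
  induction k, hk using Nat.le_induction with
  | base => simp
  | succ k hk ih =>
    have hk0 : (0:ℝ) < k := by exact_mod_cast hk
    have hfk : (k.factorial : ℝ) ≠ 0 := by exact_mod_cast Nat.factorial_ne_zero k
    rw [Nat.factorial_succ, Nat.cast_mul, log_mul (by positivity) hfk]
    have h := log_le_sub_one_of_pos (show (0:ℝ) < (k + 1) / k by positivity)
    rw [log_div (by positivity) (by positivity)] at h
    have h2 : k * (log ((k:ℝ) + 1) - log k) ≤ 1 := by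
      calc k * (log ((k:ℝ) + 1) - log k) ≤ k * (((k:ℝ) + 1) / k - 1) := by gcongr
        _ = 1 := by field_simp; ring
    push_cast
    nlinarith

theorem log_fact_div_le (x d : ℕ) (hd : 1 ≤ d) (hx : d ≤ x) :
    log ((x / d).factorial : ℝ) ≤
      (x / d : ℝ) * (log x - log d) - x / d + (log x - log d) + 1 := by
  have hk : 1 ≤ x / d := (Nat.one_le_div_iff hd).mpr hx
  have h1 := log_fact_le _ hk
  have hle : ((x / d : ℕ) : ℝ) ≤ (x / d : ℝ) := Nat.cast_div_le
  have hx0 : (0:ℝ) < x := by exact_mod_cast (by omega : 0 < x)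
  have hd0 : (0:ℝ) < d := by exact_mod_cast hd
  rw [← log_div hx0.ne' hd0.ne']
  generalize (x / d : ℝ) = t at *
  generalize x / d = k at *
  have hk0 : (1:ℝ) ≤ k := by exact_mod_cast hk
  have hk0' : (0:ℝ) < k := by linarith
  have ht : 0 < t := by linarith
  have h := one_sub_inv_le_log_of_pos (show (0:ℝ) < t / k by positivity)
  rw [log_div (by positivity) (by positivity), inv_div] at h
  have h2 : t - k ≤ t * (log t - log k) := by
    calc t - k = t * (1 - k / t) := by field_simp
      _ ≤ _ := by gcongr
  have h3 : log k ≤ log t := log_le_log hk0' hle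
  have h4 : 0 ≤ log (k:ℝ) := log_nonneg hk0
  nlinarith

theorem le_log_fact_div (x d : ℕ) (hd : 1 ≤ d) (hx : d ≤ x) :
    (x / d : ℝ) * (log x - log d) - x / d - (log x - log d) ≤ log ((x / d).factorial : ℝ) := by
  have hk : 1 ≤ x / d := (Nat.one_le_div_iff hd).mpr hx
  have h1 := le_log_fact _ hk
  have hle : ((x / d : ℕ) : ℝ) ≤ (x / d : ℝ) := Nat.cast_div_le
  have hlt : (x / d : ℝ) ≤ ((x / d : ℕ) : ℝ) + 1 := by
    have := Nat.lt_floor_add_one (x / d : ℝ)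
    rw [Nat.floor_div_eq_div] at this
    exact this.le
  have hx0 : (0:ℝ) < x := by exact_mod_cast (by omega : 0 < x)
  have hd0 : (0:ℝ) < d := by exact_mod_cast hd
  rw [← log_div hx0.ne' hd0.ne']
  generalize (x / d : ℝ) = t at *
  generalize x / d = k at *
  have hk0 : (1:ℝ) ≤ k := by exact_mod_cast hk
  have hk0' : (0:ℝ) < k := by linarith
  have ht : 0 < t := by linarith
  have h := log_le_sub_one_of_pos (show (0:ℝ) < t / k by positivity)
  rw [log_div (by positivity) (by positivity)] at h
  have h2 : k * (log t - log k) ≤ t - k := by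
    calc k * (log t - log k) ≤ k * (t / k - 1) := by gcongr
      _ = t - k := by field_simp
  have h4 : 0 ≤ log t := log_nonneg (by linarith)
  nlinarith

theorem psi_lower_s2 (x : ℕ) (hx : 30 ≤ x) :
    (93/70 : ℝ) * log 2 * x - 4 * log x ≤ Chebyshev.psi x := by
  have h := Nat.le_of_dvd (Nat.mul_pos (by positivity) (Nat.lcmUpto_pos x)) (cheb_dvd x)
  have hf : ∀ k : ℕ, (k.factorial : ℝ) ≠ 0 := fun k => by exact_mod_cast Nat.factorial_ne_zero k
  have hl : (Nat.lcmUpto x : ℝ) ≠ 0 := by exact_mod_cast Nat.lcmUpto_ne_zero x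
  have h' : ((x.factorial * (x/30).factorial : ℕ) : ℝ) ≤
    ((x/2).factorial * (x/3).factorial * (x/5).factorial * Nat.lcmUpto x : ℕ) := by
    exact_mod_cast h
  have h1 := log_le_log (by positivity) h'
  push_cast at h1
  rw [log_mul (hf _) (hf _), log_mul (mul_ne_zero (mul_ne_zero (hf _) (hf _)) (hf _)) hl,
    log_mul (mul_ne_zero (hf _) (hf _)) (hf _), log_mul (hf _) (hf _),
    ← Chebyshev.psi_eq_log_lcmUpto] at h1
  have a0 := le_log_fact x (by omega)
  have a1 := le_log_fact_div x 30 (by omega) (by omega)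
  have a2 := log_fact_div_le x 2 (by omega) (by omega)
  have a3 := log_fact_div_le x 3 (by omega) (by omega)
  have a5 := log_fact_div_le x 5 (by omega) (by omega)
  push_cast at a1 a2 a3 a5
  have e30 : log (30:ℝ) = log 2 + log 3 + log 5 := by
    rw [← log_mul (by norm_num) (by norm_num), ← log_mul (by norm_num) (by norm_num)]; norm_num
  have b3 : 19 * log 2 ≤ 12 * log (3:ℝ) := by
    have := log_le_log (by norm_num) (show (2:ℝ)^19 ≤ 3^12 by norm_num)
    rw [log_pow, log_pow] at this
    exact_mod_cast this
  have b5 : 65 * log 2 ≤ 28 * log (5:ℝ) := by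
    have := log_le_log (by norm_num) (show (2:ℝ)^65 ≤ 5^28 by norm_num)
    rw [log_pow, log_pow] at this
    exact_mod_cast this
  have hl2 := log_two_gt_d9
  rw [e30] at a1
  have hx0 : (0:ℝ) < x := by exact_mod_cast (by omega : 0 < x)
  have c3 := mul_le_mul_of_nonneg_right b3 hx0.le
  have c5 := mul_le_mul_of_nonneg_right b5 hx0.le
  ring_nf at *
  nlinarith

theorem big (n p : ℕ) (hp : 4096 ≤ p) (h1 : Nat.count Nat.Prime p = n)
    (hpp : p.Prime) : 2 ^ p < p ^ (n - n.primeCounting) := by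
  have hψ := (psi_lower_s2 p (by omega)).trans (Chebyshev.psi_le_primeCounting_mul_log p)
  have hpi : p.primeCounting = n + 1 := by
    rw [Nat.primeCounting, Nat.primeCounting', Nat.count_succ, if_pos hpp, h1]
  rw [hpi] at hψ
  have hp0 : (0:ℝ) < p := by exact_mod_cast (by omega : 0 < p)
  have hp1 : (4096:ℝ) ≤ p := by exact_mod_cast hp
  have hL := log_le_sub_one_of_pos (show (0:ℝ) < p / 4096 by positivity)
  rw [log_div (by positivity) (by positivity), show (4096:ℝ) = 2^12 by norm_num, log_pow] at hL
  have hl2 := log_two_gt_d9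
  have hl3 := log_two_lt_d9
  have hLp : 0 < log (p:ℝ) := log_pos (by linarith)
  have hn : 210 ≤ n := by
    by_contra hn
    have hn' : (n:ℝ) ≤ 210 := by exact_mod_cast (by omega : n ≤ 210)
    have := mul_le_mul_of_nonneg_right hn' hLp.le
    push_cast at *
    nlinarith
  have hB := count_bound (n + 1) (by omega)
  change 209 * n.primeCounting ≤ _ at hB
  have hle : n.primeCounting ≤ n := by omega
  have hB' : (209:ℝ) * n.primeCounting ≤ 48 * (n + 1) := by exact_mod_cast hB
  have key : (p:ℝ) * log 2 < (n - n.primeCounting : ℝ) * log p := by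
    have := mul_le_mul_of_nonneg_right hB' hLp.le
    push_cast at *
    nlinarith
  have : ((2:ℝ)) ^ p < (p:ℝ) ^ (n - n.primeCounting) := by
    rw [← log_lt_log_iff (by positivity) (by positivity), log_pow, log_pow, Nat.cast_sub hle]
    exact key
  exact_mod_cast this

/-- For every integer `n ≥ 20`, `p_{n+1} ^ (n - π n) > 2 ^ p_{n+1}`,
where `p_m` is the m-th prime (`p_1 = 2`), so `p_{n+1} = Nat.nth Nat.Prime n`. -/
theorem stmt2 (n : ℕ) (hn : n ≥ 20) :
    (Nat.nth Nat.Prime n) ^ (n - n.primeCounting) > 2 ^ (Nat.nth Nat.Prime n) := by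
  have hc : Nat.count Nat.Prime (Nat.nth Nat.Prime n) = n := Nat.primeCounting'_nth_eq n
  have hp : Nat.Prime (Nat.nth Nat.Prime n) := Nat.prime_nth_prime n
  generalize Nat.nth Nat.Prime n = p at *
  by_cases h : p < 4100
  · have := loop_spec 4100 0 0 0 (by omega) (by simp) (by simp [Nat.count_succ, Nat.not_prime_zero]) loop_ok p hp
      (by omega) (by omega) (by omega)
    rwa [hc] at this
  · exact big n p (by omega) hc hp
end

section
/- For every integer n ≥ 10, the product of the first n primes satisfies ∏_{k ≤ n} p_k > 2^(p_{n+1}). -/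
/-- The primorial of `61`, as a literal. -/
def smallM : ℕ := 117288381359406970983270

/-- Product of the numbers in `(a, a + k]` which are coprime to `smallM`. -/
def segProd (a : ℕ) : ℕ → ℕ
  | 0 => 1
  | k + 1 => segProd a k * (bif Nat.beq (Nat.gcd (a + (k + 1)) smallM) 1 then a + (k + 1) else 1)

theorem primorial_61 : primorial 61 = smallM := by decide +kernel

theorem primorial_succ_prime {m : ℕ} (h : (m + 1).Prime) :
    primorial (m + 1) = primorial m * (m + 1) := by
  unfold primorial
  rw [Finset.range_add_one, Finset.filter_insert, if_pos h, Finset.prod_insert (by simp), mul_comm]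

theorem prime_of_coprime_smallM {m : ℕ} (h2 : 2 ≤ m) (hm : m < 3844)
    (h : Nat.gcd m smallM = 1) : m.Prime := by
  by_contra hc
  have h1 : m.minFac ^ 2 ≤ m := Nat.minFac_sq_le_self (by omega) hc
  have hp : m.minFac.Prime := Nat.minFac_prime (by omega)
  have hlt : m.minFac ≤ 61 := by
    by_contra hcc
    have : 62 ≤ m.minFac := by omega
    nlinarith
  have hd : m.minFac ∣ smallM := by
    rw [← primorial_61]
    exact hp.dvd_primorial_iff.2 hlt
  have : m.minFac ∣ 1 := h ▸ Nat.dvd_gcd (Nat.minFac_dvd m) hd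
  exact hp.one_lt.ne' (Nat.dvd_one.1 this)

theorem segProd_le (a : ℕ) (ha : 1 ≤ a) (k : ℕ) (hk : a + k < 3844) :
    primorial a * segProd a k ≤ primorial (a + k) := by
  induction k with
  | zero => simp [segProd]
  | succ k ih =>
    have ih := ih (by omega)
    unfold segProd
    by_cases h : Nat.gcd (a + (k + 1)) smallM = 1
    · have hp := prime_of_coprime_smallM (by omega) hk h
      have hb : Nat.beq (Nat.gcd (a + (k + 1)) smallM) 1 = true := by rw [h]; rfl
      rw [hb, cond_true, ← mul_assoc, ← add_assoc, primorial_succ_prime (by simpa [add_assoc] using hp)]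
      exact Nat.mul_le_mul_right _ ih
    · have hb : Nat.beq (Nat.gcd (a + (k + 1)) smallM) 1 = false := by
        rw [← Bool.not_eq_true, Nat.beq_eq]; exact h
      rw [hb, cond_false, mul_one]
      exact ih.trans (primorial_mono (by omega))

theorem seg_step (a k e d : ℕ) (h : 2 ^ e < primorial a) (hk : 1 ≤ a ∧ a + k < 3844)
    (hd : Nat.ble (2 ^ d) (segProd a k) = true) : 2 ^ (e + d) < primorial (a + k) := by
  have hd' := Nat.le_of_ble_eq_true hd
  refine lt_of_lt_of_le ?_ (segProd_le a hk.1 k hk.2)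
  rw [pow_add]
  have : 0 < 2 ^ d := by positivity
  calc 2 ^ e * 2 ^ d < primorial a * 2 ^ d := Nat.mul_lt_mul_of_pos_right h this
    _ ≤ _ := Nat.mul_le_mul_left _ hd'

theorem fin_cover {a b q : ℕ} (h : 2 ^ b < primorial a) (ha : a < q) (hb : q ≤ b) :
    2 ^ q < primorial (q - 1) :=
  (Nat.pow_le_pow_right (by norm_num) hb).trans_lt (h.trans_le (primorial_mono (by omega)))

set_option exponentiation.threshold 10000 in
theorem small_cases_aux (q : ℕ) (h1 : 61 < q) (h2 : q ≤ 4100) : 2 ^ q < primorial (q - 1) := by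
  have h0 : 2 ^ 76 < primorial 61 := by rw [primorial_61]; norm_num [smallM]
  have h1 : 2 ^ 94 < primorial 75 := seg_step 61 14 76 18 h0 (by norm_num) (by decide +kernel)
  have h2 : 2 ^ 113 < primorial 93 := seg_step 75 18 94 19 h1 (by norm_num) (by decide +kernel)
  have h3 : 2 ^ 146 < primorial 112 := seg_step 93 19 113 33 h2 (by norm_num) (by decide +kernel)
  have h4 : 2 ^ 181 < primorial 145 := seg_step 112 33 146 35 h3 (by norm_num) (by decide +kernel)
  have h5 : 2 ^ 232 < primorial 180 := seg_step 145 35 181 51 h4 (by norm_num) (by decide +kernel)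
  have h6 : 2 ^ 301 < primorial 231 := seg_step 180 51 232 69 h5 (by norm_num) (by decide +kernel)
  have h7 : 2 ^ 397 < primorial 300 := seg_step 231 69 301 96 h6 (by norm_num) (by decide +kernel)
  have h8 : 2 ^ 523 < primorial 396 := seg_step 300 96 397 126 h7 (by norm_num) (by decide +kernel)
  have h9 : 2 ^ 708 < primorial 522 := seg_step 396 126 523 185 h8 (by norm_num) (by decide +kernel)
  have h10 : 2 ^ 967 < primorial 707 := seg_step 522 185 708 259 h9 (by norm_num) (by decide +kernel)
  have h11 : 2 ^ 1315 < primorial 957 := seg_step 707 250 967 348 h10 (by norm_num) (by decide +kernel)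
  have h12 : 2 ^ 1667 < primorial 1207 := seg_step 957 250 1315 352 h11 (by norm_num) (by decide +kernel)
  have h13 : 2 ^ 2019 < primorial 1457 := seg_step 1207 250 1667 352 h12 (by norm_num) (by decide +kernel)
  have h14 : 2 ^ 2390 < primorial 1707 := seg_step 1457 250 2019 371 h13 (by norm_num) (by decide +kernel)
  have h15 : 2 ^ 2725 < primorial 1957 := seg_step 1707 250 2390 335 h14 (by norm_num) (by decide +kernel)
  have h16 : 2 ^ 3077 < primorial 2207 := seg_step 1957 250 2725 352 h15 (by norm_num) (by decide +kernel)
  have h17 : 2 ^ 3457 < primorial 2457 := seg_step 2207 250 3077 380 h16 (by norm_num) (by decide +kernel)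
  have h18 : 2 ^ 3808 < primorial 2707 := seg_step 2457 250 3457 351 h17 (by norm_num) (by decide +kernel)
  have h19 : 2 ^ 4174 < primorial 2957 := seg_step 2707 250 3808 366 h18 (by norm_num) (by decide +kernel)
  rcases Nat.lt_or_ge 76 q with hq0 | hq0
  swap
  · exact fin_cover h0 (by omega) hq0
  rcases Nat.lt_or_ge 94 q with hq1 | hq1
  swap
  · exact fin_cover h1 (by omega) hq1
  rcases Nat.lt_or_ge 113 q with hq2 | hq2
  swap
  · exact fin_cover h2 (by omega) hq2
  rcases Nat.lt_or_ge 146 q with hq3 | hq3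
  swap
  · exact fin_cover h3 (by omega) hq3
  rcases Nat.lt_or_ge 181 q with hq4 | hq4
  swap
  · exact fin_cover h4 (by omega) hq4
  rcases Nat.lt_or_ge 232 q with hq5 | hq5
  swap
  · exact fin_cover h5 (by omega) hq5
  rcases Nat.lt_or_ge 301 q with hq6 | hq6
  swap
  · exact fin_cover h6 (by omega) hq6
  rcases Nat.lt_or_ge 397 q with hq7 | hq7
  swap
  · exact fin_cover h7 (by omega) hq7
  rcases Nat.lt_or_ge 523 q with hq8 | hq8
  swap
  · exact fin_cover h8 (by omega) hq8
  rcases Nat.lt_or_ge 708 q with hq9 | hq9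
  swap
  · exact fin_cover h9 (by omega) hq9
  rcases Nat.lt_or_ge 967 q with hq10 | hq10
  swap
  · exact fin_cover h10 (by omega) hq10
  rcases Nat.lt_or_ge 1315 q with hq11 | hq11
  swap
  · exact fin_cover h11 (by omega) hq11
  rcases Nat.lt_or_ge 1667 q with hq12 | hq12
  swap
  · exact fin_cover h12 (by omega) hq12
  rcases Nat.lt_or_ge 2019 q with hq13 | hq13
  swap
  · exact fin_cover h13 (by omega) hq13
  rcases Nat.lt_or_ge 2390 q with hq14 | hq14
  swap
  · exact fin_cover h14 (by omega) hq14
  rcases Nat.lt_or_ge 2725 q with hq15 | hq15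
  swap
  · exact fin_cover h15 (by omega) hq15
  rcases Nat.lt_or_ge 3077 q with hq16 | hq16
  swap
  · exact fin_cover h16 (by omega) hq16
  rcases Nat.lt_or_ge 3457 q with hq17 | hq17
  swap
  · exact fin_cover h17 (by omega) hq17
  rcases Nat.lt_or_ge 3808 q with hq18 | hq18
  swap
  · exact fin_cover h18 (by omega) hq18
  rcases Nat.lt_or_ge 4174 q with hq19 | hq19
  swap
  · exact fin_cover h19 (by omega) hq19
  omega

theorem small_cases (q : ℕ) (hp : q.Prime) (h1 : 31 ≤ q) (h2 : q ≤ 4100) :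
    2 ^ q < primorial (q - 1) := by
  rcases Nat.lt_or_ge 61 q with h | h
  · exact small_cases_aux q h h2
  · interval_cases q <;> first | (exfalso; revert hp; norm_num; done) | decide +kernel

/-! ### Large cases -/

theorem factorial_dvd (n : ℕ) (hn : 1 ≤ n) :
    (6 * n).factorial * n.factorial ∣
      Nat.lcmUpto (6 * n) * ((3 * n).factorial * ((2 * n).factorial * (2 * n).factorial)) := by
  have f0 := fun k => Nat.factorial_ne_zero k
  rw [← Nat.factorization_prime_le_iff_dvd (by simp [f0])
    (by simp [f0, Nat.lcmUpto_ne_zero])]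
  intro p hp
  rw [Nat.factorization_mul (f0 _) (f0 _), Nat.factorization_mul (Nat.lcmUpto_ne_zero _) (by simp [f0]),
    Nat.factorization_mul (f0 _) (by simp [f0]), Nat.factorization_mul (f0 _) (f0 _)]
  simp only [Finsupp.add_apply]
  have hb : ∀ m ≤ 6 * n, Nat.log p m < Nat.log p (6 * n) + 1 := fun m hm =>
    Nat.lt_succ_of_le (Nat.log_mono_right hm)
  rw [Nat.factorization_lcmUpto _ hp, Nat.factorization_factorial hp (hb (6 * n) le_rfl),
    Nat.factorization_factorial hp (hb n (by omega)),
    Nat.factorization_factorial hp (hb (3 * n) (by omega)),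
    Nat.factorization_factorial hp (hb (2 * n) (by omega))]
  have hl : Nat.log p (6 * n) = ∑ i ∈ Finset.Ico 1 (Nat.log p (6 * n) + 1), 1 := by simp
  generalize hT : Nat.log p (6 * n) + 1 = T at hl ⊢
  rw [hl]
  simp only [← Finset.sum_add_distrib]
  apply Finset.sum_le_sum
  intro i _
  have e3 : 3 * n / p ^ i = (6 * n / p ^ i) / 2 := by
    rw [Nat.div_div_eq_div_mul, mul_comm (p ^ i), ← Nat.div_div_eq_div_mul]; congr 1; omega
  have e2 : 2 * n / p ^ i = (6 * n / p ^ i) / 3 := by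
    rw [Nat.div_div_eq_div_mul, mul_comm (p ^ i), ← Nat.div_div_eq_div_mul]; congr 1; omega
  have e1 : n / p ^ i = (6 * n / p ^ i) / 6 := by
    rw [Nat.div_div_eq_div_mul, mul_comm (p ^ i), ← Nat.div_div_eq_div_mul]; congr 1; omega
  rw [e3, e2, e1]
  omega

theorem factorial_ineq (n : ℕ) (hn : 1 ≤ n) :
    108 ^ n * ((3 * n).factorial * ((2 * n).factorial * (2 * n).factorial)) ≤
      4 * n * ((6 * n).factorial * n.factorial) := by
  induction n, hn using Nat.le_induction with
  | base => decide
  | succ n hn ih =>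
    have e6 : (6 * (n + 1)).factorial = (6 * n + 6) * ((6 * n + 5) * ((6 * n + 4) * ((6 * n + 3) *
        ((6 * n + 2) * ((6 * n + 1) * (6 * n).factorial))))) := by
      simp only [← Nat.factorial_succ]; rfl
    have e3 : (3 * (n + 1)).factorial =
        (3 * n + 3) * ((3 * n + 2) * ((3 * n + 1) * (3 * n).factorial)) := by
      simp only [← Nat.factorial_succ]; rfl
    have e2 : (2 * (n + 1)).factorial = (2 * n + 2) * ((2 * n + 1) * (2 * n).factorial) := by
      simp only [← Nat.factorial_succ]; rfl
    rw [e6, e3, e2, Nat.factorial_succ n, pow_succ]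
    set A := (6 * n).factorial
    set B := (3 * n).factorial
    set C := (2 * n).factorial
    set D := n.factorial
    set X := 108 ^ n
    have key : 108 * ((3 * n + 3) * (3 * n + 2) * (3 * n + 1) * ((2 * n + 2) * (2 * n + 1)) ^ 2) * n ≤
      (n + 1) * ((6 * n + 6) * (6 * n + 5) * (6 * n + 4) * (6 * n + 3) * (6 * n + 2) * (6 * n + 1)
        * (n + 1)) := by
      have h0 : 18 * n * ((2 * n + 1) * (n + 1)) ≤ (n + 1) * ((6 * n + 5) * (6 * n + 1)) := by
        nlinarith [Nat.zero_le (n ^ 2), Nat.zero_le n]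
      have := Nat.mul_le_mul_left
        (6 * 12 * (n + 1) ^ 2 * (3 * n + 2) * (3 * n + 1) * (2 * n + 1)) h0
      nlinarith [this]
    have h1 := Nat.mul_le_mul ih key
    have hnp : 0 < n := hn
    refine Nat.le_of_mul_le_mul_left ?_ hnp
    nlinarith [h1]

theorem pow_le_lcm (n : ℕ) (hn : 1 ≤ n) : 108 ^ n ≤ 4 * n * Nat.lcmUpto (6 * n) := by
  have h1 := factorial_ineq n hn
  have h2 := Nat.le_of_dvd (Nat.mul_pos (Nat.lcmUpto_pos _) (by positivity)) (factorial_dvd n hn)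
  have hF : 0 < (3 * n).factorial * ((2 * n).factorial * (2 * n).factorial) := by positivity
  refine Nat.le_of_mul_le_mul_right ?_ hF
  calc _ ≤ _ := h1
    _ ≤ _ := Nat.mul_le_mul_left _ h2
    _ = _ := by ring

theorem lcm_le (x : ℕ) (hx : 1 ≤ x) :
    Nat.lcmUpto x ≤ primorial x * x ^ (Nat.primeCounting (Nat.sqrt x)) := by
  rw [Nat.lcmUpto_eq_prod_pow_log, primorial_eq_prod_primesLE]
  have h1 : ∏ p ∈ Nat.primesLE x, p ^ Nat.log p x ≤
      ∏ p ∈ Nat.primesLE x, (p * if p ≤ Nat.sqrt x then x else 1) := by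
    apply Finset.prod_le_prod'
    intro p hp
    have hpp := Nat.prime_of_mem_primesLE hp
    split_ifs with h
    · calc p ^ Nat.log p x ≤ x := Nat.pow_log_le_self p (by omega)
        _ ≤ p * x := Nat.le_mul_of_pos_left _ hpp.pos
    · rw [mul_one]
      have : Nat.log p x < 2 := by
        apply Nat.log_lt_of_lt_pow (by omega)
        rw [pow_two]
        exact Nat.sqrt_lt.1 (by omega)
      calc p ^ Nat.log p x ≤ p ^ 1 := Nat.pow_le_pow_right hpp.pos (by omega)
        _ = p := pow_one p
  refine h1.trans ?_
  rw [Finset.prod_mul_distrib]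
  apply Nat.mul_le_mul_left
  rw [Finset.prod_ite, Finset.prod_const, Finset.prod_const_one, mul_one,
    ← Nat.primesLE_card_eq_primeCounting]
  apply Nat.pow_le_pow_right hx
  apply Finset.card_le_card
  intro p hp
  rw [Finset.mem_filter] at hp
  exact Nat.mem_primesLE.2 ⟨hp.2, Nat.prime_of_mem_primesLE hp.1⟩

theorem pi_le_half (s : ℕ) (hs : 2 ≤ s) : Nat.primeCounting s ≤ s / 2 + 1 := by
  have h := Nat.primeCounting'_add_le (a := 2) (k := 3) (by norm_num) (by norm_num) (s - 2)
  have e : 3 + (s - 2) = s + 1 := by omega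
  have h3 : Nat.primeCounting' 3 = 1 := by decide
  rw [e, h3, Nat.totient_two] at h
  have : Nat.primeCounting s = Nat.primeCounting' (s + 1) := rfl
  omega

theorem real_ineq (s : ℝ) (hs : 64 ≤ s) :
    6 * Real.log 2 + (s + 4) * Real.log (s + 1) < s ^ 2 / 6 * Real.log (27 / 16) := by
  have hL1 := Real.log_two_gt_d9
  have hL2 := Real.log_two_lt_d9
  have h27 : 3 / 4 * Real.log 2 ≤ Real.log (27 / 16) := by
    have : Real.log (2 ^ 3) ≤ Real.log ((27 / 16) ^ 4) :=
      Real.log_le_log (by norm_num) (by norm_num)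
    rw [Real.log_pow, Real.log_pow] at this
    push_cast at this
    linarith
  have hs1 : Real.log (s + 1) ≤ 6 * Real.log 2 + (s - 63) / 64 := by
    have h1 := Real.log_le_sub_one_of_pos (show 0 < (s + 1) / 64 by positivity)
    rw [Real.log_div (by positivity) (by norm_num)] at h1
    have : Real.log 64 = 6 * Real.log 2 := by
      rw [show (64 : ℝ) = 2 ^ 6 by norm_num, Real.log_pow]; norm_num
    linarith
  have hs2 : Real.log (s + 1) ≤ 4.16 + (s - 63) / 64 := by linarith
  have h3 : 0.519 ≤ Real.log (27 / 16) := by linarith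
  have h4 : (s + 4) * Real.log (s + 1) ≤ (s + 4) * (4.16 + (s - 63) / 64) := by gcongr
  have h5 : s ^ 2 / 6 * 0.519 ≤ s ^ 2 / 6 * Real.log (27 / 16) := by gcongr
  nlinarith

theorem nat_ineq (n : ℕ) (hn : 683 ≤ n) :
    2 ^ (6 * n + 6) * (4 * n * (6 * n) ^ (Nat.primeCounting (Nat.sqrt (6 * n)))) < 108 ^ n := by
  set s := Nat.sqrt (6 * n) with hs
  have hs64 : 64 ≤ s := Nat.le_sqrt.2 (by omega)
  have hsq : s * s ≤ 6 * n := Nat.sqrt_le _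
  have hsq' : 6 * n ≤ (s + 1) ^ 2 := by
    rw [pow_two]; exact (Nat.lt_succ_sqrt _).le
  have hpi := pi_le_half s (by omega)
  have a1 : (6 * n) ^ (Nat.primeCounting s) ≤ (s + 1) ^ (s + 2) := by
    calc (6 * n) ^ (Nat.primeCounting s) ≤ ((s + 1) ^ 2) ^ (Nat.primeCounting s) :=
          Nat.pow_le_pow_left hsq' _
      _ = (s + 1) ^ (2 * Nat.primeCounting s) := by rw [pow_mul]
      _ ≤ _ := Nat.pow_le_pow_right (by omega) (by omega)
  have a2 : 64 * (4 * n) ≤ 64 * (s + 1) ^ 2 := by omega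
  have a3 : 64 * (s + 1) ^ (s + 4) * 64 ^ n < 108 ^ n := by
    have hr := real_ineq s (by exact_mod_cast hs64)
    have hlog : Real.log ((64 : ℝ) * ((s : ℝ) + 1) ^ (s + 4)) < Real.log ((27 / 16 : ℝ) ^ n) := by
      rw [Real.log_mul (by norm_num) (by positivity), Real.log_pow, Real.log_pow,
        show (64 : ℝ) = 2 ^ 6 by norm_num, Real.log_pow]
      push_cast
      have hpos : 0 < Real.log (27 / 16) := Real.log_pos (by norm_num)
      have hn' : (s : ℝ) ^ 2 / 6 ≤ n := by
        have : (s : ℝ) * s ≤ 6 * n := by exact_mod_cast hsq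
        nlinarith
      have := mul_le_mul_of_nonneg_right hn' hpos.le
      linarith
    have h := (Real.log_lt_log_iff (by positivity) (by positivity)).1 hlog
    have h' : (64 : ℝ) * ((s : ℝ) + 1) ^ (s + 4) * 64 ^ n < 108 ^ n := by
      have e : (108 : ℝ) ^ n = (27 / 16) ^ n * 64 ^ n := by
        rw [← mul_pow]; norm_num
      rw [e]
      gcongr
    exact_mod_cast h'
  refine lt_of_le_of_lt ?_ a3
  calc 2 ^ (6 * n + 6) * (4 * n * (6 * n) ^ (Nat.primeCounting s))
      = (64 * (4 * n)) * (6 * n) ^ (Nat.primeCounting s) * 64 ^ n := by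
        rw [pow_add, pow_mul]; norm_num; ring
    _ ≤ (64 * (s + 1) ^ 2) * (s + 1) ^ (s + 2) * 64 ^ n := by gcongr
    _ = _ := by ring

theorem large_cases (q : ℕ) (h : 4100 < q) : 2 ^ q < primorial (q - 1) := by
  set n := (q - 1) / 6 with hn
  have h1 := nat_ineq n (by omega)
  have h2 := pow_le_lcm n (by omega)
  have h3 := lcm_le (6 * n) (by omega)
  have h4 : 2 ^ (6 * n + 6) < primorial (6 * n) := by
    set K := 4 * n * (6 * n) ^ (Nat.primeCounting (Nat.sqrt (6 * n)))
    have : 2 ^ (6 * n + 6) * K < primorial (6 * n) * K := by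
      calc _ < _ := h1
        _ ≤ _ := h2
        _ ≤ _ := Nat.mul_le_mul_left _ h3
        _ = _ := by ring
    exact Nat.lt_of_mul_lt_mul_right this
  exact fin_cover (a := 6 * n) (b := 6 * n + 6) h4 (by omega) (by omega)

theorem prod_nth_prime (n : ℕ) :
    ∏ k ∈ Finset.range n, Nat.nth Nat.Prime k = primorial (Nat.nth Nat.Prime n - 1) := by
  have hpos : 0 < Nat.nth Nat.Prime n := (Nat.prime_nth_prime n).pos
  unfold primorial
  rw [Nat.sub_add_cancel hpos]
  refine Finset.prod_bij (fun k _ => Nat.nth Nat.Prime k) ?_ ?_ ?_ ?_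
  · intro k hk
    rw [Finset.mem_filter, Finset.mem_range]
    exact ⟨Nat.nth_strictMono Nat.infinite_setOfPred_prime (Finset.mem_range.1 hk),
      Nat.prime_nth_prime k⟩
  · intro a _ b _ hab
    exact Nat.nth_injective Nat.infinite_setOfPred_prime hab
  · intro p hp
    rw [Finset.mem_filter, Finset.mem_range] at hp
    have e := Nat.nth_count hp.2
    refine ⟨Nat.count Nat.Prime p, ?_, e⟩
    rw [Finset.mem_range]
    apply (Nat.nth_lt_nth Nat.infinite_setOfPred_prime).1
    rw [e]; exact hp.1
  · intro a _; rfl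

/-- For every integer `n ≥ 10`, the product of the first `n` primes exceeds
`2 ^ p_{n+1}`, where `p_{n+1} = Nat.nth Nat.Prime n`. -/
theorem stmt3 (n : ℕ) (hn : n ≥ 10) :
    (∏ k ∈ Finset.range n, Nat.nth Nat.Prime k) > 2 ^ (Nat.nth Nat.Prime n) := by
  rw [prod_nth_prime]
  have h10 : Nat.nth Nat.Prime 10 = 31 := by
    have h := Nat.nth_count (p := Nat.Prime) (n := 31) (by norm_num)
    have hc : Nat.count Nat.Prime 31 = 10 := by decide
    rwa [hc] at h
  have h31 : 31 ≤ Nat.nth Nat.Prime n := by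
    rw [← h10]
    exact (Nat.nth_strictMono Nat.infinite_setOfPred_prime).monotone hn
  rcases Nat.lt_or_ge 4100 (Nat.nth Nat.Prime n) with h | h
  · exact large_cases _ h
  · exact small_cases _ (Nat.prime_nth_prime n) h31 h
end

section
/- For every integer n ≥ 2, one has π(n) < 1.71678 · n / log(n · log n). -/
open ArithmeticFunction in
theorem log_fact_eq (N M : ℕ) (h : N ≤ M) :
    Real.log (N.factorial : ℝ) = ∑ d ∈ Finset.Ioc 0 M, vonMangoldt d * ((N / d : ℕ) : ℝ) := by
  have h1 := sum_Ioc_mul_zeta_eq_sum vonMangoldt N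
  rw [vonMangoldt_mul_zeta] at h1
  have h2 : ∑ d ∈ Finset.Ioc 0 M, vonMangoldt d * ((N / d : ℕ) : ℝ)
      = ∑ d ∈ Finset.Ioc 0 N, vonMangoldt d * ((N / d : ℕ) : ℝ) := by
    symm
    apply Finset.sum_subset
    · intro x hx
      simp only [Finset.mem_Ioc] at *
      omega
    · intro x hx hx2
      simp only [Finset.mem_Ioc] at *
      rw [Nat.div_eq_of_lt (by omega)]
      simp
  rw [h2, ← h1]
  clear h h1 h2
  induction N with
  | zero => simp
  | succ k ih =>
    rw [Finset.sum_Ioc_succ_top (by omega), ← ih, Nat.factorial_succ]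
    push_cast
    rw [Real.log_mul (by positivity) (by positivity)]
    simp [ArithmeticFunction.log_apply, add_comm]

theorem log_fact_upper (n : ℕ) (hn : n ≠ 0) :
    Real.log (n.factorial : ℝ) ≤ n * Real.log n - n + Real.log n / 2 + 1 := by
  obtain ⟨k, rfl⟩ := Nat.exists_eq_succ_of_ne_zero hn
  have h := Stirling.log_stirlingSeq'_antitone (Nat.zero_le k)
  simp only [Function.comp] at h
  rw [Stirling.log_stirlingSeq_formula, Stirling.log_stirlingSeq_formula] at h
  have h0 : ((k.succ : ℕ) : ℝ) ≠ 0 := by positivity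
  rw [Real.log_mul (by norm_num) h0, Real.log_div h0 (by positivity)] at h
  simp at h
  push_cast at *
  linarith

theorem log_ratio (m : ℕ) (hm : m ≠ 0) :
    Real.log ((30 * m).factorial : ℝ) + Real.log (m.factorial : ℝ)
      - Real.log ((15 * m).factorial : ℝ) - Real.log ((10 * m).factorial : ℝ)
      - Real.log ((6 * m).factorial : ℝ) ≤ 27.64 * m := by
  have a1 := log_fact_upper (30 * m) (by omega)
  have a2 := log_fact_upper m hm
  have a3 := Stirling.le_log_factorial_stirling (n := 15 * m) (by omega)
  have a4 := Stirling.le_log_factorial_stirling (n := 10 * m) (by omega)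
  have a5 := Stirling.le_log_factorial_stirling (n := 6 * m) (by omega)
  have hm0 : (m : ℝ) ≠ 0 := by exact_mod_cast hm
  have hm1 : (1 : ℝ) ≤ m := by exact_mod_cast Nat.one_le_iff_ne_zero.2 hm
  have e30 : Real.log ((30 * m : ℕ) : ℝ) = Real.log 2 + Real.log 3 + Real.log 5 + Real.log m := by
    push_cast
    rw [← Real.log_mul (by norm_num) (by norm_num), ← Real.log_mul (by norm_num) (by norm_num),
      ← Real.log_mul (by norm_num) hm0]
    norm_num
  have e15 : Real.log ((15 * m : ℕ) : ℝ) = Real.log 3 + Real.log 5 + Real.log m := by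
    push_cast
    rw [← Real.log_mul (by norm_num) (by norm_num), 
      ← Real.log_mul (by norm_num) hm0]
    norm_num
  have e10 : Real.log ((10 * m : ℕ) : ℝ) = Real.log 2 + Real.log 5 + Real.log m := by
    push_cast
    rw [← Real.log_mul (by norm_num) (by norm_num), 
      ← Real.log_mul (by norm_num) hm0]
    norm_num
  have e6 : Real.log ((6 * m : ℕ) : ℝ) = Real.log 2 + Real.log 3 + Real.log m := by
    push_cast
    rw [← Real.log_mul (by norm_num) (by norm_num), 
      ← Real.log_mul (by norm_num) hm0]
    norm_num
  rw [e30] at a1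
  rw [e15] at a3
  rw [e10] at a4
  rw [e6] at a5
  have hpi : 1 ≤ Real.log (2 * Real.pi) := by
    rw [Real.le_log_iff_exp_le (by positivity)]
    linarith [Real.exp_one_lt_d9, Real.pi_gt_three]
  have hl : 0 ≤ Real.log m := Real.log_nonneg hm1
  have l2 := Real.log_two_lt_d9
  have l2' := Real.log_two_gt_d9
  have l3 := Real.log_three_lt_d9
  have l3' := Real.log_three_gt_d9
  have l5 := Real.log_five_lt_d9
  have l5' := Real.log_five_gt_d9
  have key : (m : ℝ) * (14 * Real.log 2 + 9 * Real.log 3 + 5 * Real.log 5) ≤ m * 27.64 := by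
    apply mul_le_mul_of_nonneg_left _ (by linarith)
    linarith
  push_cast at a1 a3 a4 a5
  linarith

theorem floor_ineq (m d : ℕ) (hd : 0 < d) :
    15 * m / d + 10 * m / d + 6 * m / d ≤ 30 * m / d + m / d := by
  have hq : ∀ k, k * m / d = k * (m / d) + k * (m % d) / d := by
    intro k
    conv_lhs => rw [← Nat.div_add_mod m d]
    rw [Nat.mul_add, show k * (d * (m / d)) = d * (k * (m / d)) by ring, Nat.mul_add_div hd]
  rw [hq 15, hq 10, hq 6, hq 30]
  have hr := Nat.mod_lt m hd
  generalize m % d = r at *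
  have g : ∀ k, ∃ q, k * r / d = q ∧ d * q ≤ k * r ∧ k * r < d * q + d := by
    intro k
    refine ⟨_, rfl, Nat.mul_div_le _ _, ?_⟩
    have := Nat.lt_mul_div_succ (k * r) hd
    rw [Nat.mul_add] at this
    omega
  -- t = ⌊30 r / d⌋ ; then the other floors are t/2, t/3, t/5
  have h15 : 15 * r / d = 30 * r / d / 2 := by
    rw [Nat.div_div_eq_div_mul, mul_comm d 2, ← Nat.div_div_eq_div_mul]; congr 1; omega
  have h10 : 10 * r / d = 30 * r / d / 3 := by
    rw [Nat.div_div_eq_div_mul, mul_comm d 3, ← Nat.div_div_eq_div_mul]; congr 1; omega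
  have h6 : 6 * r / d = 30 * r / d / 5 := by
    rw [Nat.div_div_eq_div_mul, mul_comm d 5, ← Nat.div_div_eq_div_mul]; congr 1; omega
  rw [h15, h10, h6]
  have ht : 30 * r / d < 30 := by
    rw [Nat.div_lt_iff_lt_mul hd]; omega
  generalize 30 * r / d = t at *
  omega

theorem floor_ineq' (m p : ℕ) (h1 : 5 * m < p) (h2 : p ≤ 30 * m) :
    15 * m / p + 10 * m / p + 6 * m / p + 1 ≤ 30 * m / p + m / p := by
  have hd : 0 < p := by omega
  have h15 : 15 * m / p = 30 * m / p / 2 := by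
    rw [Nat.div_div_eq_div_mul, mul_comm p 2, ← Nat.div_div_eq_div_mul]; congr 1; omega
  have h10 : 10 * m / p = 30 * m / p / 3 := by
    rw [Nat.div_div_eq_div_mul, mul_comm p 3, ← Nat.div_div_eq_div_mul]; congr 1; omega
  have h6 : 6 * m / p = 30 * m / p / 5 := by
    rw [Nat.div_div_eq_div_mul, mul_comm p 5, ← Nat.div_div_eq_div_mul]; congr 1; omega
  rw [h15, h10, h6]
  have ht : 30 * m / p < 6 := by
    rw [Nat.div_lt_iff_lt_mul hd]; omega
  have ht' : 1 ≤ 30 * m / p := by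
    rw [Nat.le_div_iff_mul_le hd]; omega
  generalize 30 * m / p = t at *
  generalize m / p = w
  interval_cases t <;> omega

open ArithmeticFunction in
theorem pi_step (m : ℕ) (hm : m ≠ 0) :
    ((30 * m).primeCounting : ℝ) * Real.log (5 * m)
      ≤ (5 * m).primeCounting * Real.log (5 * m) + 27.64 * m := by
  have h := log_ratio m hm
  rw [log_fact_eq (30 * m) (30 * m) le_rfl, log_fact_eq m (30 * m) (by omega),
    log_fact_eq (15 * m) (30 * m) (by omega), log_fact_eq (10 * m) (30 * m) (by omega),
    log_fact_eq (6 * m) (30 * m) (by omega), ← Finset.sum_add_distrib, ← Finset.sum_sub_distrib,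
    ← Finset.sum_sub_distrib, ← Finset.sum_sub_distrib] at h
  have hle : ∑ d ∈ Finset.Ioc 0 (30 * m), (if d.Prime ∧ 5 * m < d then Real.log (5 * m) else 0)
      ≤ 27.64 * m := by
    refine le_trans (Finset.sum_le_sum ?_) h
    intro d hd
    rw [Finset.mem_Ioc] at hd
    have hL : 0 ≤ vonMangoldt d := vonMangoldt_nonneg
    split_ifs with hc
    · have f := floor_ineq' m d hc.2 hd.2
      have f' : ((15 * m / d : ℕ) : ℝ) + ((10 * m / d : ℕ) : ℝ) + ((6 * m / d : ℕ) : ℝ) + 1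
        ≤ ((30 * m / d : ℕ) : ℝ) + ((m / d : ℕ) : ℝ) := by exact_mod_cast f
      have hlog : Real.log (5 * m) ≤ vonMangoldt d := by
        rw [vonMangoldt_apply_prime hc.1]
        apply Real.log_le_log
        · have : (0:ℝ) < m := by exact_mod_cast Nat.pos_of_ne_zero hm
          positivity
        · exact_mod_cast hc.2.le
      nlinarith
    · have f := floor_ineq m d hd.1
      have f' : ((15 * m / d : ℕ) : ℝ) + ((10 * m / d : ℕ) : ℝ) + ((6 * m / d : ℕ) : ℝ)
        ≤ ((30 * m / d : ℕ) : ℝ) + ((m / d : ℕ) : ℝ) := by exact_mod_cast f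
      nlinarith
  rw [← Finset.sum_filter, Finset.sum_const, nsmul_eq_mul] at hle
  have hc : (30 * m).primeCounting = (5 * m).primeCounting +
      (Finset.filter (fun d => d.Prime ∧ 5 * m < d) (Finset.Ioc 0 (30 * m))).card := by
    unfold Nat.primeCounting Nat.primeCounting'
    rw [Nat.count_eq_card_filter_range, Nat.count_eq_card_filter_range, ← Finset.card_union_of_disjoint]
    · congr 1
      ext x
      simp only [Finset.mem_union, Finset.mem_filter, Finset.mem_range, Finset.mem_Ioc]
      constructor
      · rintro ⟨hx, hp⟩
        have := hp.pos
        by_cases hh : 5 * m < x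
        · right; exact ⟨by omega, hp, hh⟩
        · left; exact ⟨by omega, hp⟩
      · rintro (⟨hx, hp⟩ | ⟨hx, hp, _⟩)
        · exact ⟨by omega, hp⟩
        · exact ⟨by omega, hp⟩
    · rw [Finset.disjoint_left]
      intro x
      simp only [Finset.mem_filter, Finset.mem_range, Finset.mem_Ioc]
      omega
  rw [hc]
  push_cast
  linarith

theorem ineq_core (s δ : ℝ) (hs1 : 1 ≤ s) (hs2 : s ≤ 1.2442) (hd0 : 0 ≤ δ) (hd : δ ≤ 0.2213) :
    1.71678 / s + 5.528 < 5.99 * 1.71678 / (s + δ) := by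
  have h1 : 5.99 * 1.71678 / (s + 0.2213) ≤ 5.99 * 1.71678 / (s + δ) := by gcongr
  refine lt_of_lt_of_le ?_ h1
  rw [div_add' _ _ _ (by positivity), div_lt_div_iff₀ (by positivity) (by positivity)]
  nlinarith

/-- The analytic inequality behind the induction step; `u = log x`. -/
theorem ineq_step (u : ℝ) (hu : 9 ≤ u) :
    1.71678 / (u + Real.log u) + 5.528 / u
      < 5.99 * 1.71678 / (u + Real.log 6 + Real.log (u + Real.log 6)) := by
  have h0 : 0 < u := by linarith
  have l6 : Real.log 6 = Real.log 2 + Real.log 3 := by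
    rw [← Real.log_mul (by norm_num) (by norm_num)]; norm_num
  have l2 := Real.log_two_lt_d9
  have l3 := Real.log_three_lt_d9
  have l2' := Real.log_two_gt_d9
  have l3' := Real.log_three_gt_d9
  have hv0 : 0 ≤ Real.log u := Real.log_nonneg (by linarith)
  have h9 : Real.log 9 = 2 * Real.log 3 := by
    rw [show (9:ℝ) = 3 ^ 2 by norm_num, Real.log_pow]; norm_num
  have hv : Real.log u ≤ 0.2442 * u := by
    have := Real.log_le_sub_one_of_pos (x := u / 9) (by positivity)
    rw [Real.log_div (by positivity) (by norm_num)] at this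
    linarith
  have hw : Real.log (u + Real.log 6) ≤ Real.log u + Real.log 6 / u := by
    have := Real.log_le_sub_one_of_pos (x := (u + Real.log 6) / u) (by rw [l6]; positivity)
    rw [Real.log_div (by rw [l6]; positivity) (by positivity), add_div, div_self h0.ne'] at this
    linarith
  have hw0 : 0 ≤ Real.log (u + Real.log 6) := Real.log_nonneg (by linarith)
  have hc := ineq_core (1 + Real.log u / u) ((Real.log 6 + Real.log 6 / u) / u)
    (by linarith [div_nonneg hv0 h0.le])
    (by
      have : Real.log u / u ≤ 0.2442 := by rw [div_le_iff₀ h0]; exact hv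
      linarith)
    (by rw [l6]; positivity)
    (by
      have : Real.log 6 / u ≤ 0.1991 := by rw [div_le_iff₀ h0]; linarith
      rw [div_le_iff₀ h0]; linarith)
  have e1 : 1.71678 / (u + Real.log u) + 5.528 / u
      = (1.71678 / (1 + Real.log u / u) + 5.528) / u := by
    have : u + Real.log u ≠ 0 := by positivity
    have h2 : 1 + Real.log u / u = (u + Real.log u) / u := by field_simp
    rw [h2]
    field_simp
  have e2 : (5.99 * 1.71678 / (1 + Real.log u / u + (Real.log 6 + Real.log 6 / u) / u)) / u
      = 5.99 * 1.71678 / (u + Real.log u + Real.log 6 + Real.log 6 / u) := by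
    rw [div_div]
    congr 1
    field_simp
    ring
  rw [e1]
  refine lt_of_lt_of_le (div_lt_div_of_pos_right hc h0) ?_
  rw [e2]
  apply div_le_div_of_nonneg_left (by norm_num)
  · linarith
  · linarith

theorem log_pos_aux (n : ℕ) (hn : 2 ≤ n) : 0 < Real.log (n * Real.log n) := by
  have h2 : (2:ℝ) ≤ n := by exact_mod_cast hn
  have := Real.log_two_gt_d9
  have h3 := Real.log_le_log (by norm_num) h2
  apply Real.log_pos
  nlinarith

theorem step (N m : ℕ) (hN : 50000 ≤ N) (h1 : N ≤ 30 * m) (h2 : 30 * m ≤ N + 29)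
    (hpi : ((30 * m).primeCounting : ℝ) * Real.log (5 * m)
      ≤ (5 * m).primeCounting * Real.log (5 * m) + 27.64 * m)
    (ih : ((5 * m : ℕ).primeCounting : ℝ)
      < 1.71678 * (5 * m : ℕ) / Real.log ((5 * m : ℕ) * Real.log (5 * m : ℕ))) :
    (N.primeCounting : ℝ) < 1.71678 * N / Real.log (N * Real.log N) := by
  push_cast at ih
  set x : ℝ := 5 * m with hx
  have hx1 : (8333 : ℝ) ≤ x := by
    have : 8333 ≤ 5 * m := by omega
    rw [hx]; exact_mod_cast this
  have hNx : 5.99 * x ≤ N := by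
    have : (30 * m : ℝ) ≤ N + 29 := by exact_mod_cast h2
    linarith
  have hNx' : (N : ℝ) ≤ 6 * x := by
    have : (N : ℝ) ≤ 30 * m := by exact_mod_cast h1
    linarith
  have hu : 9 ≤ Real.log x := by
    rw [Real.le_log_iff_exp_le (by linarith)]
    have : Real.exp 9 = Real.exp 1 ^ 9 := by rw [← Real.exp_nat_mul]; norm_num
    rw [this]
    have h := pow_le_pow_left₀ (Real.exp_pos 1).le Real.exp_one_lt_d9.le 9
    refine h.trans (le_trans ?_ hx1)
    norm_num
  set u := Real.log x with hudef
  have hst := ineq_step u hu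
  have hmono : ((N.primeCounting : ℕ) : ℝ) ≤ (30 * m).primeCounting := by
    exact_mod_cast Nat.monotone_primeCounting h1
  have hlx : Real.log (x * u) = u + Real.log u := by
    rw [Real.log_mul (by linarith) (by linarith)]
  have hlN : Real.log (N * Real.log N) ≤ u + Real.log 6 + Real.log (u + Real.log 6) := by
    have e : Real.log (6 * x) = u + Real.log 6 := by
      rw [Real.log_mul (by norm_num) (by linarith)]; ring
    have hN0 : (0:ℝ) < N := by linarith
    have hlogN : Real.log N ≤ u + Real.log 6 := by
      rw [← e]; exact Real.log_le_log hN0 hNx'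
    have hlogN0 : 0 < Real.log N := Real.log_pos (by linarith)
    rw [Real.log_mul hN0.ne' hlogN0.ne']
    exact add_le_add hlogN (Real.log_le_log hlogN0 hlogN)
  have hp := log_pos_aux N (by omega)
  rw [hlx] at ih
  have hpi2 : ((30 * m).primeCounting : ℝ) ≤ (5 * m).primeCounting + 5.528 * x / u := by
    have hu0 : 0 < u := by linarith
    have : ((30 * m).primeCounting : ℝ) ≤ ((5 * m).primeCounting * u + 27.64 * m) / u := by
      rw [le_div_iff₀ hu0]; exact hpi
    rw [add_div, mul_div_assoc, div_self hu0.ne', mul_one] at this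
    rw [hx]
    convert! this using 3
    ring
  have hfin : 5.99 * 1.71678 / (u + Real.log 6 + Real.log (u + Real.log 6)) * x
      ≤ 1.71678 * N / Real.log (N * Real.log N) := by
    rw [div_mul_eq_mul_div]
    apply div_le_div₀ (by positivity) (by linarith) hp hlN
  have hx0 : 0 < x := by linarith
  have := mul_lt_mul_of_pos_right hst hx0
  have e3 : (1.71678 / (u + Real.log u) + 5.528 / u) * x
    = 1.71678 * x / (u + Real.log u) + 5.528 * x / u := by ring
  linarith

/-- Upper bound certificate for the inequality on `[a, b]`, given `π ≤ c` there. -/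
def okTest (a b c : ℕ) : Bool :=
  Nat.ble (c * (11 * 6931471808 * ((Nat.log2 (b ^ 64) + 1)
      + (Nat.log2 ((Nat.log2 (b ^ 64) + 1) ^ 64) + 1))) + 1)
    (a * 12086131200000 + c * (384 * 11 * 6931471803 + 2560000000000))

theorem log_nat_le (b : ℕ) (hb : b ≠ 0) :
    Real.log b ≤ ((Nat.log2 (b ^ 64) + 1 : ℕ) : ℝ) / 64 * Real.log 2 := by
  have h : b ^ 64 < 2 ^ (Nat.log2 (b ^ 64) + 1) := Nat.lt_log2_self
  have h2 : (b : ℝ) ^ 64 ≤ 2 ^ (Nat.log2 (b ^ 64) + 1) := by exact_mod_cast h.le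
  have h3 := Real.log_le_log (by positivity) h2
  rw [Real.log_pow, Real.log_pow] at h3
  push_cast at h3 ⊢
  linarith

theorem loglog_two : Real.log (Real.log 2) ≤ - (4 / 11) := by
  have h0 : 0 < Real.log 2 := Real.log_pos (by norm_num)
  have h1 : Real.exp 1 ^ 4 * Real.log 2 ^ 11 ≤ 1 := by
    calc Real.exp 1 ^ 4 * Real.log 2 ^ 11 ≤ 2.7182818286 ^ 4 * 0.6931471808 ^ 11 := by
          gcongr
          · exact Real.exp_one_lt_d9.le
          · exact Real.log_two_lt_d9.le
      _ ≤ 1 := by norm_num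
  have h2 := Real.log_le_log (by positivity) h1
  rw [Real.log_mul (by positivity) (by positivity), Real.log_pow, Real.log_pow, Real.log_exp,
    Real.log_one] at h2
  push_cast at h2
  linarith

theorem okTest_sound (a b c n : ℕ) (h : okTest a b c = true) (hn : 2 ≤ n) (h1 : a ≤ n)
    (h2 : n ≤ b) (hc : n.primeCounting ≤ c) :
    (n.primeCounting : ℝ) < 1.71678 * n / Real.log (n * Real.log n) := by
  have hl2 : 0 < Real.log 2 := Real.log_pos (by norm_num)
  have hn2 : (2:ℝ) ≤ n := by exact_mod_cast hn
  have hnb : (n : ℝ) ≤ b := by exact_mod_cast h2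
  have han : (a : ℝ) ≤ n := by exact_mod_cast h1
  have hln : 0 < Real.log n := Real.log_pos (by linarith)
  have hpos : 0 < Real.log (n * Real.log n) := by
    have := Real.log_two_gt_d9
    have h3 := Real.log_le_log (by norm_num) hn2
    apply Real.log_pos
    nlinarith
  rw [lt_div_iff₀ hpos]
  have hb := log_nat_le b (by omega)
  simp only [okTest] at h
  have h := Nat.le_of_ble_eq_true h
  generalize ht : Nat.log2 (b ^ 64) + 1 = t at *
  have ht0 : t ≠ 0 := by omega
  have hb2 := log_nat_le t ht0
  generalize ht2 : Nat.log2 (t ^ 64) + 1 = t2 at *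
  have hlog : Real.log n ≤ (t : ℝ) / 64 * Real.log 2 :=
    (Real.log_le_log (by linarith) hnb).trans hb
  have ht0' : (0:ℝ) < t := by positivity
  have hll : Real.log (Real.log n) ≤ (t2 : ℝ) / 64 * Real.log 2 - 6 * Real.log 2 - 4 / 11 := by
    refine (Real.log_le_log hln hlog).trans ?_
    rw [Real.log_mul (by positivity) (by positivity), Real.log_div (by positivity) (by norm_num),
      show (64:ℝ) = 2 ^ 6 by norm_num, Real.log_pow]
    have := loglog_two
    push_cast
    norm_num at hb2 ⊢
    linarith
  have hL : Real.log (n * Real.log n) ≤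
      (t + t2) / 64 * 0.6931471808 - 6 * 0.6931471803 - 4 / 11 := by
    rw [Real.log_mul (by positivity) hln.ne']
    have g1 := Real.log_two_lt_d9
    have g2 := Real.log_two_gt_d9
    have g3 : ((t:ℝ) + t2) / 64 * Real.log 2 ≤ (t + t2) / 64 * 0.6931471808 := by gcongr
    linarith
  have hc' : (n.primeCounting : ℝ) ≤ c := by exact_mod_cast hc
  have h' : (c : ℝ) * (11 * 6931471808 * (t + t2)) + 1 ≤
    a * 12086131200000 + c * (384 * 11 * 6931471803 + 2560000000000) := by exact_mod_cast h
  have hcc : (c:ℝ) * Real.log (n * Real.log n)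
      ≤ c * ((t + t2) / 64 * 0.6931471808 - 6 * 0.6931471803 - 4 / 11) :=
    mul_le_mul_of_nonneg_left hL (by positivity)
  have := mul_le_mul_of_nonneg_right hc' hpos.le
  linarith

/-- Number of `n ∈ [a, a + 2 ^ j)` coprime to `q`. -/
def cnt (q : ℕ) : ℕ → ℕ → ℕ
  | 0, a => bif Nat.beq (Nat.gcd a q) 1 then 1 else 0
  | j + 1, a => cnt q j a + cnt q j (a + 2 ^ j)

theorem cnt_sound (q : ℕ) (j a : ℕ) (hq : ∀ p, a ≤ p → p.Prime → Nat.gcd p q = 1) :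
    Nat.primeCounting' (a + 2 ^ j) ≤ Nat.primeCounting' a + cnt q j a := by
  induction j generalizing a with
  | zero =>
    have : Nat.primeCounting' (a + 1) = Nat.primeCounting' a + if a.Prime then 1 else 0 :=
      Nat.count_succ _ _
    rw [pow_zero, this]
    by_cases hp : a.Prime
    · simp [cnt, hq a le_rfl hp, hp]
    · simp [hp]
  | succ j ih =>
    have i1 := ih a hq
    have hj : 0 < 2 ^ j := by positivity
    have i2 := ih (a + 2 ^ j) (fun p hp => hq p (by omega))
    rw [show a + 2 ^ (j + 1) = a + 2 ^ j + 2 ^ j by ring]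
    simp only [cnt]
    omega

/-- Check `k` consecutive blocks of length `2 ^ j` from `a`, where `c` bounds the primes below `a`,
and `e` bounds the final count. -/
def runTest (q j e : ℕ) : ℕ → ℕ → ℕ → Bool
  | 0, _, c => Nat.ble c e
  | k + 1, a, c => okTest a (a + 2 ^ j - 1) (c + cnt q j a)
      && runTest q j e k (a + 2 ^ j) (c + cnt q j a)

theorem runTest_sound (q j e k a c : ℕ) (ha : 2 ≤ a)
    (hq : ∀ p, a ≤ p → p.Prime → Nat.gcd p q = 1)
    (hc : Nat.primeCounting' a ≤ c) (h : runTest q j e k a c = true) :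
    Nat.primeCounting' (a + k * 2 ^ j) ≤ e ∧ ∀ n : ℕ, a ≤ n → n < a + k * 2 ^ j →
      (n.primeCounting : ℝ) < 1.71678 * n / Real.log (n * Real.log n) := by
  induction k generalizing a c with
  | zero =>
    simp only [runTest] at h
    have := Nat.le_of_ble_eq_true h
    refine ⟨by simpa using hc.trans this, ?_⟩
    intro n h1 h2
    omega
  | succ k ih =>
    simp only [runTest, Bool.and_eq_true] at h
    have hc' : Nat.primeCounting' (a + 2 ^ j) ≤ c + cnt q j a := by
      have := cnt_sound q j a hq
      omega
    have hj : 0 < 2 ^ j := by positivity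
    obtain ⟨r1, r2⟩ := ih (a + 2 ^ j) (c + cnt q j a) (by omega)
      (fun p hp => hq p (by omega)) hc' h.2
    have e1 : a + (k + 1) * 2 ^ j = a + 2 ^ j + k * 2 ^ j := by ring
    rw [e1]
    refine ⟨r1, fun n h1 h2 => ?_⟩
    by_cases hn : n < a + 2 ^ j
    · refine okTest_sound _ _ _ n h.1 (by omega) h1 (by omega) (le_trans ?_ hc')
      exact Nat.monotone_primeCounting' (by omega)
    · exact r2 n (by omega) h2

theorem coprime_one (p : ℕ) (hp : 17 ≤ p) (hpp : p.Prime) : Nat.gcd p 30030 = 1 := by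
  have h : Nat.Coprime p (Nat.factorial 16) := by
    rw [hpp.coprime_iff_not_dvd, hpp.dvd_factorial]; omega
  exact Nat.Coprime.coprime_dvd_right (by decide +kernel) h

/-- The product of the primes below `256`. -/
def primeProd : ℕ :=
  64266330917908644872330635228106713310880186591609208114244758680898150367880703152525200743234420230

theorem coprime_two (p : ℕ) (hp : 256 ≤ p) (hpp : p.Prime) : Nat.gcd p primeProd = 1 := by
  have h : Nat.Coprime p (Nat.factorial 255) := by
    rw [hpp.coprime_iff_not_dvd, hpp.dvd_factorial]; omega
  exact Nat.Coprime.coprime_dvd_right (by decide +kernel) h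

theorem small_case (n : ℕ) (h2 : 2 ≤ n) (hn : n < 65536) :
    (n.primeCounting : ℝ) < 1.71678 * n / Real.log (n * Real.log n) := by
  have key : ∀ a < 17, 2 ≤ a → okTest a a (Nat.primeCounting a) = true := by decide +kernel
  obtain ⟨c0, r0⟩ := runTest_sound 30030 0 54 239 17 6 (by norm_num) coprime_one
    (by decide +kernel) (by decide +kernel)
  obtain ⟨c1, r1⟩ := runTest_sound primeProd 4 97 16 256 54 (by norm_num) coprime_two
    c0 (by decide +kernel)
  obtain ⟨c2, r2⟩ := runTest_sound primeProd 6 172 8 512 97 (by norm_num)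
    (fun p hp => coprime_two p (by omega)) c1 (by decide +kernel)
  obtain ⟨c3, r3⟩ := runTest_sound primeProd 7 309 8 1024 172 (by norm_num)
    (fun p hp => coprime_two p (by omega)) c2 (by decide +kernel)
  obtain ⟨c4, r4⟩ := runTest_sound primeProd 8 564 8 2048 309 (by norm_num)
    (fun p hp => coprime_two p (by omega)) c3 (by decide +kernel)
  obtain ⟨c5, r5⟩ := runTest_sound primeProd 9 1028 8 4096 564 (by norm_num)
    (fun p hp => coprime_two p (by omega)) c4 (by decide +kernel)
  obtain ⟨c6, r6⟩ := runTest_sound primeProd 10 1900 8 8192 1028 (by norm_num)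
    (fun p hp => coprime_two p (by omega)) c5 (by decide +kernel)
  obtain ⟨c7, r7⟩ := runTest_sound primeProd 11 3512 8 16384 1900 (by norm_num)
    (fun p hp => coprime_two p (by omega)) c6 (by decide +kernel)
  obtain ⟨c8, r8⟩ := runTest_sound primeProd 12 6542 8 32768 3512 (by norm_num)
    (fun p hp => coprime_two p (by omega)) c7 (by decide +kernel)
  norm_num at r0 r1 r2 r3 r4 r5 r6 r7 r8
  rcases Nat.lt_or_ge n 17 with h | h
  · exact okTest_sound n n _ n (key n h h2) h2 le_rfl le_rfl le_rfl
  rcases Nat.lt_or_ge n 256 with h | h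
  · norm_num; exact r0 n (by omega) h
  rcases Nat.lt_or_ge n 512 with h | h
  · norm_num; exact r1 n (by omega) h
  rcases Nat.lt_or_ge n 1024 with h | h
  · norm_num; exact r2 n (by omega) h
  rcases Nat.lt_or_ge n 2048 with h | h
  · norm_num; exact r3 n (by omega) h
  rcases Nat.lt_or_ge n 4096 with h | h
  · norm_num; exact r4 n (by omega) h
  rcases Nat.lt_or_ge n 8192 with h | h
  · norm_num; exact r5 n (by omega) h
  rcases Nat.lt_or_ge n 16384 with h | h
  · norm_num; exact r6 n (by omega) h
  rcases Nat.lt_or_ge n 32768 with h | h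
  · norm_num; exact r7 n (by omega) h
  norm_num; exact r8 n (by omega) hn

/-- For every integer `n ≥ 2`, `π n < 1.71678 * n / log (n * log n)`. -/
theorem stmt4 (n : ℕ) (hn : n ≥ 2) :
    (n.primeCounting : ℝ) < 1.71678 * n / Real.log (n * Real.log n) := by
  induction n using Nat.strong_induction_on with
  | _ n ih =>
    rcases Nat.lt_or_ge n 65536 with h | h
    · exact small_case n hn h
    · have hm : (n + 29) / 30 ≠ 0 := by omega
      exact step n ((n + 29) / 30) (by omega) (by omega) (by omega)
        (pi_step _ hm) (ih _ (by omega) (by omega))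
end

section
/- For every integer n > 74, one has π(n)/n < 1 - log(2) · (1 + 1/n); equivalently, n - π(n) > (n + 1) · log 2. -/
theorem stmt8_base : ∀ n < 104, 74 < n →
    69315 * (n + 1) + 100000 * n.primeCounting < 100000 * n := by
  decide +kernel

theorem stmt8_aux (n : ℕ) (hn : 74 < n) :
    69315 * (n + 1) + 100000 * n.primeCounting < 100000 * n := by
  induction n using Nat.strong_induction_on with
  | _ n ih =>
    by_cases h : n < 104
    · exact stmt8_base n h hn
    · obtain ⟨k, rfl⟩ : ∃ k, n = k + 29 := ⟨n - 29, by omega⟩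
      have h1 := ih k (by omega) (by omega)
      have h2 := Nat.primeCounting_add_le (a := 30) (k := k) (by norm_num) (by omega) 29
      have h3 : Nat.totient 30 = 8 := by decide +kernel
      rw [h3] at h2
      omega

/-- For every integer `n > 74`, `π n / n < 1 - log 2 * (1 + 1/n)`; equivalently,
`n - π n > (n + 1) * log 2`. -/
theorem stmt8 (n : ℕ) (hn : n > 74) :
    (n.primeCounting : ℝ) / n < 1 - Real.log 2 * (1 + 1 / (n : ℝ)) ∧
    (n : ℝ) - n.primeCounting > ((n : ℝ) + 1) * Real.log 2 := by
  have h : (69315 * ((n : ℝ) + 1) + 100000 * n.primeCounting) < 100000 * n := by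
    exact_mod_cast stmt8_aux n hn
  have hl : Real.log 2 < 0.69315 := lt_trans Real.log_two_lt_d9 (by norm_num)
  have hpos : (0 : ℝ) < n := by exact_mod_cast (by omega : 0 < n)
  have key : (n : ℝ) - n.primeCounting > ((n : ℝ) + 1) * Real.log 2 := by
    have := mul_lt_mul_of_pos_left hl (by linarith : (0 : ℝ) < n + 1)
    linarith
  refine ⟨?_, key⟩
  rw [div_lt_iff₀ hpos]
  have : (1 - Real.log 2 * (1 + 1 / (n : ℝ))) * n = n - (n + 1) * Real.log 2 := by
    field_simp
  rw [this]
  linarith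
end

section
/- Let c be a real number with 1 < c < e (where e is Euler's number) and let k ≥ 0 be an integer. Then there exists a natural number N such that for every integer n > N, one has n - π(n) > (log c / log n) · p_{n+k}. -/
open MeasureTheory Filter Topology Set

namespace PNTLower

noncomputable def ker (x : ℝ) : ℝ := Real.sinc (x / 2) ^ 2

lemma ker_cont : Continuous ker := by
  unfold ker
  exact (Real.continuous_sinc.comp (by fun_prop)).pow 2

lemma ker_nonneg (x : ℝ) : 0 ≤ ker x := sq_nonneg _

lemma ker_le (x : ℝ) : ker x ≤ 5 * (1 + x ^ 2)⁻¹ := by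
  have h1 : ker x ≤ 1 := by
    unfold ker
    have := Real.abs_sinc_le_one (x / 2)
    rw [← sq_abs]
    nlinarith [abs_nonneg (Real.sinc (x / 2))]
  have h2 : x ^ 2 * ker x ≤ 4 := by
    by_cases hx : x = 0
    · simp [hx]
    · unfold ker
      rw [Real.sinc_of_ne_zero (by positivity)]
      have := Real.sin_sq_le_one (x / 2)
      field_simp
      nlinarith
  rw [← div_eq_mul_inv, le_div_iff₀ (by positivity)]
  linarith

lemma ker_integrable : Integrable ker := by
  refine (integrable_inv_one_add_sq.const_mul 5).mono' ker_cont.aestronglyMeasurable ?_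
  refine Eventually.of_forall fun x => ?_
  rw [Real.norm_of_nonneg (ker_nonneg x)]
  exact ker_le x

lemma ker_integral_pos : 0 < ∫ x, ker x :=
  integral_pos_of_integrable_nonneg_nonzero (x := 0) ker_cont ker_integrable
    (fun x => ker_nonneg x) (by simp [ker])

lemma ker_eq (x : ℝ) : ∫ y in (0 : ℝ)..1, 2 * (1 - y) * Real.cos (y * x) = ker x := by
  by_cases hx : x = 0
  · subst hx
    have : ∀ y ∈ uIcc (0 : ℝ) 1, HasDerivAt (fun y : ℝ => 2 * y - y ^ 2)
        (2 * (1 - y) * Real.cos (y * 0)) y := by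
      intro y _
      have := ((hasDerivAt_id y).const_mul 2).sub ((hasDerivAt_id y).pow 2)
      convert! this using 1
      simp; ring
    rw [intervalIntegral.integral_eq_sub_of_hasDerivAt this
      (Continuous.intervalIntegrable (by fun_prop) _ _)]
    simp [ker]; norm_num
  · have : ∀ y ∈ uIcc (0 : ℝ) 1, HasDerivAt
        (fun y : ℝ => 2 * (1 - y) * (Real.sin (y * x) / x) - 2 * (Real.cos (y * x) / x ^ 2))
        (2 * (1 - y) * Real.cos (y * x)) y := by
      intro y _
      have e : HasDerivAt (fun y : ℝ => y * x) x y := by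
        simpa using (hasDerivAt_id y).mul_const x
      have h1 : HasDerivAt (fun y : ℝ => 2 * (1 - y)) (-2) y := by
        simpa using ((hasDerivAt_id y).const_sub 1).const_mul 2
      have := (h1.mul (e.sin.div_const x)).sub ((e.cos.div_const (x ^ 2)).const_mul 2)
      convert! this using 1
      field_simp
      ring
    rw [intervalIntegral.integral_eq_sub_of_hasDerivAt this
      (Continuous.intervalIntegrable (by fun_prop) _ _)]
    unfold ker
    rw [Real.sinc_of_ne_zero (by positivity), div_pow, Real.sin_sq_eq_half_sub]
    simp only [mul_div_cancel₀ x (two_ne_zero)]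
    field_simp
    simp
    ring

lemma integral_re_aux {μ : Measure ℝ} {f : ℝ → ℂ} (hf : Integrable f μ) :
    ∫ x, (f x).re ∂μ = (∫ x, f x ∂μ).re := integral_re (𝕜 := ℂ) hf

/-- the complex kernel -/
lemma ker_eq_re (x : ℝ) :
    (∫ y in Ioc (0 : ℝ) 1, ((2 * (1 - y) : ℝ) : ℂ) * Complex.exp ((y * x : ℝ) * Complex.I)).re
      = ker x := by
  have hi : IntegrableOn (fun y : ℝ => ((2 * (1 - y) : ℝ) : ℂ) *
      Complex.exp ((y * x : ℝ) * Complex.I)) (Ioc 0 1) :=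
    (Continuous.integrableOn_Icc (by fun_prop)).mono_set Ioc_subset_Icc_self
  rw [← ker_eq, intervalIntegral.integral_of_le zero_le_one]
  rw [← integral_re_aux hi]
  congr 1
  ext y
  rw [Complex.re_ofReal_mul, Complex.exp_ofReal_mul_I_re]

variable {b : ℝ → ℝ} {M : ℝ} {H : ℂ → ℂ}

lemma fubini_step (hb : Measurable b) (hM : ∀ t, |b t| ≤ M)
    (hH : ∀ z : ℂ, 0 < z.re → H z = ∫ t in Ioi (0 : ℝ), (b t : ℂ) * Complex.exp (-(z * t)))
    {d : ℝ} (hd : 0 < d) (u : ℝ) :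
    (∫ y in Ioc (0 : ℝ) 1, ((2 * (1 - y) : ℝ) : ℂ) * H (d + y * Complex.I) *
        Complex.exp ((y * u : ℝ) * Complex.I)).re
      = ∫ t in Ioi (0 : ℝ), b t * Real.exp (-(d * t)) * ker (u - t) := by
  have hM0 : 0 ≤ M := (abs_nonneg _).trans (hM 0)
  have hexp : IntegrableOn (fun t : ℝ => Real.exp (-(d * t))) (Ioi 0) := by
    simpa using integrableOn_exp_mul_Ioi (a := -d) (by linarith) 0
  set F : ℝ → ℝ → ℂ := fun y t => ((2 * (1 - y) : ℝ) : ℂ) *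
    ((b t : ℂ) * Complex.exp (-((d + y * Complex.I) * t))) *
        Complex.exp ((y * u : ℝ) * Complex.I) with hF
  have hint : Integrable (Function.uncurry F)
      ((volume.restrict (Ioc (0 : ℝ) 1)).prod (volume.restrict (Ioi (0 : ℝ)))) := by
    have hg : Integrable (fun p : ℝ × ℝ => (2 * M) * Real.exp (-(d * p.2)))
        ((volume.restrict (Ioc (0 : ℝ) 1)).prod (volume.restrict (Ioi (0 : ℝ)))) :=
      Integrable.mul_prod (f := fun _ : ℝ => (2 * M)) (integrable_const _) hexp
    refine hg.mono' ?_ ?_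
    · refine Measurable.aestronglyMeasurable ?_
      simp only [hF, Function.uncurry_def]
      fun_prop
    · rw [Measure.prod_restrict]
      refine (ae_restrict_mem (measurableSet_Ioc.prod measurableSet_Ioi)).mono ?_
      rintro ⟨y, t⟩ ⟨⟨hy0, hy1⟩, ht⟩
      simp only at hy0 hy1
      simp only [hF, Function.uncurry_def, norm_mul, Complex.norm_exp,
        Complex.norm_real, Real.norm_eq_abs]
      rw [show (-((d + y * Complex.I) * t) : ℂ).re = -(d * t) by simp,
        show (((y * u : ℝ) : ℂ) * Complex.I).re = 0 by simp, Real.exp_zero]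
      have h2 : |1 - y| ≤ 1 := by rw [abs_le]; constructor <;> linarith
      have h3 := hM t
      have h4 := Real.exp_pos (-(d * t))
      simp only [abs_two, mul_one]
      have : 2 * |1 - y| * |b t| ≤ 2 * M := by nlinarith [abs_nonneg (b t), abs_nonneg (1 - y)]
      nlinarith
  have hre : ∀ y t : ℝ, F y t = ((b t * Real.exp (-(d * t)) : ℝ) : ℂ) *
      (((2 * (1 - y) : ℝ) : ℂ) * Complex.exp ((y * (u - t) : ℝ) * Complex.I)) := by
    intro y t
    simp only [hF]
    have : Complex.exp (-((d + y * Complex.I) * t)) * Complex.exp ((y * u : ℝ) * Complex.I) =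
        ((Real.exp (-(d * t)) : ℝ) : ℂ) * Complex.exp ((y * (u - t) : ℝ) * Complex.I) := by
      rw [Complex.ofReal_exp, ← Complex.exp_add, ← Complex.exp_add]
      congr 1
      push_cast; ring
    push_cast at this ⊢
    linear_combination (2 * (1 - (y : ℂ)) * (b t : ℂ)) * this
  have e1 : ∫ y in Ioc (0 : ℝ) 1, ((2 * (1 - y) : ℝ) : ℂ) * H (d + y * Complex.I) *
        Complex.exp ((y * u : ℝ) * Complex.I) = ∫ t in Ioi (0 : ℝ), ∫ y in Ioc (0 : ℝ) 1, F y t := by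
    rw [← integral_integral_swap hint]
    congr 1
    ext y
    rw [hH _ (by simpa using hd), ← integral_const_mul, ← integral_mul_const]
  have hint2 : Integrable (fun t => ∫ y in Ioc (0 : ℝ) 1, F y t) (volume.restrict (Ioi (0 : ℝ))) :=
    hint.integral_prod_right
  rw [e1]
  rw [← integral_re_aux hint2]
  congr 1
  ext t
  simp only [hre]
  rw [integral_const_mul, Complex.re_ofReal_mul, ker_eq_re]

lemma ker_shift_integrable (u : ℝ) : Integrable (fun t => ker (u - t)) :=
  ker_integrable.comp_sub_left u

lemma limit_step (hb : Measurable b) (hM : ∀ t, |b t| ≤ M)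
    (hH : ∀ z : ℂ, 0 < z.re → H z = ∫ t in Ioi (0 : ℝ), (b t : ℂ) * Complex.exp (-(z * t)))
    (hc : ContinuousOn H {z | 0 ≤ z.re}) (u : ℝ) :
    (∫ y in Ioc (0 : ℝ) 1, ((2 * (1 - y) : ℝ) : ℂ) * H (y * Complex.I) *
        Complex.exp ((y * u : ℝ) * Complex.I)).re
      = ∫ t in Ioi (0 : ℝ), b t * ker (u - t) := by
  have hM0 : 0 ≤ M := (abs_nonneg _).trans (hM 0)
  have hR : Tendsto (fun d : ℝ => ∫ t in Ioi (0 : ℝ), b t * Real.exp (-(d * t)) * ker (u - t))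
      (𝓝[>] 0) (𝓝 (∫ t in Ioi (0 : ℝ), b t * ker (u - t))) := by
    refine tendsto_integral_filter_of_dominated_convergence (fun t => M * ker (u - t)) ?_ ?_ ?_ ?_
    · refine Eventually.of_forall fun d => Measurable.aestronglyMeasurable ?_
      have := ker_cont.measurable
      fun_prop
    · filter_upwards [self_mem_nhdsWithin] with d hd
      refine (ae_restrict_mem measurableSet_Ioi).mono fun t ht => ?_
      simp only [norm_mul, Real.norm_eq_abs, abs_of_nonneg (ker_nonneg _), Real.abs_exp]
      have h1 : Real.exp (-(d * t)) ≤ 1 := by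
        rw [Real.exp_le_one_iff]
        have : 0 < d * t := mul_pos hd ht
        linarith
      have := Real.exp_pos (-(d * t))
      refine mul_le_mul_of_nonneg_right ?_ (ker_nonneg _)
      nlinarith [hM t, abs_nonneg (b t)]
    · exact ((ker_shift_integrable u).const_mul M).integrableOn
    · refine Eventually.of_forall fun t => ?_
      have : Tendsto (fun d : ℝ => b t * Real.exp (-(d * t)) * ker (u - t)) (𝓝 0)
          (𝓝 (b t * Real.exp (-(0 * t)) * ker (u - t))) :=
        Continuous.tendsto (by fun_prop) 0
      simp only [zero_mul, neg_zero, Real.exp_zero, mul_one] at this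
      exact this.mono_left nhdsWithin_le_nhds
  have hL : Tendsto (fun d : ℝ => ∫ y in Ioc (0 : ℝ) 1, ((2 * (1 - y) : ℝ) : ℂ) *
        H (d + y * Complex.I) * Complex.exp ((y * u : ℝ) * Complex.I))
      (𝓝[>] 0) (𝓝 (∫ y in Ioc (0 : ℝ) 1, ((2 * (1 - y) : ℝ) : ℂ) * H (y * Complex.I) *
        Complex.exp ((y * u : ℝ) * Complex.I))) := by
    have hK : IsCompact ((fun p : ℝ × ℝ => (p.1 + p.2 * Complex.I : ℂ)) '' (Icc 0 1 ×ˢ Icc 0 1)) :=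
      (isCompact_Icc.prod isCompact_Icc).image (by fun_prop)
    obtain ⟨C, hC⟩ := hK.exists_bound_of_continuousOn (f := H) (hc.mono (by
      rintro _ ⟨⟨x, y⟩, ⟨hx, hy⟩, rfl⟩
      simpa using hx.1))
    refine tendsto_integral_filter_of_dominated_convergence (fun y => 2 * C) ?_ ?_ ?_ ?_
    · filter_upwards [self_mem_nhdsWithin] with d hd
      refine ContinuousOn.aestronglyMeasurable ?_ measurableSet_Ioc
      refine ContinuousOn.mul (ContinuousOn.mul (by fun_prop) ?_) (by fun_prop)
      refine hc.comp (by fun_prop) ?_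
      intro y _
      simpa using le_of_lt hd
    · filter_upwards [Ioc_mem_nhdsGT (zero_lt_one (α := ℝ))] with d hd
      refine (ae_restrict_mem measurableSet_Ioc).mono fun y hy => ?_
      simp only [norm_mul, Complex.norm_exp_ofReal_mul_I, Complex.norm_real, Real.norm_eq_abs,
        abs_two, mul_one]
      have h1 := hC (d + y * Complex.I) ⟨(d, y), ⟨⟨hd.1.le, hd.2⟩, ⟨hy.1.le, hy.2⟩⟩, rfl⟩
      have h2 : |1 - y| ≤ 1 := by rw [abs_le]; constructor <;> linarith [hy.1, hy.2]
      nlinarith [norm_nonneg (H (d + y * Complex.I)), abs_nonneg (1 - y)]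
    · exact integrable_const _
    · refine (ae_restrict_mem measurableSet_Ioc).mono fun y hy => ?_
      refine Tendsto.mul_const _ (Tendsto.const_mul _ ?_)
      have h1 : ContinuousWithinAt H {z | 0 ≤ z.re} (y * Complex.I) := hc _ (by simp)
      refine h1.tendsto.comp ?_
      refine tendsto_nhdsWithin_iff.2 ⟨?_, ?_⟩
      · have : Tendsto (fun d : ℝ => (d + y * Complex.I : ℂ)) (𝓝 0)
          (𝓝 (((0 : ℝ) : ℂ) + y * Complex.I)) := Continuous.tendsto (by fun_prop) 0
        simp only [Complex.ofReal_zero, zero_add] at this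
        exact this.mono_left nhdsWithin_le_nhds
      · filter_upwards [self_mem_nhdsWithin] with d hd
        simpa using le_of_lt hd
  have hL' := (Complex.continuous_re.tendsto _).comp hL
  refine tendsto_nhds_unique hL' (hR.congr' ?_)
  filter_upwards [self_mem_nhdsWithin] with d hd
  simp only [Function.comp]
  exact (fubini_step hb hM hH hd u).symm

lemma conv_tendsto (hb : Measurable b) (hM : ∀ t, |b t| ≤ M)
    (hH : ∀ z : ℂ, 0 < z.re → H z = ∫ t in Ioi (0 : ℝ), (b t : ℂ) * Complex.exp (-(z * t)))
    (hc : ContinuousOn H {z | 0 ≤ z.re}) :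
    Tendsto (fun u : ℝ => ∫ t in Ioi (0 : ℝ), b t * ker (u - t)) atTop (𝓝 0) := by
  have key := Real.tendsto_integral_exp_smul_cocompact
    ((Ioc (0 : ℝ) 1).indicator fun y : ℝ => ((2 * (1 - y) : ℝ) : ℂ) * H (y * Complex.I))
  have h2 : Tendsto (fun u : ℝ => -(u / (2 * Real.pi))) atTop (cocompact ℝ) := by
    have : Tendsto (fun u : ℝ => -(u / (2 * Real.pi))) atTop atBot :=
      tendsto_neg_atTop_atBot.comp (tendsto_id.atTop_div_const (by positivity))
    exact this.mono_right atBot_le_cocompact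
  have h3 := (Complex.continuous_re.tendsto _).comp (key.comp h2)
  rw [Complex.zero_re] at h3
  refine h3.congr fun u => ?_
  simp only [Function.comp]
  rw [← limit_step hb hM hH hc u, ← integral_indicator measurableSet_Ioc]
  congr 2
  ext y
  by_cases hy : y ∈ Ioc (0 : ℝ) 1
  · simp only [hy, indicator_of_mem]
    rw [Circle.smul_def, Real.fourierChar_apply, smul_eq_mul, mul_comm]
    congr 3
    push_cast
    have : (Real.pi : ℂ) ≠ 0 := by exact_mod_cast Real.pi_ne_zero
    field_simp
  · simp [hy]

end PNTLower

namespace PNTLower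

/-- Tauberian lower bound. -/
lemma tauberian {b : ℝ → ℝ} {M : ℝ} {H : ℂ → ℂ} (hb : Measurable b) (hM : ∀ t, |b t| ≤ M)
    (hH : ∀ z : ℂ, 0 < z.re → H z = ∫ t in Ioi (0 : ℝ), (b t : ℂ) * Complex.exp (-(z * t)))
    (hc : ContinuousOn H {z | 0 ≤ z.re})
    (hmono : ∀ s t, s ≤ t → 1 + b s ≤ Real.exp (t - s) * (1 + b t))
    {ε : ℝ} (hε : 0 < ε) (hε1 : ε < 1) : ∀ᶠ t in atTop, -ε ≤ b t := by
  have hM0 : 0 ≤ M := (abs_nonneg _).trans (hM 0)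
  set J := ∫ x, ker x with hJ
  have hJpos : 0 < J := ker_integral_pos
  -- choose R
  obtain ⟨R, hR0, hR⟩ : ∃ R : ℝ, 0 < R ∧
      (M + ε) * ∫ x, (Icc (-R) R)ᶜ.indicator ker x ≤ ε / 4 * J := by
    have h1 : Tendsto (fun R : ℝ => ∫ x in (-R)..R, ker x) atTop (𝓝 J) :=
      intervalIntegral_tendsto_integral ker_integrable tendsto_neg_atTop_atBot tendsto_id
    have h2 : Tendsto (fun R : ℝ => (M + ε) * (J - ∫ x in (-R)..R, ker x)) atTop
        (𝓝 ((M + ε) * (J - J))) := (h1.const_sub J).const_mul _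
    rw [sub_self, mul_zero] at h2
    obtain ⟨R, h3, h4⟩ := ((h2.eventually_le_const (show 0 < ε / 4 * J by positivity)).and
      (eventually_gt_atTop 0)).exists
    refine ⟨R, h4, ?_⟩
    rw [integral_indicator measurableSet_Icc.compl]
    have h5 := integral_add_compl (measurableSet_Icc (a := -R) (b := R)) ker_integrable
    rw [intervalIntegral.integral_of_le (by linarith), ← integral_Icc_eq_integral_Ioc] at h3
    have : ∫ x in (Icc (-R) R)ᶜ, ker x = J - ∫ x in Icc (-R) R, ker x := by
      rw [hJ, ← h5]; ring
    rw [this]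
    exact h3
  -- choose l
  obtain ⟨l, hl0, hl⟩ : ∃ l : ℝ, 0 < l ∧ Real.exp (2 * R / l) * (1 - ε) ≤ 1 - ε / 2 := by
    have h1 : Tendsto (fun l : ℝ => Real.exp (2 * R / l) * (1 - ε)) atTop
        (𝓝 (Real.exp 0 * (1 - ε))) :=
      ((Real.continuous_exp.tendsto 0).comp (tendsto_id.const_div_atTop _)).mul_const _
    rw [Real.exp_zero, one_mul] at h1
    obtain ⟨l, h3, h4⟩ := ((h1.eventually_le_const (show 1 - ε < 1 - ε / 2 by linarith)).and
      (eventually_gt_atTop 0)).exists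
    exact ⟨l, h4, h3⟩
  have hconv := conv_tendsto (b := fun t => b (t / l)) (M := M)
    (H := fun z => (l : ℂ) * H (l * z)) (by fun_prop) (fun t => hM _) (by
      intro z hz
      rw [hH _ (by simpa using mul_pos hl0 hz)]
      have := integral_comp_mul_left_Ioi (fun t : ℝ => (b t : ℂ) * Complex.exp (-(l * z * t))) 0
        (b := l⁻¹) (by positivity)
      rw [mul_zero, inv_inv, Complex.real_smul] at this
      rw [← this]
      congr 1
      ext t
      have hl' : (l : ℂ) ≠ 0 := by exact_mod_cast hl0.ne'
      congr 2
      · rw [div_eq_inv_mul]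
      · push_cast; field_simp) (by
      refine continuousOn_const.mul (hc.comp (by fun_prop) ?_)
      intro z hz
      simpa using mul_nonneg hl0.le hz)
  have hconv2 : Tendsto (fun t0 : ℝ => ∫ t in Ioi (0 : ℝ), b (t / l) * ker (l * t0 - R - t)) atTop
      (𝓝 0) := hconv.comp (tendsto_atTop_add_const_right _ (-R) (tendsto_id.const_mul_atTop hl0))
  filter_upwards [hconv2.eventually_const_lt (show -(ε / 4 * J) < 0 by
    have : 0 < ε / 4 * J := by positivity
    linarith), eventually_gt_atTop (2 * R / l)] with t0 ht0 ht0R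
  by_contra! hneg
  rw [div_lt_iff₀ hl0] at ht0R
  set u := l * t0 - R with hu
  have hub : ∫ t in Ioi (0 : ℝ), b (t / l) * ker (u - t) ≤
      ∫ t, (-(ε / 2) * ker (u - t) + (M + ε) * (Icc (-R) R)ᶜ.indicator ker (u - t)) := by
    have hi2 : Integrable (fun t => (Icc (-R) R)ᶜ.indicator ker (u - t)) :=
      (ker_integrable.indicator measurableSet_Icc.compl).comp_sub_left u
    rw [← integral_indicator measurableSet_Ioi]
    refine integral_mono ?_ (((ker_shift_integrable u).const_mul _).add (hi2.const_mul _)) ?_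
    · refine Integrable.indicator ?_ measurableSet_Ioi
      refine (ker_shift_integrable u).bdd_mul (c := M) ?_ ?_
      · exact Measurable.aestronglyMeasurable (by fun_prop)
      · exact Eventually.of_forall fun t => hM _
    · intro t
      have hk := ker_nonneg (u - t)
      simp only
      by_cases hmem : u - t ∈ Icc (-R) R
      · have htpos : t ∈ Ioi (0 : ℝ) := by
          have := hmem.2
          simp only [mem_Ioi]; linarith
        rw [indicator_of_mem htpos, indicator_of_notMem (by simpa using hmem)]
        have hle : t / l ≤ t0 := by
          rw [div_le_iff₀ hl0]; linarith [hmem.1]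
        have h1 := hmono _ _ hle
        have h2 : Real.exp (t0 - t / l) ≤ Real.exp (2 * R / l) := by
          apply Real.exp_le_exp.2
          rw [sub_le_iff_le_add, ← add_div, le_div_iff₀ hl0]
          linarith [hmem.2]
        have h3 : Real.exp (t0 - t / l) * (1 + b t0) ≤ Real.exp (t0 - t / l) * (1 - ε) :=
          mul_le_mul_of_nonneg_left (by linarith) (Real.exp_pos _).le
        have h4 : Real.exp (t0 - t / l) * (1 - ε) ≤ Real.exp (2 * R / l) * (1 - ε) :=
          mul_le_mul_of_nonneg_right h2 (by linarith)
        have h5 : b (t / l) ≤ -(ε / 2) := by linarith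
        rw [mul_zero, add_zero]
        exact mul_le_mul_of_nonneg_right h5 hk
      · rw [indicator_of_mem (show u - t ∈ (Icc (-R) R)ᶜ from hmem)]
        have h6 : 0 ≤ M * ker (u - t) := mul_nonneg hM0 hk
        have h7 : 0 ≤ ε * ker (u - t) := mul_nonneg hε.le hk
        by_cases htp : t ∈ Ioi (0 : ℝ)
        · rw [indicator_of_mem htp]
          have h5 : b (t / l) * ker (u - t) ≤ M * ker (u - t) :=
            mul_le_mul_of_nonneg_right ((le_abs_self _).trans (hM _)) hk
          linarith
        · rw [indicator_of_notMem htp]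
          linarith
  have hi2 : Integrable (fun t => (Icc (-R) R)ᶜ.indicator ker (u - t)) :=
    (ker_integrable.indicator measurableSet_Icc.compl).comp_sub_left u
  rw [integral_add ((ker_shift_integrable u).const_mul _) (hi2.const_mul _), integral_const_mul,
    integral_const_mul, integral_sub_left_eq_self ker, 
    integral_sub_left_eq_self ((Icc (-R) R)ᶜ.indicator ker), ← hJ] at hub
  linarith

end PNTLower

namespace PNTLower

noncomputable def bfun (t : ℝ) : ℝ := Chebyshev.psi (Real.exp t) * Real.exp (-t) - 1

noncomputable def Aux (s : ℂ) : ℂ :=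
  ArithmeticFunction.vonMangoldt.LFunctionResidueClassAux (1 : ZMod 1) s

noncomputable def Hfun (z : ℂ) : ℂ := (Aux (1 + z) - 1) / (1 + z)

lemma bfun_meas : Measurable bfun := by
  unfold bfun
  have := Chebyshev.psi_mono.measurable
  fun_prop

lemma bfun_bound (t : ℝ) : |bfun t| ≤ Real.log 4 + 4 := by
  unfold bfun
  have h1 := Chebyshev.psi_le_const_mul_self (Real.exp_pos t).le
  have h2 := Chebyshev.psi_nonneg (Real.exp t)
  have h3 := Real.exp_pos (-t)
  have h4 : Real.exp t * Real.exp (-t) = 1 := by rw [← Real.exp_add]; simp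
  have h5 : Chebyshev.psi (Real.exp t) * Real.exp (-t) ≤ Real.log 4 + 4 := by
    calc _ ≤ (Real.log 4 + 4) * Real.exp t * Real.exp (-t) :=
          mul_le_mul_of_nonneg_right h1 h3.le
      _ = _ := by rw [mul_assoc, h4, mul_one]
  have h6 : 0 ≤ Chebyshev.psi (Real.exp t) * Real.exp (-t) := mul_nonneg h2 h3.le
  have h7 : 0 ≤ Real.log 4 := Real.log_nonneg (by norm_num)
  rw [abs_le]; constructor <;> linarith

lemma bfun_mono (s t : ℝ) (h : s ≤ t) : 1 + bfun s ≤ Real.exp (t - s) * (1 + bfun t) := by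
  unfold bfun
  have h1 : Chebyshev.psi (Real.exp s) ≤ Chebyshev.psi (Real.exp t) :=
    Chebyshev.psi_mono (Real.exp_le_exp.2 h)
  have h2 : Real.exp (t - s) * Real.exp (-t) = Real.exp (-s) := by
    rw [← Real.exp_add]; congr 1; ring
  calc _ = Chebyshev.psi (Real.exp s) * Real.exp (-s) := by ring
    _ ≤ Chebyshev.psi (Real.exp t) * Real.exp (-s) :=
        mul_le_mul_of_nonneg_right h1 (Real.exp_pos _).le
    _ = _ := by rw [← h2]; ring

lemma Hfun_cont : ContinuousOn Hfun {z | 0 ≤ z.re} := by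
  unfold Hfun
  have h := ArithmeticFunction.vonMangoldt.continuousOn_LFunctionResidueClassAux (1 : ZMod 1)
  have h' : ContinuousOn Aux {s | 1 ≤ s.re} := h
  refine ContinuousOn.div ((h'.comp (by fun_prop) ?_).sub continuousOn_const) (by fun_prop) ?_
  · intro z hz
    simpa using hz
  · intro z hz h0
    have := congrArg Complex.re h0
    simp at this
    have hz' : 0 ≤ z.re := hz
    linarith

lemma Aux_eq {s : ℂ} (hs : 1 < s.re) :
    Aux s = LSeries (fun n => (ArithmeticFunction.vonMangoldt n : ℂ)) s - 1 / (s - 1) := by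
  have h := ArithmeticFunction.vonMangoldt.eqOn_LFunctionResidueClassAux (q := 1) (a := 1)
    isUnit_one hs
  unfold Aux
  rw [h]
  simp only [Nat.totient_one, Nat.cast_one, inv_one]
  congr 2
  ext n
  have : ArithmeticFunction.vonMangoldt.residueClass (1 : ZMod 1) n
      = ArithmeticFunction.vonMangoldt n := by
    unfold ArithmeticFunction.vonMangoldt.residueClass
    rw [indicator_of_mem]
    exact (Subsingleton.elim _ _ : ((n : ℕ) : ZMod 1) = 1)
  rw [this]

lemma psi_sum (t : ℝ) : ∑ k ∈ Finset.Icc 1 ⌊t⌋₊, (ArithmeticFunction.vonMangoldt k : ℝ)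
    = Chebyshev.psi t := by
  unfold Chebyshev.psi
  rfl

lemma LS_eq {s : ℂ} (hs : 1 < s.re) :
    LSeries (fun n => (ArithmeticFunction.vonMangoldt n : ℂ)) s
      = s * ∫ t in Ioi (0 : ℝ), ((Chebyshev.psi (Real.exp t) * Real.exp (-t) : ℝ) : ℂ) *
          Complex.exp (-((s - 1) * t)) := by
  have h := LSeries_eq_mul_integral_of_nonneg (fun n => ArithmeticFunction.vonMangoldt n)
    (r := 1) zero_le_one hs (by
      refine Asymptotics.IsBigO.of_bound (Real.log 4 + 4) (Eventually.of_forall fun n => ?_)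
      have h1 := psi_sum n
      rw [Nat.floor_natCast] at h1
      rw [h1, Real.norm_of_nonneg (Chebyshev.psi_nonneg _), Real.rpow_one,
        Real.norm_of_nonneg (Nat.cast_nonneg n)]
      exact Chebyshev.psi_le_const_mul_self (Nat.cast_nonneg n))
    (fun n => ArithmeticFunction.vonMangoldt_nonneg)
  rw [h]
  congr 1
  have h2 := integral_comp_exp_Ioi (fun t : ℝ =>
    (∑ k ∈ Finset.Icc 1 ⌊t⌋₊, (ArithmeticFunction.vonMangoldt k : ℂ)) * (t : ℂ) ^ (-(s + 1))) 0
  rw [Real.exp_zero] at h2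
  rw [← h2]
  congr 1
  ext t
  rw [← psi_sum, Complex.real_smul, Complex.cpow_def_of_ne_zero
    (by exact_mod_cast (Real.exp_pos t).ne'), ← Complex.ofReal_log (Real.exp_pos t).le,
    Real.log_exp]
  have : (Real.exp t : ℂ) * Complex.exp (t * -(s + 1)) =
      (Real.exp (-t) : ℂ) * Complex.exp (-((s - 1) * t)) := by
    rw [Complex.ofReal_exp, Complex.ofReal_exp, ← Complex.exp_add, ← Complex.exp_add]
    congr 1
    push_cast; ring
  push_cast at this ⊢
  linear_combination (∑ k ∈ Finset.Icc 1 ⌊Real.exp t⌋₊, (ArithmeticFunction.vonMangoldt k : ℂ)) * this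

lemma Hfun_eq (z : ℂ) (hz : 0 < z.re) :
    Hfun z = ∫ t in Ioi (0 : ℝ), (bfun t : ℂ) * Complex.exp (-(z * t)) := by
  have hexp : IntegrableOn (fun t : ℝ => Complex.exp (-(z * t))) (Ioi 0) := by
    simpa using integrableOn_exp_mul_complex_Ioi (a := -z) (by simpa using hz) 0
  have hb : IntegrableOn (fun t : ℝ => (bfun t : ℂ) * Complex.exp (-(z * t))) (Ioi 0) := by
    refine Integrable.bdd_mul (c := Real.log 4 + 4) hexp ?_ ?_
    · exact (Complex.measurable_ofReal.comp bfun_meas).aestronglyMeasurable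
    · refine Eventually.of_forall fun t => ?_
      rw [Complex.norm_real]; exact bfun_bound t
  have hI : ∫ t in Ioi (0 : ℝ), Complex.exp (-(z * t)) = 1 / z := by
    have := integral_exp_mul_complex_Ioi (a := -z) (by simpa using hz) 0
    simp only [neg_mul, Complex.ofReal_zero, mul_zero, Complex.exp_zero] at this
    rw [this, neg_div_neg_eq]
  have hs : 1 < (1 + z).re := by simpa using hz
  have hsum := LS_eq hs
  have e : ∫ t in Ioi (0 : ℝ), ((Chebyshev.psi (Real.exp t) * Real.exp (-t) : ℝ) : ℂ) *
          Complex.exp (-((1 + z - 1) * t)) =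
      (∫ t in Ioi (0 : ℝ), (bfun t : ℂ) * Complex.exp (-(z * t))) + 1 / z := by
    rw [← hI, ← integral_add hb hexp]
    congr 1
    ext t
    unfold bfun
    push_cast
    rw [add_sub_cancel_left]
    ring
  have h1z : 1 + z ≠ 0 := by
    intro h0
    rw [h0] at hs
    simp at hs
    linarith
  have hz0 : z ≠ 0 := by
    rintro rfl
    simp at hz
  unfold Hfun
  rw [Aux_eq hs, hsum, e]
  rw [add_sub_cancel_left]
  field_simp
  ring

lemma psi_lower {ε : ℝ} (hε : 0 < ε) (hε1 : ε < 1) :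
    ∀ᶠ x : ℝ in atTop, (1 - ε) * x ≤ Chebyshev.psi x := by
  have h := tauberian bfun_meas bfun_bound Hfun_eq Hfun_cont bfun_mono hε hε1
  filter_upwards [Real.tendsto_log_atTop.eventually h, eventually_gt_atTop 0] with x hx hx0
  unfold bfun at hx
  rw [Real.exp_log hx0, Real.exp_neg, Real.exp_log hx0, ← div_eq_mul_inv] at hx
  rw [← le_div_iff₀ hx0]
  linarith

end PNTLower

open PNTLower in
/-- Let `1 < c < e` and `k ≥ 0` an integer. Then there exists `N` such that for all
`n > N`, `n - π n > (log c / log n) * p_{n+k}`. -/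
theorem stmt10 (c : ℝ) (hc1 : 1 < c) (hce : c < Real.exp 1) (k : ℕ) :
    ∃ N : ℕ, ∀ n : ℕ, n > N →
      (n : ℝ) - n.primeCounting >
        (Real.log c / Real.log n) * (Nat.nth Nat.Prime (n + k - 1) : ℝ) := by
  have hL0 : 0 < Real.log c := Real.log_pos hc1
  have hL1 : Real.log c < 1 := by
    rw [Real.log_lt_iff_lt_exp (by linarith)]; exact hce
  set L := Real.log c with hL
  obtain ⟨ε, hε0, hε1, hε⟩ : ∃ ε : ℝ, 0 < ε ∧ ε < 1 ∧ L * (1 + ε) < (1 - ε) ^ 3 := by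
    have h1 : Tendsto (fun ε : ℝ => L * (1 + ε)) (𝓝[>] 0) (𝓝 (L * (1 + 0))) :=
      (Continuous.tendsto (by fun_prop) 0).mono_left nhdsWithin_le_nhds
    have h2 : Tendsto (fun ε : ℝ => (1 - ε) ^ 3) (𝓝[>] 0) (𝓝 ((1 - 0) ^ 3)) :=
      (Continuous.tendsto (by fun_prop) 0).mono_left nhdsWithin_le_nhds
    obtain ⟨ε, h3, h4⟩ := ((h1.eventually_lt h2 (by simpa using hL1)).and
      (Ioo_mem_nhdsGT (zero_lt_one (α := ℝ)))).exists
    exact ⟨ε, h4.1, h4.2, h3⟩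
  have hnat : Tendsto (fun n : ℕ => (n : ℝ)) atTop atTop := tendsto_natCast_atTop_atTop
  -- eventual facts in the prime
  have hp : ∀ᶠ x : ℝ in atTop, (1 - ε) * x ≤ Chebyshev.psi x ∧
      Real.log x ≤ (1 - ε) / 2 * x ^ ε := by
    refine (psi_lower hε0 hε1).and ?_
    have := (isLittleO_log_rpow_atTop hε0).bound (show 0 < (1 - ε) / 2 by linarith)
    filter_upwards [this, eventually_ge_atTop 1] with x hx hx1
    rw [Real.norm_of_nonneg (Real.log_nonneg hx1),
      Real.norm_of_nonneg (Real.rpow_nonneg (by linarith) _)] at hx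
    exact hx
  obtain ⟨X, hX⟩ := eventually_atTop.1 hp
  have hpi : ∀ᶠ n : ℕ in atTop, (n.primeCounting : ℝ) ≤ ε * n := by
    have h1 := hnat.eventually (Chebyshev.eventually_primeCounting_le (ε := 1) one_pos)
    have h2 := hnat.eventually (Real.tendsto_log_atTop.eventually_ge_atTop ((Real.log 4 + 1) / ε))
    filter_upwards [h1, h2, eventually_gt_atTop 1] with n hn1 hn2 hn3
    rw [Nat.floor_natCast] at hn1
    have hlog : 0 < Real.log n := Real.log_pos (by exact_mod_cast hn3)
    refine hn1.trans ?_
    rw [div_le_iff₀ hlog]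
    rw [div_le_iff₀ hε0] at hn2
    have : (0 : ℝ) ≤ n := Nat.cast_nonneg n
    nlinarith
  have hk : ∀ᶠ n : ℕ in atTop, (k : ℝ) ≤ ε * n :=
    (hnat.const_mul_atTop hε0).eventually_ge_atTop _
  have hev : ∀ᶠ n : ℕ in atTop, (n : ℝ) - n.primeCounting >
        (L / Real.log n) * (Nat.nth Nat.Prime (n + k - 1) : ℝ) := by
    filter_upwards [hpi, hk, eventually_gt_atTop 1, hnat.eventually_ge_atTop X]
      with n hpin hkn hn1 hnX
    set p := Nat.nth Nat.Prime (n + k - 1) with hpdef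
    have hn1' : (1 : ℝ) < n := by exact_mod_cast hn1
    have hlog : 0 < Real.log n := Real.log_pos hn1'
    have hcount : p.primeCounting = n + k := by
      unfold Nat.primeCounting Nat.primeCounting'
      rw [hpdef, Nat.count_nth_succ (fun hf => absurd hf Nat.infinite_setOfPred_prime)]
      omega
    have hple : n ≤ p := by
      have : n + k - 1 + 2 ≤ p := Nat.add_two_le_nth_prime _
      omega
    have hp1 : (1 : ℝ) < p := hn1'.trans_le (by exact_mod_cast hple)
    have hp0 : (0 : ℝ) < p := by linarith
    obtain ⟨hpsi, hlogp⟩ := hX p (hnX.trans (by exact_mod_cast hple))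
    have hpp := Chebyshev.psi_le_primeCounting_mul_log p
    rw [hcount] at hpp
    push_cast at hpp
    have hlp : 0 < Real.log p := Real.log_pos hp1
    have h1 : (1 - ε) * p ≤ (n + k) * Real.log p := hpsi.trans hpp
    have h2 : (p : ℝ) ≤ n * (p : ℝ) ^ ε := by
      have hnk : (n : ℝ) + k ≤ 2 * n := by nlinarith
      have : (n + k) * Real.log p ≤ (2 * n) * ((1 - ε) / 2 * (p : ℝ) ^ ε) :=
        mul_le_mul hnk hlogp hlp.le (by positivity)
      have h3 : (1 - ε) * p ≤ (1 - ε) * (n * (p : ℝ) ^ ε) := by linarith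
      exact le_of_mul_le_mul_left h3 (by linarith)
    have h3 : (1 - ε) * Real.log p ≤ Real.log n := by
      have := Real.log_le_log hp0 h2
      rw [Real.log_mul (by positivity) (by positivity), Real.log_rpow hp0] at this
      linarith
    have h4 : (1 - ε) ^ 2 * p ≤ (n + k) * Real.log n := by
      have a1 := mul_le_mul_of_nonneg_left h1 (show 0 ≤ 1 - ε by linarith)
      have a2 := mul_le_mul_of_nonneg_left h3 (show (0 : ℝ) ≤ n + k by positivity)
      nlinarith
    have h5 : (1 - ε) ^ 2 * p ≤ (1 + ε) * (n * Real.log n) := by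
      have := mul_le_mul_of_nonneg_right hkn hlog.le
      linarith
    have hnl : 0 < n * Real.log n := by positivity
    have h6 : L * p < (1 - ε) * (n * Real.log n) := by
      have a1 := mul_le_mul_of_nonneg_left h5 hL0.le
      have a2 := mul_lt_mul_of_pos_right hε hnl
      have a3 : (1 - ε) ^ 2 * (L * p) < (1 - ε) ^ 2 * ((1 - ε) * (n * Real.log n)) := by
        linarith
      exact lt_of_mul_lt_mul_left a3 (by positivity)
    rw [gt_iff_lt, div_mul_eq_mul_div, div_lt_iff₀ hlog]
    have := mul_le_mul_of_nonneg_right hpin hlog.le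
    linarith
  obtain ⟨N, hN⟩ := eventually_atTop.1 hev
  exact ⟨N, fun n hn => hN n hn.le⟩
end
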